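/- arXiv:2503.18618 — 2 statements merged into one kernel-verified Lean document; each statement's English description precedes it below -/
import Mathlib

section
/- Fix n ≥ 1 and consider the first-order language L consisting of the ring language (constants 0, 1, binary functions +, ·) together with two unary function symbols tr and *, and a binary relation symbol ≤. Make Mat_n(ℝ) an L-structure by interpreting the ring symbols as matrix addition and multiplication, tr as the map A ↦ (trace of A)·I, * as matrix transposition, and ≤ as the Loewner order (A ≤ B iff B − A is positive semidefinite). Then this structure admits quantifier elimination: for every L-formula φ(x_1,…,x_m) there is a quantifier-free L-formula ψ(x_1,…,x_m) defining the same subset of Mat_n(ℝ)^m. -/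
open FirstOrder FirstOrder.Language Matrix

/-- Function symbols of the language of rings extended by unary `tr` and `*`. -/
inductive MatFunc : ℕ → Type
  | zero : MatFunc 0
  | one : MatFunc 0
  | add : MatFunc 2
  | mul : MatFunc 2
  | tr : MatFunc 1
  | star : MatFunc 1

/-- Relation symbols: a single binary relation `≤`. -/
inductive MatRel : ℕ → Type
  | le : MatRel 2

/-- The language of rings extended by unary function symbols `tr`, `*` and a binary
relation symbol `≤`. -/
def matLang : Language := ⟨MatFunc, MatRel⟩

/-- `Mat_n(ℝ)` as a `matLang`-structure: ring symbols as matrix operations, `tr` as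
`A ↦ trace(A) • I`, `*` as transposition, `≤` as the Loewner order. -/
noncomputable instance matStructureReal (n : ℕ) :
    matLang.Structure (Matrix (Fin n) (Fin n) ℝ) where
  funMap {arity} f x :=
    match f, x with
    | .zero, _ => 0
    | .one, _ => 1
    | .add, x => x 0 + x 1
    | .mul, x => x 0 * x 1
    | .tr, x => (x 0).trace • (1 : Matrix (Fin n) (Fin n) ℝ)
    | .star, x => (x 0)ᵀ
  RelMap {arity} r x :=
    match r, x with
    | .le, x => (x 1 - x 0).PosSemidef

theorem exists_orderIso_glue (φ ψ : ℝ ≃o ℝ) (c : ℝ) (h : φ c = ψ c) :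
    ∃ θ : ℝ ≃o ℝ, (∀ t ≤ c, θ t = φ t) ∧ ∀ t, c ≤ t → θ t = ψ t := by
  have hmono : StrictMono fun t => if t ≤ c then φ t else ψ t := by
    intro s t hst
    dsimp only
    split_ifs with h1 h2 h2
    · exact φ.strictMono hst
    · calc φ s ≤ φ c := φ.monotone h1
        _ = ψ c := h
        _ < ψ t := ψ.strictMono (not_le.1 h2)
    · linarith
    · exact ψ.strictMono hst
  have hsurj : Function.Surjective fun t => if t ≤ c then φ t else ψ t := by
    intro y
    rcases le_total y (φ c) with hy | hy
    · refine ⟨φ.symm y, ?_⟩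
      have : φ.symm y ≤ c := by simpa using φ.symm.monotone hy
      simp [this]
    · refine ⟨ψ.symm y, ?_⟩
      have h2 : c ≤ ψ.symm y := by rw [h] at hy; simpa using ψ.symm.monotone hy
      rcases h2.eq_or_lt with h3 | h3
      · simp only [← h3, le_refl, if_true, h]
        rw [h3]; simp
      · simp [not_le.2 h3]
  refine ⟨hmono.orderIsoOfSurjective _ hsurj, fun t ht => ?_, fun t ht => ?_⟩
  · simp [ht]
  · rcases ht.eq_or_lt with rfl | h3
    · simp [h]
    · simp [not_le.2 h3]

theorem exists_orderIso_affine {a b a' b' : ℝ} (h : a < b) (h' : a' < b') :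
    ∃ θ : ℝ ≃o ℝ, θ a = a' ∧ θ b = b' := by
  have hk : 0 < (b' - a') / (b - a) := div_pos (by linarith) (by linarith)
  have hba : b - a ≠ 0 := by linarith
  have hmono : StrictMono fun t => a' + (t - a) * ((b' - a') / (b - a)) := by
    intro s t hst
    have := mul_lt_mul_of_pos_right (sub_lt_sub_right hst a) hk
    dsimp only
    linarith
  refine ⟨hmono.orderIsoOfSurjective _ fun y =>
    ⟨a + (y - a') / ((b' - a') / (b - a)), ?_⟩, ?_, ?_⟩
  · have : ((b' - a') / (b - a)) ≠ 0 := hk.ne'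
    simp only [add_sub_cancel_left]
    rw [div_mul_cancel₀ _ this]
    ring
  · show a' + (a - a) * _ = a'
    ring
  · show a' + (b - a) * _ = b'
    rw [mul_div_cancel₀ _ hba]
    ring

theorem exists_orderIso_bump {a b z z' : ℝ} (hz : z ∈ Set.Ioo a b) (hz' : z' ∈ Set.Ioo a b) :
    ∃ θ : ℝ ≃o ℝ, (∀ t ≤ a, θ t = t) ∧ (∀ t, b ≤ t → θ t = t) ∧ θ z = z' := by
  obtain ⟨α, hα, hα'⟩ := exists_orderIso_affine hz.1 hz'.1
  obtain ⟨β, hβ, hβ'⟩ := exists_orderIso_affine hz.2 hz'.2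
  obtain ⟨γ, hγ, hγ'⟩ := exists_orderIso_glue (.refl ℝ) α a (by simp [hα])
  have hγz : γ z = z' := by rw [hγ' _ hz.1.le, hα']
  obtain ⟨δ, hδ, hδ'⟩ := exists_orderIso_glue γ β z (by rw [hγz, hβ])
  have hδb : δ b = b := by rw [hδ' _ hz.2.le, hβ']
  obtain ⟨ε, hε, hε'⟩ := exists_orderIso_glue δ (.refl ℝ) b (by simp [hδb])
  refine ⟨ε, fun t ht => ?_, fun t ht => by simp [hε' t ht], ?_⟩
  · rw [hε _ (by linarith [hz.1, hz.2]), hδ _ (by linarith [hz.1]), hγ _ ht]; rfl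
  · rw [hε _ hz.2.le, hδ _ le_rfl, hγz]

theorem sign_eq_of_continuous_of_ne_zero {f : ℝ → ℝ} (hf : Continuous f) {a b : ℝ}
    (h : ∀ t ∈ Set.uIcc a b, f t ≠ 0) : SignType.sign (f a) = SignType.sign (f b) := by
  by_contra hne
  have ha := h a Set.left_mem_uIcc
  have hb := h b Set.right_mem_uIcc
  have h0 : (0 : ℝ) ∈ Set.uIcc (f a) (f b) := by
    rw [Set.mem_uIcc]
    rcases lt_or_gt_of_ne ha with h1 | h1 <;> rcases lt_or_gt_of_ne hb with h2 | h2
    · simp [sign_neg h1, sign_neg h2] at hne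
    · exact Or.inl ⟨h1.le, h2.le⟩
    · exact Or.inr ⟨h2.le, h1.le⟩
    · simp [sign_pos h1, sign_pos h2] at hne
  obtain ⟨t, ht, h0⟩ := intermediate_value_uIcc hf.continuousOn h0
  exact h t ht h0

theorem exists_orderIso_sign_eq_of_strictMonoOn {f g : ℝ → ℝ} (hf : Continuous f)
    (hg : Continuous g) {a b : ℝ} (hab : a < b) (hfm : StrictMonoOn f (Set.Icc a b))
    (hgm : StrictMonoOn g (Set.Icc a b)) (ha : SignType.sign (f a) = SignType.sign (g a))
    (hb : SignType.sign (f b) = SignType.sign (g b)) :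
    ∃ θ : ℝ ≃o ℝ, (∀ t ≤ a, θ t = t) ∧ (∀ t, b ≤ t → θ t = t) ∧
      ∀ t ∈ Set.Icc a b, SignType.sign (f t) = SignType.sign (g (θ t)) := by
  have hale : a ∈ Set.Icc a b := Set.left_mem_Icc.2 hab.le
  have hble : b ∈ Set.Icc a b := Set.right_mem_Icc.2 hab.le
  by_cases hpos : 0 ≤ f a
  · have hpos' : 0 ≤ g a := by
      rw [← sign_nonneg_iff, ← ha, sign_nonneg_iff]; exact hpos
    refine ⟨.refl ℝ, by simp, by simp, fun t ht => ?_⟩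
    rcases ht.1.eq_or_lt with rfl | h1
    · simpa using ha
    · have h2 := hfm hale ht h1
      have h3 := hgm hale ht h1
      simp [sign_pos (hpos.trans_lt h2), sign_pos (hpos'.trans_lt h3)]
  by_cases hneg : f b ≤ 0
  · have hneg' : g b ≤ 0 := by
      rw [← sign_nonpos_iff, ← hb, sign_nonpos_iff]; exact hneg
    refine ⟨.refl ℝ, by simp, by simp, fun t ht => ?_⟩
    rcases ht.2.eq_or_lt with rfl | h1
    · simpa using hb
    · have h2 := hfm ht hble h1
      have h3 := hgm ht hble h1
      simp [sign_neg (h2.trans_le hneg), sign_neg (h3.trans_le hneg')]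
  push Not at hpos hneg
  have hpos' : g a < 0 := by rw [← sign_eq_neg_one_iff, ← ha, sign_neg hpos]
  have hneg' : 0 < g b := by rw [← sign_eq_one_iff, ← hb, sign_pos hneg]
  obtain ⟨z, hz, hfz⟩ := intermediate_value_Ioo hab.le hf.continuousOn ⟨hpos, hneg⟩
  obtain ⟨z', hz', hgz⟩ := intermediate_value_Ioo hab.le hg.continuousOn ⟨hpos', hneg'⟩
  obtain ⟨θ, h1, h2, h3⟩ := exists_orderIso_bump hz hz'
  refine ⟨θ, h1, h2, fun t ht => ?_⟩
  have hθ : θ t ∈ Set.Icc a b :=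
    ⟨by simpa [h1 a le_rfl] using θ.monotone ht.1, by simpa [h2 b le_rfl] using θ.monotone ht.2⟩
  rcases lt_trichotomy t z with h4 | rfl | h4
  · have h5 := hfm ht (Set.Ioo_subset_Icc_self hz) h4
    have h6 := hgm hθ (Set.Ioo_subset_Icc_self hz') (by rw [← h3]; exact θ.strictMono h4)
    rw [sign_neg (hfz ▸ h5), sign_neg (hgz ▸ h6)]
  · rw [h3, hfz, hgz]
  · have h5 := hfm (Set.Ioo_subset_Icc_self hz) ht h4
    have h6 := hgm (Set.Ioo_subset_Icc_self hz') hθ (by rw [← h3]; exact θ.strictMono h4)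
    rw [sign_pos (hfz ▸ h5), sign_pos (hgz ▸ h6)]

theorem exists_orderIso_sign_eq_of_gap {f g : ℝ → ℝ} (hf : Continuous f)
    (hg : Continuous g) {a b : ℝ} (hab : a < b)
    (hm : StrictMonoOn f (Set.Icc a b) ∧ StrictMonoOn g (Set.Icc a b) ∨
      StrictAntiOn f (Set.Icc a b) ∧ StrictAntiOn g (Set.Icc a b))
    (ha : SignType.sign (f a) = SignType.sign (g a))
    (hb : SignType.sign (f b) = SignType.sign (g b)) :
    ∃ θ : ℝ ≃o ℝ, (∀ t ≤ a, θ t = t) ∧ (∀ t, b ≤ t → θ t = t) ∧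
      ∀ t ∈ Set.Icc a b, SignType.sign (f t) = SignType.sign (g (θ t)) := by
  rcases hm with ⟨h1, h2⟩ | ⟨h1, h2⟩
  · exact exists_orderIso_sign_eq_of_strictMonoOn hf hg hab h1 h2 ha hb
  · simpa [Left.sign_neg] using exists_orderIso_sign_eq_of_strictMonoOn hf.neg hg.neg hab
      h1.neg h2.neg (by simpa [Left.sign_neg] using ha) (by simpa [Left.sign_neg] using hb)

theorem exists_orderIso_sign_eq_of_finset {f g : ℝ → ℝ} (hf : Continuous f)
    (hg : Continuous g) (T : Finset ℝ)
    (hm : ∀ a ∈ T, ∀ b ∈ T, a < b → (∀ t ∈ T, t ∉ Set.Ioo a b) →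
      StrictMonoOn f (Set.Icc a b) ∧ StrictMonoOn g (Set.Icc a b) ∨
      StrictAntiOn f (Set.Icc a b) ∧ StrictAntiOn g (Set.Icc a b))
    (hT : ∀ t ∈ T, SignType.sign (f t) = SignType.sign (g t)) :
    ∃ θ : ℝ ≃o ℝ, (∀ t ∈ T, θ t = t) ∧ (∀ t, (∀ a ∈ T, t ≤ a) → θ t = t) ∧
      (∀ t, (∀ a ∈ T, a ≤ t) → θ t = t) ∧
      ∀ a ∈ T, ∀ b ∈ T, ∀ t ∈ Set.Icc a b, SignType.sign (f t) = SignType.sign (g (θ t)) := by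
  induction T using Finset.induction_on_max with
  | empty => exact ⟨.refl ℝ, by simp⟩
  | insert b T hlt ih =>
    rcases T.eq_empty_or_nonempty with rfl | hne
    · refine ⟨.refl ℝ, by simp, by simp, by simp, fun x hx y hy t ht => ?_⟩
      simp only [insert_empty_eq, Finset.mem_singleton] at hx hy
      subst hx hy
      rw [le_antisymm ht.2 ht.1]
      simpa using hT
    obtain ⟨θ, h1, h2, h3, h4⟩ := ih
      (fun x hx y hy hxy hgap => hm x (by simp [hx]) y (by simp [hy]) hxy fun t ht => by
        rcases Finset.mem_insert.1 ht with rfl | ht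
        · exact fun h => (h.2.trans (hlt y hy)).false
        · exact hgap t ht)
      (fun t ht => hT t (by simp [ht]))
    set a := T.max' hne with ha
    have haT : a ∈ T := T.max'_mem hne
    have hmax : ∀ t ∈ T, t ≤ a := fun t ht => T.le_max' t ht
    have hab : a < b := hlt a haT
    obtain ⟨η, e1, e2, e3⟩ := exists_orderIso_sign_eq_of_gap hf hg hab
      (hm a (by simp [haT]) b (by simp) hab fun t ht => by
        rcases Finset.mem_insert.1 ht with rfl | ht
        · exact fun h => h.2.false
        · exact fun h => (h.1.trans_le (hmax t ht)).false)
      (hT a (by simp [haT])) (hT b (by simp))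
    obtain ⟨ψ, q1, q2⟩ := exists_orderIso_glue θ η a (by rw [h1 a haT, e1 a le_rfl])
    refine ⟨ψ, fun t ht => ?_, fun t ht => ?_, fun t ht => ?_, fun x hx y hy t ht => ?_⟩
    · rcases Finset.mem_insert.1 ht with rfl | ht
      · rw [q2 _ hab.le, e2 _ le_rfl]
      · rw [q1 _ (hmax t ht), h1 t ht]
    · rw [q1 _ (ht a (by simp [haT])), h2 t fun x hx => ht x (by simp [hx])]
    · have := ht b (by simp)
      rw [q2 _ (hab.le.trans this), e2 _ this]
    · rcases le_total t a with hta | hta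
      · rw [q1 _ hta]
        rcases Finset.mem_insert.1 hx with rfl | hx
        · linarith [ht.1]
        · exact h4 x hx a haT t ⟨ht.1, hta⟩
      · rw [q2 _ hta]
        refine e3 t ⟨hta, ht.2.trans ?_⟩
        rcases Finset.mem_insert.1 hy with rfl | hy
        · exact le_rfl
        · exact (hlt y hy).le

section SignPatterns

open Polynomial

theorem Polynomial.exists_sign_eval_eq_sign_leadingCoeff (p : ℝ[X]) :
    ∃ M, ∀ t, M ≤ t → SignType.sign (p.eval t) = SignType.sign p.leadingCoeff := by
  rw [← Filter.eventually_atTop]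
  rcases Nat.eq_zero_or_pos p.natDegree with h0 | h0
  · rw [Polynomial.eq_C_of_natDegree_eq_zero h0]; simp
  have hd : 0 < p.degree := Polynomial.natDegree_pos_iff_degree_pos.1 h0
  rcases lt_trichotomy p.leadingCoeff 0 with h | h | h
  · filter_upwards [(p.tendsto_atBot_of_leadingCoeff_nonpos hd h.le).eventually_lt_atBot 0] with t ht
    rw [sign_neg ht, sign_neg h]
  · rw [Polynomial.leadingCoeff_eq_zero] at h; simp [h]
  · filter_upwards [(p.tendsto_atTop_of_leadingCoeff_nonneg hd h.le).eventually_gt_atTop 0] with t ht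
    rw [sign_pos ht, sign_pos h]

theorem Polynomial.exists_sign_eval_eq_of_le_neg (p : ℝ[X]) :
    ∃ M, ∀ t, t ≤ -M → SignType.sign (p.eval t) =
      SignType.sign ((-1) ^ p.natDegree * p.leadingCoeff) := by
  obtain ⟨M, hM⟩ := (p.comp (-X)).exists_sign_eval_eq_sign_leadingCoeff
  refine ⟨M, fun t ht => ?_⟩
  have := hM (-t) (by linarith)
  rw [Polynomial.leadingCoeff_comp (by simp)] at this
  simpa [mul_comm] using this

theorem Polynomial.strictMonoOn_or_strictAntiOn {p : ℝ[X]} {a b : ℝ}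
    (h : ∀ t ∈ Set.Ioo a b, p.derivative.eval t ≠ 0) :
    (∀ t ∈ Set.Ioo a b, 0 < p.derivative.eval t) ∨ (∀ t ∈ Set.Ioo a b, p.derivative.eval t < 0) := by
  by_contra! hc
  obtain ⟨⟨s, hs, hs'⟩, ⟨t, ht, ht'⟩⟩ := hc
  have hst : ∀ u ∈ Set.uIcc s t, p.derivative.eval u ≠ 0 := fun u hu =>
    h u (Set.OrdConnected.uIcc_subset Set.ordConnected_Ioo hs ht hu)
  have := sign_eq_of_continuous_of_ne_zero p.derivative.continuous hst
  rw [sign_neg (lt_of_le_of_ne hs' (h s hs)), sign_pos (lt_of_le_of_ne ht' (h t ht).symm)] at this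
  simp at this

theorem Polynomial.strictMonoOn_of_derivative_pos {p : ℝ[X]} {a b : ℝ}
    (h : ∀ t ∈ Set.Ioo a b, 0 < p.derivative.eval t) :
    StrictMonoOn (fun t => p.eval t) (Set.Icc a b) :=
  strictMonoOn_of_deriv_pos (convex_Icc a b) p.continuous.continuousOn fun t ht => by
    rw [interior_Icc] at ht; simpa using h t ht

theorem Polynomial.strictAntiOn_of_derivative_neg {p : ℝ[X]} {a b : ℝ}
    (h : ∀ t ∈ Set.Ioo a b, p.derivative.eval t < 0) :
    StrictAntiOn (fun t => p.eval t) (Set.Icc a b) :=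
  strictAntiOn_of_deriv_neg (convex_Icc a b) p.continuous.continuousOn fun t ht => by
    rw [interior_Icc] at ht; simpa using h t ht

theorem Polynomial.exists_orderIso_sign_eval_eq {p q : ℝ[X]} (hdeg : p.natDegree = q.natDegree)
    (hlc : SignType.sign p.leadingCoeff = SignType.sign q.leadingCoeff)
    (φ : ℝ ≃o ℝ) (T : Finset ℝ)
    (hT : ∀ t ∈ T, SignType.sign (p.eval t) = SignType.sign (q.eval (φ t)))
    (hder : ∀ t, SignType.sign (p.derivative.eval t) = SignType.sign (q.derivative.eval (φ t)))
    (hroots : ∀ t, p.derivative.eval t = 0 → t ∈ T) :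
    ∃ ψ : ℝ ≃o ℝ, (∀ t ∈ T, ψ t = φ t) ∧
      ∀ t, SignType.sign (p.eval t) = SignType.sign (q.eval (ψ t)) := by
  obtain ⟨M₁, hM₁⟩ := p.exists_sign_eval_eq_sign_leadingCoeff
  obtain ⟨M₂, hM₂⟩ := q.exists_sign_eval_eq_sign_leadingCoeff
  obtain ⟨M₃, hM₃⟩ := p.exists_sign_eval_eq_of_le_neg
  obtain ⟨M₄, hM₄⟩ := q.exists_sign_eval_eq_of_le_neg
  set A := max M₁ (φ.symm M₂)
  set B := min (-M₃) (φ.symm (-M₄))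
  have hA : ∀ t, A ≤ t → SignType.sign (p.eval t) = SignType.sign (q.eval (φ t)) := fun t ht => by
    rw [hM₁ t ((le_max_left _ _).trans ht), hM₂, hlc]
    simpa using φ.monotone ((le_max_right _ _).trans ht)
  have hB : ∀ t, t ≤ B → SignType.sign (p.eval t) = SignType.sign (q.eval (φ t)) := fun t ht => by
    rw [hM₃ t (ht.trans (min_le_left _ _)), hM₄, sign_mul, sign_mul, hlc, hdeg]
    simpa using φ.monotone (ht.trans (min_le_right _ _))
  have hgap : ∀ a ∈ insert A (insert B T), ∀ b ∈ insert A (insert B T), a < b →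
      (∀ t ∈ insert A (insert B T), t ∉ Set.Ioo a b) →
      StrictMonoOn (fun t => p.eval t) (Set.Icc a b) ∧
        StrictMonoOn (fun t => q.eval (φ t)) (Set.Icc a b) ∨
      StrictAntiOn (fun t => p.eval t) (Set.Icc a b) ∧
        StrictAntiOn (fun t => q.eval (φ t)) (Set.Icc a b) := by
    intro a _ b _ hab hgap
    have hne : ∀ t ∈ Set.Ioo a b, p.derivative.eval t ≠ 0 := fun t ht h0 =>
      hgap t (by simp [hroots t h0]) ht
    have hsymm : ∀ s ∈ Set.Ioo (φ a) (φ b), φ.symm s ∈ Set.Ioo a b := fun s hs =>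
      ⟨by simpa using φ.symm.strictMono hs.1, by simpa using φ.symm.strictMono hs.2⟩
    have hmaps : Set.MapsTo φ (Set.Icc a b) (Set.Icc (φ a) (φ b)) := fun s hs =>
      ⟨φ.monotone hs.1, φ.monotone hs.2⟩
    rcases Polynomial.strictMonoOn_or_strictAntiOn hne with hs | hs
    · refine Or.inl ⟨strictMonoOn_of_derivative_pos hs,
        (strictMonoOn_of_derivative_pos fun s hs' => ?_).comp (φ.strictMono.strictMonoOn _) hmaps⟩
      have h5 := hder (φ.symm s)
      rw [sign_pos (hs _ (hsymm s hs'))] at h5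
      simpa using (sign_eq_one_iff.1 h5.symm)
    · refine Or.inr ⟨strictAntiOn_of_derivative_neg hs,
        (strictAntiOn_of_derivative_neg fun s hs' => ?_).comp_strictMonoOn
          (φ.strictMono.strictMonoOn _) hmaps⟩
      have h5 := hder (φ.symm s)
      rw [sign_neg (hs _ (hsymm s hs'))] at h5
      simpa using (sign_eq_neg_one_iff.1 h5.symm)
  have hsign : ∀ t ∈ insert A (insert B T),
      SignType.sign (p.eval t) = SignType.sign (q.eval (φ t)) := by
    intro t ht
    simp only [Finset.mem_insert] at ht
    rcases ht with ht | ht | ht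
    · exact ht ▸ hA _ le_rfl
    · exact ht ▸ hB _ le_rfl
    · exact hT t ht
  obtain ⟨θ, h1, h2, h3, h4⟩ := exists_orderIso_sign_eq_of_finset p.continuous
    (q.continuous.comp φ.continuous) (insert A (insert B T)) hgap hsign
  refine ⟨θ.trans φ, fun t ht => ?_, fun t => ?_⟩
  · simp [h1 t (by simp [ht])]
  · by_cases hlo : ∀ a ∈ insert A (insert B T), t ≤ a
    · simpa [h2 t hlo] using hB t (hlo B (by simp))
    by_cases hhi : ∀ a ∈ insert A (insert B T), a ≤ t
    · simpa [h3 t hhi] using hA t (hhi A (by simp))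
    push Not at hlo hhi
    obtain ⟨a, ha, hat⟩ := hlo
    obtain ⟨b, hb, hbt⟩ := hhi
    exact h4 a ha b hb t ⟨hat.le, hbt.le⟩

section SignDetermination

variable {R : Type*} [CommRing R]

/-- The single-step pseudo-remainder of `p` by the truncation of `q` to degree at most `j`. -/
noncomputable def Polynomial.reduceBy (p q : R[X]) (j : ℕ) : R[X] :=
  C (q.coeff j) * p.eraseLead -
    C p.leadingCoeff * X ^ (p.natDegree - j) * ∑ i ∈ Finset.range j, C (q.coeff i) * X ^ i

theorem Polynomial.natDegree_reduceBy_lt {p : R[X]} (hp : 0 < p.natDegree) (q : R[X]) {j : ℕ}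
    (hj : j ≤ p.natDegree) : (p.reduceBy q j).natDegree < p.natDegree := by
  have h1 : (C (q.coeff j) * p.eraseLead).natDegree ≤ p.natDegree - 1 :=
    (natDegree_C_mul_le _ _).trans p.eraseLead_natDegree_le
  have h2 : (C p.leadingCoeff * X ^ (p.natDegree - j) *
      ∑ i ∈ Finset.range j, C (q.coeff i) * X ^ i).natDegree ≤ p.natDegree - 1 := by
    rcases Nat.eq_zero_or_pos j with rfl | hj0
    · simp
    · have h3 : (∑ i ∈ Finset.range j, C (q.coeff i) * X ^ i).natDegree ≤ j - 1 :=
        natDegree_sum_le_of_forall_le _ _ fun i hi =>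
          (natDegree_C_mul_X_pow_le _ _).trans (by have := Finset.mem_range.1 hi; omega)
      have h4 := natDegree_C_mul_X_pow_le p.leadingCoeff (p.natDegree - j)
      exact natDegree_mul_le.trans (by omega)
  have := natDegree_sub_le_of_le h1 h2
  simp only [max_self] at this
  exact this.trans_lt (by omega)

theorem Polynomial.eval₂_reduceBy {S : Type*} [CommRing S] (e : R →+* S) {p q : R[X]} {j : ℕ}
    (hj : j ≤ p.natDegree) {t : S} (hq : (q.map e).natDegree ≤ j) (h0 : q.eval₂ e t = 0) :
    (p.reduceBy q j).eval₂ e t = e (q.coeff j) * p.eval₂ e t := by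
  have h1 : e (q.coeff j) * t ^ j + ∑ i ∈ Finset.range j, e (q.coeff i) * t ^ i = 0 := by
    rw [← h0, ← eval_map, eval_eq_sum_range' (n := j + 1) (by omega), Finset.sum_range_succ]
    simp [add_comm]
  have h2 : p.eval₂ e t = p.eraseLead.eval₂ e t + e p.leadingCoeff * t ^ p.natDegree := by
    have := congrArg (eval₂ e t) p.eraseLead_add_C_mul_X_pow
    simp only [eval₂_add, eval₂_mul, eval₂_C, eval₂_pow, eval₂_X] at this
    exact this.symm
  have h3 : t ^ p.natDegree = t ^ (p.natDegree - j) * t ^ j := by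
    rw [← pow_add, Nat.sub_add_cancel hj]
  rw [reduceBy, h2, h3]
  simp only [eval₂_sub, eval₂_mul, eval₂_C, eval₂_pow, eval₂_X, eval₂_finsetSum]
  linear_combination -e p.leadingCoeff * t ^ (p.natDegree - j) * h1

/-- The signs at `e` and `e'` of the elements of the finite set `T` agree. -/
def SignAgree (T : Finset R) (e e' : R →+* ℝ) : Prop :=
  ∀ r ∈ T, SignType.sign (e r) = SignType.sign (e' r)

/-- The sign diagrams of the family `F` specialised at `e` and at `e'` correspond under an
increasing bijection of the real line. -/
def SignDiagramEquiv (F : Finset R[X]) (e e' : R →+* ℝ) : Prop :=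
  ∃ φ : ℝ ≃o ℝ, ∀ p ∈ F, ∀ t,
    SignType.sign (p.eval₂ e t) = SignType.sign (p.eval₂ e' (φ t))

theorem natDegree_map_eq_of_sign_coeff_eq {e e' : R →+* ℝ} {q : R[X]}
    (h : ∀ i, SignType.sign (e (q.coeff i)) = SignType.sign (e' (q.coeff i))) :
    (q.map e).natDegree = (q.map e').natDegree := by
  have hs : (q.map e).support = (q.map e').support := by
    ext i
    rw [mem_support_iff, mem_support_iff, coeff_map, coeff_map, not_iff_not,
      ← sign_eq_zero_iff, h, sign_eq_zero_iff]
  rw [natDegree, natDegree, degree, degree, hs]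

open Classical in
theorem signDiagramEquiv_insert {d : ℕ} (hd : 0 < d) {p : R[X]} (hp : p.natDegree = d)
    (F : Finset R[X]) (hF : ∀ q ∈ F, q.natDegree ≤ d)
    {e e' : R →+* ℝ}
    (hFe : SignDiagramEquiv (F ∪ {p.derivative, p.eraseLead} ∪
      (insert p.derivative F ×ˢ Finset.range (d + 1)).image fun x => p.reduceBy x.1 x.2) e e')
    (hT : SignAgree ((insert p (insert p.derivative F) ×ˢ Finset.range (d + 1)).image
      fun x => x.1.coeff x.2) e e') :
    SignDiagramEquiv (insert p F) e e' := by
  obtain ⟨φ, hφ⟩ := hFe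
  have hF' : ∀ q ∈ insert p (insert p.derivative F), q.natDegree ≤ d := by
    intro q hq
    simp only [Finset.mem_insert] at hq
    rcases hq with rfl | rfl | hq
    · exact hp.le
    · exact (natDegree_derivative_le p).trans (by omega)
    · exact hF q hq
  have hcoeff : ∀ q ∈ insert p (insert p.derivative F), ∀ i,
      SignType.sign (e (q.coeff i)) = SignType.sign (e' (q.coeff i)) := by
    intro q hq i
    by_cases hi : i ≤ d
    · exact hT _ (Finset.mem_image.2 ⟨(q, i), by
        simp only [Finset.mem_product, Finset.mem_range]; exact ⟨hq, by omega⟩, rfl⟩)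
    · rw [coeff_eq_zero_of_natDegree_lt (by have := hF' q hq; omega)]
      simp
  have hmemF : ∀ q ∈ insert p.derivative F, ∀ t,
      SignType.sign (q.eval₂ e t) = SignType.sign (q.eval₂ e' (φ t)) := by
    intro q hq t
    rcases Finset.mem_insert.1 hq with rfl | hq
    · exact hφ _ (by simp) t
    · exact hφ _ (by simp [hq]) t
  have hlc := hcoeff p (by simp) p.natDegree
  rw [coeff_natDegree] at hlc
  by_cases h0 : e p.leadingCoeff = 0
  · have h0' : e' p.leadingCoeff = 0 := by
      rw [← sign_eq_zero_iff, ← hlc, h0, sign_zero]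
    refine ⟨φ, fun q hq t => ?_⟩
    rcases Finset.mem_insert.1 hq with rfl | hq
    · have h1 := congrArg (eval₂ e t) q.eraseLead_add_C_mul_X_pow
      have h2 := congrArg (eval₂ e' (φ t)) q.eraseLead_add_C_mul_X_pow
      simp only [eval₂_add, eval₂_mul, eval₂_C, h0, h0', zero_mul, add_zero] at h1 h2
      rw [← h1, ← h2]
      exact hφ q.eraseLead (by simp) t
    · exact hmemF q (by simp [hq]) t
  have h0' : e' p.leadingCoeff ≠ 0 := by
    rwa [← sign_ne_zero, ← hlc, sign_ne_zero]
  set T : Finset ℝ := (insert p.derivative F).biUnion fun q => (q.map e).roots.toFinset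
  have hT' : ∀ q ∈ insert p.derivative F, q.map e ≠ 0 → ∀ t, q.eval₂ e t = 0 → t ∈ T := by
    intro q hq h0 t ht
    refine Finset.mem_biUnion.2 ⟨q, hq, ?_⟩
    rw [Multiset.mem_toFinset, mem_roots h0, IsRoot.def, eval_map, ht]
  have hder : p.derivative.map e ≠ 0 := by
    rw [← derivative_map]
    intro h
    have h1 := derivative_eq_zero.1 h
    rw [natDegree_map_of_leadingCoeff_ne_zero _ h0] at h1
    omega
  obtain ⟨ψ, hψT, hψ⟩ := Polynomial.exists_orderIso_sign_eval_eq (p := p.map e) (q := p.map e')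
    (by rw [natDegree_map_of_leadingCoeff_ne_zero _ h0, natDegree_map_of_leadingCoeff_ne_zero _ h0'])
    (by rwa [leadingCoeff_map_of_leadingCoeff_ne_zero _ h0,
      leadingCoeff_map_of_leadingCoeff_ne_zero _ h0'])
    φ T (fun t ht => by
      obtain ⟨q, hq, ht⟩ := Finset.mem_biUnion.1 ht
      rw [Multiset.mem_toFinset] at ht
      have hq0 : q.map e ≠ 0 := ne_zero_of_mem_roots ht
      have hq1 : q.eval₂ e t = 0 := by simpa [eval_map] using isRoot_of_mem_roots ht
      have hqc := hcoeff q (Finset.mem_insert_of_mem hq)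
      have hdeg := natDegree_map_eq_of_sign_coeff_eq hqc
      set j := (q.map e).natDegree
      have hjd : j ≤ d := natDegree_map_le.trans (hF' q (Finset.mem_insert_of_mem hq))
      have hq1' : q.eval₂ e' (φ t) = 0 := by
        rw [← sign_eq_zero_iff, ← hmemF q hq, hq1, sign_zero]
      have hr := hφ (p.reduceBy q j) (by
        refine Finset.mem_union_right _ (Finset.mem_image.2 ⟨(q, j), ?_, rfl⟩)
        simp only [Finset.mem_product, Finset.mem_range]
        exact ⟨hq, by omega⟩) t
      rw [eval₂_reduceBy e (by omega) le_rfl hq1, eval₂_reduceBy e' (by omega) hdeg.ge hq1',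
        sign_mul, sign_mul, hqc] at hr
      have hne : SignType.sign (e' (q.coeff j)) ≠ 0 := by
        rw [← hqc, sign_ne_zero, ← coeff_map]
        exact leadingCoeff_ne_zero.2 hq0
      rw [eval_map, eval_map]
      exact mul_left_cancel₀ hne hr)
    (fun t => by simpa [derivative_map, eval_map] using hmemF p.derivative (by simp) t)
    (fun t ht => hT' p.derivative (by simp) hder t (by simpa [derivative_map, eval_map] using ht))
  refine ⟨ψ, fun q hq t => ?_⟩
  rcases Finset.mem_insert.1 hq with rfl | hq
  · simpa [eval_map] using hψ t
  have hq' : q ∈ insert p.derivative F := by simp [hq]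
  by_cases hq0 : q.map e = 0
  · have hq0' : q.map e' = 0 := by
      ext i
      have := congrArg (fun q => q.coeff i) hq0
      simp only [coeff_map, coeff_zero] at this ⊢
      rw [← sign_eq_zero_iff, ← hcoeff q (by simp [hq]), this, sign_zero]
    rw [← eval_map, ← eval_map, hq0, hq0']
    simp
  by_cases htT : t ∈ T
  · rw [hψT t htT]
    exact hmemF q hq' t
  have hu : φ (φ.symm (ψ t)) = ψ t := by simp
  rw [← hu, ← hmemF q hq']
  simp only [← eval_map]
  refine sign_eq_of_continuous_of_ne_zero (f := fun t => (q.map e).eval t) (q.map e).continuous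
    fun s hs hs0 => ?_
  have hsT := hT' q hq' hq0 s (by simpa [eval_map] using hs0)
  have hψs := hψT s hsT
  have hst : s ≠ t := fun h => htT (h ▸ hsT)
  rcases Set.mem_uIcc.1 hs with ⟨h1, h2⟩ | ⟨h1, h2⟩
  · have h3 := ψ.strictMono (lt_of_le_of_ne h1 hst.symm)
    have h4 := φ.monotone h2
    rw [hu] at h4
    linarith
  · have h3 := ψ.strictMono (lt_of_le_of_ne h2 hst)
    have h4 := φ.monotone h1
    rw [hu] at h4
    linarith

open Classical in
theorem exists_signDiagramEquiv_of_signAgree (F : Finset R[X]) :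
    ∃ T : Finset R, ∀ e e' : R →+* ℝ, SignAgree T e e' → SignDiagramEquiv F e e' := by
  suffices h : ∀ d, ∀ F : Finset R[X], (∀ p ∈ F, p.natDegree < d) →
      ∃ T : Finset R, ∀ e e' : R →+* ℝ, SignAgree T e e' → SignDiagramEquiv F e e' from
    h (F.sup natDegree + 1) F fun p hp => Nat.lt_succ_of_le (Finset.le_sup (f := natDegree) hp)
  intro d
  induction d with
  | zero =>
    intro F hF
    exact ⟨∅, fun e e' _ => ⟨.refl ℝ, fun p hp => absurd (hF p hp) (by simp)⟩⟩
  | succ d ih =>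
    suffices h : ∀ H : Finset R[X], (∀ p ∈ H, p.natDegree ≤ d) →
        ∀ G : Finset R[X], (∀ p ∈ G, p.natDegree < d) →
        ∃ T : Finset R, ∀ e e' : R →+* ℝ, SignAgree T e e' → SignDiagramEquiv (H ∪ G) e e' by
      intro F hF
      simpa using h F (fun p hp => Nat.le_of_lt_succ (hF p hp)) ∅ (by simp)
    intro H
    induction H using Finset.induction_on with
    | empty => intro _ G hG; simpa using ih G hG
    | insert p H _ ihH =>
      intro hH G hG
      have hH' : ∀ p ∈ H, p.natDegree ≤ d := fun q hq => hH q (by simp [hq])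
      rcases Nat.eq_zero_or_pos d with rfl | hd
      · obtain ⟨T, hT⟩ := ihH hH' G hG
        refine ⟨insert (p.coeff 0) T, fun e e' h => ?_⟩
        obtain ⟨φ, hφ⟩ := hT e e' fun r hr => h r (by simp [hr])
        refine ⟨φ, fun q hq t => ?_⟩
        rw [Finset.insert_union] at hq
        rcases Finset.mem_insert.1 hq with rfl | hq
        · rw [eq_C_of_natDegree_eq_zero (Nat.le_zero.1 (hH q (by simp)))]
          simpa using h (q.coeff 0) (by simp)
        · exact hφ q hq t
      rcases (hH p (by simp)).lt_or_eq with hp | hp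
      · obtain ⟨T, hT⟩ := ihH hH' (insert p G) (by simpa [hp] using hG)
        exact ⟨T, by simpa using hT⟩
      · have hHG : ∀ q ∈ H ∪ G, q.natDegree ≤ d := fun q hq => by
          rcases Finset.mem_union.1 hq with hq | hq
          · exact hH' q hq
          · exact (hG q hq).le
        obtain ⟨T, hT⟩ := ihH hH' (G ∪ ({p.derivative, p.eraseLead} ∪
          (insert p.derivative (H ∪ G) ×ˢ Finset.range (d + 1)).image
            fun x => p.reduceBy x.1 x.2)) (by
          intro q hq
          simp only [Finset.mem_union, Finset.mem_insert, Finset.mem_singleton, Finset.mem_image,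
            Finset.mem_product, Finset.mem_range] at hq
          rcases hq with hq | (rfl | rfl) | ⟨x, ⟨-, hx⟩, rfl⟩
          · exact hG q hq
          · exact (natDegree_derivative_le p).trans_lt (by omega)
          · exact p.eraseLead_natDegree_le.trans_lt (by omega)
          · rw [← hp]
            exact natDegree_reduceBy_lt (by omega) _ (by omega))
        refine ⟨T ∪ (insert p (insert p.derivative (H ∪ G)) ×ˢ Finset.range (d + 1)).image
          fun x => x.1.coeff x.2, fun e e' h => ?_⟩
        rw [Finset.insert_union]
        have h1 := hT e e' fun r hr => h r (Finset.mem_union_left _ hr)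
        rw [← Finset.union_assoc, ← Finset.union_assoc] at h1
        exact signDiagramEquiv_insert hd hp (H ∪ G) hHG h1
          fun r hr => h r (Finset.mem_union_right _ hr)

end SignDetermination

end SignPatterns

section Semialgebraic

open MvPolynomial

/-- A set of real points is *semialgebraic over `ℤ`* if membership depends only on the signs of
finitely many polynomials with integer coefficients. -/
def IsSemialgebraic {σ : Type*} (S : Set (σ → ℝ)) : Prop :=
  ∃ T : Finset (MvPolynomial σ ℤ), ∀ x y : σ → ℝ,
    (∀ p ∈ T, SignType.sign (aeval x p) = SignType.sign (aeval y p)) → x ∈ S → y ∈ S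

namespace IsSemialgebraic

variable {σ τ : Type*}

theorem const (P : Prop) : IsSemialgebraic {_x : σ → ℝ | P} :=
  ⟨∅, fun _ _ _ h => h⟩

theorem compl {S : Set (σ → ℝ)} (h : IsSemialgebraic S) : IsSemialgebraic Sᶜ := by
  obtain ⟨T, hT⟩ := h
  exact ⟨T, fun x y hxy hx hy => hx (hT y x (fun p hp => (hxy p hp).symm) hy)⟩

open Classical in
theorem iInter {ι : Type*} [Finite ι] {S : ι → Set (σ → ℝ)} (h : ∀ i, IsSemialgebraic (S i)) :
    IsSemialgebraic (⋂ i, S i) := by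
  have := Fintype.ofFinite ι
  choose T hT using h
  refine ⟨Finset.univ.biUnion T, fun x y hxy hx => Set.mem_iInter.2 fun i => hT i x y
    (fun p hp => hxy p (Finset.mem_biUnion.2 ⟨i, Finset.mem_univ i, hp⟩)) (Set.mem_iInter.1 hx i)⟩

theorem inter {S S' : Set (σ → ℝ)} (h : IsSemialgebraic S) (h' : IsSemialgebraic S') :
    IsSemialgebraic (S ∩ S') := by
  rw [Set.inter_eq_iInter]
  exact iInter fun b => by cases b <;> assumption

theorem imp {P Q : (σ → ℝ) → Prop} (h : IsSemialgebraic {x | P x})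
    (h' : IsSemialgebraic {x | Q x}) : IsSemialgebraic {x | P x → Q x} := by
  have := (h.inter h'.compl).compl
  convert this using 1
  ext x
  simp

theorem eq_zero (p : MvPolynomial σ ℤ) : IsSemialgebraic {x : σ → ℝ | aeval x p = 0} :=
  ⟨{p}, fun x y h hx => by
    have := h p (by simp)
    rw [hx.out, sign_zero] at this
    exact sign_eq_zero_iff.1 this.symm⟩

theorem nonneg (p : MvPolynomial σ ℤ) : IsSemialgebraic {x : σ → ℝ | 0 ≤ aeval x p} :=
  ⟨{p}, fun x y h hx => by
    have := h p (by simp)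
    rw [Set.mem_ofPred_eq] at hx ⊢
    rwa [← sign_nonneg_iff, ← this, sign_nonneg_iff]⟩

open Classical in
theorem preimage {S : Set (τ → ℝ)} (h : IsSemialgebraic S) (P : τ → MvPolynomial σ ℤ) :
    IsSemialgebraic {x : σ → ℝ | (fun j => aeval x (P j)) ∈ S} := by
  obtain ⟨T, hT⟩ := h
  refine ⟨T.image (aeval P), fun x y hxy hx => hT _ _ (fun p hp => ?_) hx⟩
  have h := hxy _ (Finset.mem_image_of_mem _ hp)
  have key (x : σ → ℝ) : aeval x (aeval P p) = aeval (fun j => aeval x (P j)) p := by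
    rw [← AlgHom.comp_apply, comp_aeval]
  rwa [key, key] at h

theorem reindex {S : Set (τ → ℝ)} (h : IsSemialgebraic S) (f : τ → σ) :
    IsSemialgebraic {x : σ → ℝ | x ∘ f ∈ S} := by
  simpa [Function.comp_def] using h.preimage fun j => X (f j)

theorem aeval_optionElim (t : ℝ) (x : σ → ℝ) (p : MvPolynomial (Option σ) ℤ) :
    aeval (fun o : Option σ => o.elim t x) p =
      (optionEquivLeft ℤ σ p).eval₂ (aeval x : MvPolynomial σ ℤ →ₐ[ℤ] ℝ).toRingHom t := by
  induction p using MvPolynomial.induction_on with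
  | C a =>
    have h := map_intCast (Polynomial.eval₂RingHom
      (aeval x : MvPolynomial σ ℤ →ₐ[ℤ] ℝ).toRingHom t) a
    simp only [eq_intCast, map_intCast]
    exact h.symm
  | add p q hp hq => simp [hp, hq]
  | mul_X p o hp =>
    rw [map_mul, map_mul, Polynomial.eval₂_mul, hp]
    cases o <;> simp

open Classical in
/-- The **Tarski–Seidenberg theorem** for one variable. -/
theorem exists_option {S : Set (Option σ → ℝ)} (h : IsSemialgebraic S) :
    IsSemialgebraic {x : σ → ℝ | ∃ t : ℝ, (fun o : Option σ => o.elim t x) ∈ S} := by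
  obtain ⟨T, hT⟩ := h
  obtain ⟨T', hT'⟩ := exists_signDiagramEquiv_of_signAgree (T.image (optionEquivLeft ℤ σ))
  refine ⟨T', fun x y hxy ⟨t, ht⟩ => ?_⟩
  obtain ⟨φ, hφ⟩ := hT' (aeval x : MvPolynomial σ ℤ →ₐ[ℤ] ℝ).toRingHom
    (aeval y : MvPolynomial σ ℤ →ₐ[ℤ] ℝ).toRingHom hxy
  refine ⟨φ t, hT _ _ (fun p hp => ?_) ht⟩
  rw [aeval_optionElim, aeval_optionElim]
  exact hφ _ (Finset.mem_image_of_mem _ hp) t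

/-- The **Tarski–Seidenberg theorem**. -/
theorem exists_sum {α : Type*} [Finite α] {S : Set (α ⊕ σ → ℝ)} (h : IsSemialgebraic S) :
    IsSemialgebraic {x : σ → ℝ | ∃ a : α → ℝ, Sum.elim a x ∈ S} := by
  revert S
  refine Finite.induction_empty_option (P := fun α => ∀ {S : Set (α ⊕ σ → ℝ)},
    IsSemialgebraic S → IsSemialgebraic {x : σ → ℝ | ∃ a : α → ℝ, Sum.elim a x ∈ S})
    ?_ ?_ ?_ α
  · intro α β e ih S h
    convert ih (h.reindex (Sum.map e.symm id)) using 1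
    ext x
    constructor
    · rintro ⟨a, ha⟩
      refine ⟨a ∘ e, ?_⟩
      simp only [Set.mem_ofPred_eq] at ha ⊢
      convert ha using 1
      ext (i | i) <;> simp
    · rintro ⟨a, ha⟩
      refine ⟨a ∘ e.symm, ?_⟩
      simp only [Set.mem_ofPred_eq] at ha ⊢
      convert ha using 1
      ext (i | i) <;> simp
  · intro S h
    convert h.reindex (Sum.elim PEmpty.elim id) using 1
    ext x
    have hx (a : PEmpty → ℝ) : Sum.elim a x = x ∘ Sum.elim PEmpty.elim id := by
      ext (i | i)
      · exact i.elim
      · rfl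
    rw [Set.mem_ofPred_eq, Set.mem_ofPred_eq]
    exact ⟨fun ⟨a, ha⟩ => hx a ▸ ha, fun h => ⟨PEmpty.elim, (hx _).symm ▸ h⟩⟩
  · intro α _ ih S h
    convert ih (h.reindex (Sum.elim (fun o => o.map Sum.inl) (fun s => some (Sum.inr s)) :
      Option α ⊕ σ → Option (α ⊕ σ))).exists_option using 1
    ext x
    constructor
    · rintro ⟨a, ha⟩
      refine ⟨a ∘ some, a none, ?_⟩
      simp only [Set.mem_ofPred_eq] at ha ⊢
      convert ha using 1
      ext ((_ | i) | i) <;> simp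
    · rintro ⟨a, t, ha⟩
      refine ⟨fun o => o.elim t a, ?_⟩
      simp only [Set.mem_ofPred_eq] at ha ⊢
      convert ha using 1
      ext ((_ | i) | i) <;> simp

theorem forall_sum {α : Type*} [Finite α] {S : Set (α ⊕ σ → ℝ)} (h : IsSemialgebraic S) :
    IsSemialgebraic {x : σ → ℝ | ∀ a : α → ℝ, Sum.elim a x ∈ S} := by
  convert h.compl.exists_sum.compl using 1
  ext x
  simp

end IsSemialgebraic

/-- The matrix with index `a` in the tuple of matrices with coordinates `v`. -/
def coordMatrix {β : Type*} {n : ℕ} (v : β × Fin n × Fin n → ℝ) (a : β) :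
    Matrix (Fin n) (Fin n) ℝ :=
  Matrix.of fun i j => v (a, i, j)

theorem isSemialgebraic_posSemidef (n : ℕ) :
    IsSemialgebraic {v : Fin n × Fin n → ℝ | (Matrix.of fun i j => v (i, j)).PosSemidef} := by
  have h1 : IsSemialgebraic {v : Fin n × Fin n → ℝ | ∀ i j, v (i, j) = v (j, i)} := by
    simp only [Set.ofPred_forall]
    refine .iInter fun i => .iInter fun j => ?_
    convert IsSemialgebraic.eq_zero (X (i, j) - X (j, i) : MvPolynomial (Fin n × Fin n) ℤ)
      using 3 with v
    rw [map_sub, MvPolynomial.aeval_X, MvPolynomial.aeval_X, sub_eq_zero]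
  have h2 := (IsSemialgebraic.nonneg (∑ i : Fin n, X (Sum.inl i) *
    ∑ j : Fin n, X (Sum.inr (i, j)) * X (Sum.inl j) :
      MvPolynomial (Fin n ⊕ Fin n × Fin n) ℤ)).forall_sum
  convert h1.inter h2 using 1
  ext v
  rw [Set.mem_ofPred_eq, Matrix.posSemidef_iff_dotProduct_mulVec]
  simp only [Matrix.IsHermitian.ext_iff, Set.mem_inter_iff, Set.mem_ofPred_eq]
  refine and_congr ?_ ?_
  · simp only [Matrix.of_apply, star_trivial]
    exact forall_comm
  · simp [dotProduct, mulVec]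

theorem exists_aeval_eq_realize_term {β : Type*} {n : ℕ} (t : matLang.Term β) (i j : Fin n) :
    ∃ P : MvPolynomial (β × Fin n × Fin n) ℤ, ∀ v : β × Fin n × Fin n → ℝ,
      t.realize (coordMatrix v) i j = aeval v P := by
  induction t generalizing i j with
  | var a => exact ⟨X (a, i, j), fun v => by simp [coordMatrix]⟩
  | @func l f ts ih =>
    choose P hP using ih
    change MatFunc l at f
    cases f with
    | zero => exact ⟨0, fun v => by simp [Term.realize, Structure.funMap]⟩
    | one =>
      refine ⟨if i = j then 1 else 0, fun v => ?_⟩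
      by_cases h : i = j <;> simp [Term.realize, Structure.funMap, Matrix.one_apply, h]
    | add => exact ⟨P 0 i j + P 1 i j, fun v => by simp [Term.realize, Structure.funMap, hP]⟩
    | mul =>
      exact ⟨∑ k, P 0 i k * P 1 k j, fun v => by
        simp [Term.realize, Structure.funMap, hP, Matrix.mul_apply]⟩
    | tr =>
      refine ⟨if i = j then ∑ k, P 0 k k else 0, fun v => ?_⟩
      by_cases h : i = j <;>
        simp [Term.realize, Structure.funMap, Matrix.trace, h, hP]
    | star => exact ⟨P 0 j i, fun v => by simp [Term.realize, Structure.funMap, hP]⟩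

theorem isSemialgebraic_realize {α : Type*} {n k : ℕ} (φ : matLang.BoundedFormula α k) :
    IsSemialgebraic {v : (α ⊕ Fin k) × Fin n × Fin n → ℝ |
      φ.Realize (fun a => coordMatrix v (Sum.inl a)) (fun i => coordMatrix v (Sum.inr i))} := by
  have hsum {k : ℕ} (v : (α ⊕ Fin k) × Fin n × Fin n → ℝ) :
      Sum.elim (fun a => coordMatrix v (Sum.inl a)) (fun i => coordMatrix v (Sum.inr i)) =
        coordMatrix v := by
    ext (a | a) <;> rfl
  induction φ with
  | falsum => exact .const False
  | equal t₁ t₂ =>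
    choose P hP using exists_aeval_eq_realize_term (n := n) t₁
    choose Q hQ using exists_aeval_eq_realize_term (n := n) t₂
    simp only [BoundedFormula.Realize, hsum, ← Matrix.ext_iff, hP, hQ, Set.ofPred_forall]
    refine .iInter fun i => .iInter fun j => ?_
    simpa [sub_eq_zero] using IsSemialgebraic.eq_zero (P i j - Q i j)
  | @rel k l R ts =>
    change MatRel l at R
    cases R with
    | le =>
      choose P hP using exists_aeval_eq_realize_term (n := n) (ts 0)
      choose Q hQ using exists_aeval_eq_realize_term (n := n) (ts 1)
      convert (isSemialgebraic_posSemidef n).preimage fun x => Q x.1 x.2 - P x.1 x.2 using 1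
      ext v
      simp only [BoundedFormula.Realize, hsum, Structure.RelMap, Set.mem_ofPred_eq]
      have : (ts 1).realize (coordMatrix v) - (ts 0).realize (coordMatrix v) =
          Matrix.of fun i j => aeval v (Q i j - P i j) := by
        ext i j
        simp [hP, hQ]
      rw [this]
  | imp _ _ h₁ h₂ => exact h₁.imp h₂
  | @all k φ ih =>
    let f : (α ⊕ Fin (k + 1)) × Fin n × Fin n → (Fin n × Fin n) ⊕ ((α ⊕ Fin k) × Fin n × Fin n) :=
      fun x => Sum.elim (fun a => Sum.inr (Sum.inl a, x.2))
        (fun i => Fin.lastCases (motive := fun _ => (Fin n × Fin n) ⊕ ((α ⊕ Fin k) × Fin n × Fin n))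
          (Sum.inl x.2) (fun i => Sum.inr (Sum.inr i, x.2)) i) x.1
    convert (ih.reindex f).forall_sum using 1
    ext v
    have key (A : Fin n × Fin n → ℝ) :
        (fun a => coordMatrix (Sum.elim A v ∘ f) (Sum.inl a)) =
            (fun a => coordMatrix v (Sum.inl a)) ∧
          (fun i => coordMatrix (Sum.elim A v ∘ f) (Sum.inr i)) =
            Fin.snoc (fun i => coordMatrix v (Sum.inr i)) (Matrix.of fun i j => A (i, j)) := by
      refine ⟨rfl, funext fun l => ?_⟩
      refine Fin.lastCases ?_ (fun l => ?_) l
      · ext i j; simp [coordMatrix, f]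
      · ext i j; simp [coordMatrix, f]
    simp only [BoundedFormula.Realize, Set.mem_ofPred_eq, key]
    exact ⟨fun h A => h _, fun h A => h fun x => A x.1 x.2⟩

end Semialgebraic

section UnitaryEquivalence

variable {A n : Type*} [Ring A] [Algebra ℝ A] [Fintype n]

theorem exists_linearMap_extend_of_isCompl {K U V W : Type*} [Field K] [AddCommGroup U]
    [AddCommGroup V] [AddCommGroup W] [Module K U] [Module K V] [Module K W] (L : U →ₗ[K] V)
    (M : U →ₗ[K] W) (h : ∀ u, L u = 0 → M u = 0) {V' : Submodule K V}
    (hV' : IsCompl (LinearMap.range L) V') :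
    ∃ G : V →ₗ[K] W, (∀ u, G (L u) = M u) ∧ ∀ v ∈ V', G v = 0 := by
  obtain ⟨s, hs⟩ := L.rangeRestrict.exists_rightInverse_of_surjective L.range_rangeRestrict
  refine ⟨LinearMap.ofIsCompl hV' (M.comp s) 0, fun u => ?_,
    fun v hv => LinearMap.ofIsCompl_apply_right hV' ⟨v, hv⟩⟩
  have h₁ : L (s (L.rangeRestrict u)) = L u :=
    congrArg Subtype.val (LinearMap.congr_fun hs (L.rangeRestrict u))
  have h₂ : M (s (L.rangeRestrict u) - u) = 0 := h _ (by rw [map_sub, h₁, sub_self])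
  rw [map_sub, sub_eq_zero] at h₂
  exact (LinearMap.ofIsCompl_apply_left hV' (L.rangeRestrict u)).trans h₂

theorem eq_zero_of_trace_transpose_mul_self_eq_zero {X : Matrix n n ℝ}
    (h : (Xᵀ * X).trace = 0) : X = 0 := by
  rw [← conjTranspose_eq_transpose_of_trivial] at h
  exact trace_conjTranspose_mul_self_eq_zero_iff.1 h

theorem isCompl_orthogonal_trace_form (K : Submodule ℝ (Matrix n n ℝ)) :
    ∃ B : LinearMap.BilinForm ℝ (Matrix n n ℝ), (∀ X Y, B X Y = (Xᵀ * Y).trace) ∧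
      IsCompl K (B.orthogonal K) := by
  refine ⟨LinearMap.mk₂ ℝ (fun X Y => (Xᵀ * Y).trace) (by simp [add_mul]) (by simp)
    (by simp [mul_add]) (by simp), fun _ _ => rfl, ?_⟩
  rw [LinearMap.BilinForm.isCompl_orthogonal_iff_disjoint, Submodule.disjoint_def]
  · exact fun X hX hX' => eq_zero_of_trace_transpose_mul_self_eq_zero (hX' X hX)
  · intro X Y h
    simp only [LinearMap.mk₂_apply] at h ⊢
    rw [← trace_transpose, transpose_mul, transpose_transpose, h]

variable [DecidableEq n]

theorem exists_linearMap_of_trace_eq (ρ σ : A →ₐ[ℝ] Matrix n n ℝ)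
    (hstar : ∀ a, ∃ b, ρ b = (ρ a)ᵀ ∧ σ b = (σ a)ᵀ) {P Q : Matrix n n ℝ}
    (hQs : Qᵀ = Q) (hQ : Q * Q = Q) (hQσ : ∀ a, Q * σ a = σ a * Q)
    (htr : ∀ a, (ρ a * P).trace = (σ a * Q).trace) :
    ∃ G : Matrix n n ℝ →ₗ[ℝ] Matrix n n ℝ, G P = Q ∧ (∀ X, Q * G X = G X) ∧
      ∀ a X, G (ρ a * X) = σ a * G X := by
  let L : A →ₗ[ℝ] Matrix n n ℝ := (LinearMap.mulRight ℝ P).comp ρ.toLinearMap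
  let M : A →ₗ[ℝ] Matrix n n ℝ := (LinearMap.mulRight ℝ Q).comp σ.toLinearMap
  have hL a : L a = ρ a * P := rfl
  have hM a : M a = σ a * Q := rfl
  have hLM a (ha : L a = 0) : M a = 0 := by
    apply eq_zero_of_trace_transpose_mul_self_eq_zero
    obtain ⟨b, hρ, hσ⟩ := hstar a
    have h₁ : (M a)ᵀ * M a = σ (b * a) * Q := by
      rw [hM, transpose_mul, hQs, ← hσ, map_mul, hQσ, mul_assoc, ← mul_assoc Q, hQσ, mul_assoc, hQ,
        mul_assoc]
    rw [h₁, ← htr, map_mul, mul_assoc, ← hL, ha, mul_zero, trace_zero]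
  obtain ⟨B, hB, hK⟩ := isCompl_orthogonal_trace_form (LinearMap.range L)
  obtain ⟨G, hGL, hG₀⟩ := exists_linearMap_extend_of_isCompl L M hLM hK
  have hdec X : ∃ c, ∃ Y ∈ B.orthogonal (LinearMap.range L), L c + Y = X := by
    have hX : X ∈ LinearMap.range L ⊔ B.orthogonal (LinearMap.range L) := by
      rw [hK.sup_eq_top]
      exact Submodule.mem_top
    obtain ⟨_, ⟨c, rfl⟩, Y, hY, h⟩ := Submodule.mem_sup.1 hX
    exact ⟨c, Y, hY, h⟩
  refine ⟨G, ?_, fun X => ?_, fun a X => ?_⟩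
  · have := hGL 1
    rwa [hL, hM, map_one, map_one, one_mul, one_mul] at this
  · obtain ⟨c, Y, hY, rfl⟩ := hdec X
    rw [map_add, hGL, hG₀ Y hY, add_zero, hM, ← mul_assoc, hQσ, mul_assoc, hQ]
  · obtain ⟨c, Y, hY, rfl⟩ := hdec X
    have hY' : ρ a * Y ∈ B.orthogonal (LinearMap.range L) := by
      rintro _ ⟨d, rfl⟩
      obtain ⟨b, hρ, -⟩ := hstar a
      have := hY (L (b * d)) ⟨_, rfl⟩
      change B _ _ = 0 at this ⊢
      rw [hB] at this ⊢
      rw [← this, hL, hL, map_mul, hρ]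
      simp [mul_assoc]
    have h₁ : ρ a * L c = L (a * c) := by simp only [hL, map_mul, mul_assoc]
    have h₂ : σ a * M c = M (a * c) := by simp only [hM, map_mul, mul_assoc]
    rw [mul_add, map_add, map_add, hG₀ _ hY', hG₀ _ hY, h₁, hGL, hGL, add_zero, add_zero, h₂]

theorem exists_intertwiner_ne_zero (ρ σ : A →ₐ[ℝ] Matrix n n ℝ)
    (hstar : ∀ a, ∃ b, ρ b = (ρ a)ᵀ ∧ σ b = (σ a)ᵀ) {P Q : Matrix n n ℝ}
    (hPs : Pᵀ = P) (hP : P * P = P) (hQs : Qᵀ = Q) (hQ : Q * Q = Q)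
    (hPρ : ∀ a, P * ρ a = ρ a * P) (hQσ : ∀ a, Q * σ a = σ a * Q)
    (htr : ∀ a, (ρ a * P).trace = (σ a * Q).trace) (hP₀ : P ≠ 0) :
    ∃ T : Matrix n n ℝ, T ≠ 0 ∧ (∀ a, T * ρ a = σ a * T) ∧ T * P = T ∧ Q * T = T := by
  obtain ⟨G, hGP, hGQ, hG⟩ := exists_linearMap_of_trace_eq ρ σ hstar hQs hQ hQσ htr
  have hQ₀ : Q ≠ 0 := by
    rintro rfl
    have h := htr 1
    rw [map_one, one_mul, mul_zero, trace_zero] at h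
    exact hP₀ (eq_zero_of_trace_transpose_mul_self_eq_zero (by rwa [hPs, hP]))
  let T (j k : n) : Matrix n n ℝ := LinearMap.toMatrix' (((mulVecBilin ℝ ℝ).flip (Pi.single k 1)).comp
    (G.comp ((vecMulVecBilin ℝ ℝ).flip (Pi.single j 1))))
  have hT j k v : T j k *ᵥ v = G (vecMulVec v (Pi.single j 1)) *ᵥ Pi.single k 1 := by
    rw [← Matrix.toLin'_apply, Matrix.toLin'_toMatrix']
    rfl
  have hTρ j k a : T j k * ρ a = σ a * T j k := by
    refine Matrix.ext_of_mulVec_single fun i => ?_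
    rw [← mulVec_mulVec, ← mulVec_mulVec, hT, hT, mulVec_mulVec, ← hG, ← mul_vecMulVec]
  have hTQ j k : Q * T j k = T j k := by
    refine Matrix.ext_of_mulVec_single fun i => ?_
    rw [← mulVec_mulVec, hT, mulVec_mulVec, hGQ]
  have : ∃ j k, T j k * P ≠ 0 := by
    by_contra! h
    refine hQ₀ (Matrix.ext_of_mulVec_single fun k => ?_)
    have h₁ : P = ∑ j, vecMulVec (P *ᵥ Pi.single j 1) (Pi.single j 1) := by
      simp_rw [← mul_vecMulVec, ← Finset.mul_sum, ← single_eq_single_vecMulVec_single,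
        sum_single_one, mul_one]
    rw [← hGP, h₁, map_sum, sum_mulVec, zero_mulVec]
    refine Finset.sum_eq_zero fun j _ => ?_
    rw [← hT, mulVec_mulVec, h, zero_mulVec]
  obtain ⟨j, k, h⟩ := this
  refine ⟨T j k * P, h, fun a => ?_, ?_, ?_⟩
  · rw [mul_assoc, hPρ, ← mul_assoc, hTρ, mul_assoc]
  · rw [mul_assoc, hP]
  · rw [← mul_assoc, hTQ]

theorem exists_partialIsometry_of_intertwiner {T : Matrix n n ℝ} (hT : T ≠ 0) :
    ∃ F : Matrix n n ℝ, Fᵀ = F ∧ (∀ X, Commute (Tᵀ * T) X → Commute F X) ∧ T * F ≠ 0 ∧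
      T * F * (T * F)ᵀ * (T * F) = T * F := by
  set S := Tᵀ * T with hS
  have hS' : S.PosSemidef := by
    rw [hS, ← conjTranspose_eq_transpose_of_trivial]
    exact posSemidef_conjTranspose_mul_self T
  have hSa : IsSelfAdjoint S := hS'.isHermitian
  let f : ℝ → ℝ := fun x => (√x)⁻¹
  have hc (g : ℝ → ℝ) : ContinuousOn g (spectrum ℝ S) := S.finite_real_spectrum.continuousOn g
  have hF : (cfc f S)ᵀ = cfc f S := by
    rw [← conjTranspose_eq_transpose_of_trivial]
    exact cfc_predicate f S
  refine ⟨cfc f S, hF, fun X hX => hX.cfc_real f, fun h => ?_, ?_⟩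
  · have h₁ : S = cfc f S * cfc (fun x => x * √x) S := by
      rw [← cfc_mul f _ S (hc _) (hc _)]
      conv_lhs => rw [← cfc_id ℝ S]
      refine cfc_congr fun x hx => ?_
      have hx : 0 ≤ x := by
        have := (posSemidef_iff_isHermitian_and_spectrum_nonneg.1 hS').2 hx
        simpa using this
      rcases hx.eq_or_lt with rfl | hx
      · simp
      · have := Real.sqrt_ne_zero'.2 hx
        simp only [id, f]
        field_simp
    have h₂ : T * S = 0 := by rw [h₁, ← mul_assoc, h, zero_mul]
    have h₃ : S = 0 := eq_zero_of_trace_transpose_mul_self_eq_zero (by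
      have h₄ : Sᵀ = S := by rw [hS, transpose_mul, transpose_transpose]
      rw [h₄]
      conv_lhs => enter [1, 1]; rw [hS]
      rw [mul_assoc, h₂, mul_zero, trace_zero])
    exact hT (eq_zero_of_trace_transpose_mul_self_eq_zero (by rw [← hS, h₃, trace_zero]))
  · rw [transpose_mul, hF]
    have h₁ : cfc f S * (cfc f S * S * cfc f S) = cfc f S := by
      conv_lhs => enter [2, 1, 2]; rw [← cfc_id ℝ S]
      rw [← cfc_mul f _ S (hc _) (hc _), ← cfc_mul _ f S (hc _) (hc _),
        ← cfc_mul f _ S (hc _) (hc _)]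
      refine cfc_congr fun x _ => ?_
      rcases le_or_gt x 0 with hx | hx
      · simp [f, Real.sqrt_eq_zero_of_nonpos hx]
      · have := Real.sqrt_ne_zero'.2 hx
        have h := Real.sq_sqrt hx.le
        simp only [id, f]
        field_simp
        linarith
    calc T * cfc f S * (cfc f S * Tᵀ) * (T * cfc f S) = T * (cfc f S * (cfc f S * S * cfc f S)) := by
          simp only [hS, mul_assoc]
      _ = _ := by rw [h₁]

theorem rank_lt_rank_add {U D : Matrix n n ℝ} (h₁ : Uᵀ * D = 0) (h₂ : U * Dᵀ = 0)
    (hD : D ≠ 0) : U.rank < (U + D).rank := by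
  have h₃ : Dᵀ * U = 0 := by rw [← transpose_transpose U, ← transpose_mul, h₁, transpose_zero]
  have hker : LinearMap.ker (U + D).mulVecLin < LinearMap.ker U.mulVecLin := by
    refine lt_of_le_of_ne (fun v hv => ?_) fun h => hD ?_
    · simp only [LinearMap.mem_ker, mulVecLin_apply] at hv ⊢
      have : (Uᵀ * U) *ᵥ v = 0 := by
        rw [← add_zero (Uᵀ * U), ← h₁, ← mul_add, ← mulVec_mulVec, hv, mulVec_zero]
      rwa [← conjTranspose_eq_transpose_of_trivial,
        conjTranspose_mul_self_mulVec_eq_zero] at this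
    · have hv (v : n → ℝ) : (D * Dᵀ) *ᵥ v = 0 := by
        have : Dᵀ *ᵥ v ∈ LinearMap.ker U.mulVecLin := by
          simp [mulVec_mulVec, h₂]
        rw [← h, LinearMap.mem_ker, mulVecLin_apply, mulVec_mulVec, add_mul, h₂, zero_add] at this
        exact this
      have hDD : D * Dᵀ = 0 := ext_of_mulVec_single fun i => by rw [hv, zero_mulVec]
      rw [← transpose_eq_zero]
      exact eq_zero_of_trace_transpose_mul_self_eq_zero (by
        rw [transpose_transpose, hDD, trace_zero])
  have h₄ := Submodule.finrank_lt_finrank_of_lt hker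
  have h₅ := U.mulVecLin.finrank_range_add_finrank_ker
  have h₆ := (U + D).mulVecLin.finrank_range_add_finrank_ker
  simp only [Matrix.rank]
  lia

/-- Two representations of an algebra by real matrices, compatible with transposition and with the
same character, are orthogonally equivalent. -/
theorem exists_orthogonal_intertwiner (ρ σ : A →ₐ[ℝ] Matrix n n ℝ)
    (hstar : ∀ a, ∃ b, ρ b = (ρ a)ᵀ ∧ σ b = (σ a)ᵀ) (htr : ∀ a, (ρ a).trace = (σ a).trace) :
    ∃ U : Matrix n n ℝ, Uᵀ * U = 1 ∧ ∀ a, U * ρ a = σ a * U := by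
  have hflip {U : Matrix n n ℝ} (hU : ∀ a, U * ρ a = σ a * U) (a : A) : ρ a * Uᵀ = Uᵀ * σ a := by
    obtain ⟨b, hρ, hσ⟩ := hstar a
    have := congrArg transpose (hU b)
    rwa [transpose_mul, transpose_mul, hρ, hσ, transpose_transpose, transpose_transpose] at this
  let p (k : ℕ) := ∃ U : Matrix n n ℝ, U.rank = k ∧ U * Uᵀ * U = U ∧ ∀ a, U * ρ a = σ a * U
  have hp : ∃ k, p k := ⟨_, 0, rfl, by simp, by simp⟩
  have hb k (hk : p k) : k ≤ Fintype.card n := by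
    obtain ⟨U, rfl, -⟩ := hk
    exact U.rank_le_card_width
  classical
  obtain ⟨k₀, hk₀⟩ := hp
  obtain ⟨U, hrank, hU, hUρ⟩ := Nat.findGreatest_spec (hb _ hk₀) hk₀
  have hmax V (hV : V * Vᵀ * V = V) (hVρ : ∀ a, V * ρ a = σ a * V) : V.rank ≤ U.rank := by
    rw [hrank]
    exact Nat.le_findGreatest (V.rank_le_card_width) ⟨V, rfl, hV, hVρ⟩
  refine ⟨U, ?_, hUρ⟩
  by_contra hne
  have hU' : Uᵀ * U * Uᵀ = Uᵀ := by
    conv_rhs => rw [← hU]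
    simp [mul_assoc]
  have hPU : U * (1 - Uᵀ * U) = 0 := by rw [mul_sub, mul_one, ← mul_assoc, hU, sub_self]
  have hQU : (1 - U * Uᵀ) * U = 0 := by rw [sub_mul, one_mul, hU, sub_self]
  have hPU' : (1 - Uᵀ * U) * Uᵀ = 0 := by rw [sub_mul, one_mul, hU', sub_self]
  have hQU' : Uᵀ * (1 - U * Uᵀ) = 0 := by rw [mul_sub, mul_one, ← mul_assoc, hU', sub_self]
  obtain ⟨T, hT, hTρ, hTP, hQT⟩ := exists_intertwiner_ne_zero ρ σ hstar
    (P := 1 - Uᵀ * U) (Q := 1 - U * Uᵀ) (by simp)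
    (by rw [mul_sub, mul_one, ← mul_assoc, hPU', zero_mul, sub_zero]) (by simp)
    (by rw [mul_sub, mul_one, ← mul_assoc, hQU, zero_mul, sub_zero])
    (fun a => by
      rw [sub_mul, mul_sub, one_mul, mul_one, mul_assoc, hUρ, ← mul_assoc, ← hflip hUρ, mul_assoc])
    (fun a => by
      rw [sub_mul, mul_sub, one_mul, mul_one, mul_assoc, ← hflip hUρ, ← mul_assoc, hUρ, mul_assoc])
    (fun a => by
      rw [mul_sub, mul_sub, mul_one, mul_one, trace_sub, trace_sub, htr, ← mul_assoc, hflip hUρ,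
        mul_assoc, ← mul_assoc (σ a), ← hUρ, trace_mul_comm])
    (fun h => hne (sub_eq_zero.1 h).symm)
  obtain ⟨F, hF, hFc, hTF, hD⟩ := exists_partialIsometry_of_intertwiner hT
  have hTt : (1 - Uᵀ * U) * Tᵀ = Tᵀ := by
    conv_rhs => rw [← hTP]
    simp
  have hFP : F * (1 - Uᵀ * U) = (1 - Uᵀ * U) * F := hFc _ (by
    rw [commute_iff_eq, mul_assoc, hTP, ← mul_assoc, hTt])
  have hFρ a : F * ρ a = ρ a * F := hFc _ (by
    rw [commute_iff_eq, mul_assoc, hTρ, ← mul_assoc, ← hflip hTρ, mul_assoc])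
  set D := T * F with hD'
  have hDP : D * (1 - Uᵀ * U) = D := by rw [hD', mul_assoc, hFP, ← mul_assoc, hTP]
  have hQD : (1 - U * Uᵀ) * D = D := by rw [hD', ← mul_assoc, hQT]
  have h₁ : Uᵀ * D = 0 := by rw [← hQD, ← mul_assoc, hQU', zero_mul]
  have h₂ : D * Uᵀ = 0 := by rw [← hDP, mul_assoc, hPU', mul_zero]
  have h₃ : U * Dᵀ = 0 := by rw [← transpose_transpose U, ← transpose_mul, h₂, transpose_zero]
  have h₄ : Dᵀ * U = 0 := by rw [← transpose_transpose U, ← transpose_mul, h₁, transpose_zero]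
  refine (rank_lt_rank_add h₁ h₃ hTF).not_ge (hmax _ ?_ fun a => ?_)
  · have : (U + D) * (U + D)ᵀ * (U + D) = U * Uᵀ * U + D * Dᵀ * D := by
      rw [transpose_add, mul_assoc, add_mul Uᵀ, mul_add Uᵀ, mul_add Dᵀ, h₁, h₄, add_zero, zero_add,
        mul_add, add_mul, add_mul, ← mul_assoc, ← mul_assoc, ← mul_assoc, ← mul_assoc, h₂, h₃]
      simp [mul_assoc]
    rw [this, hU, hD]
  · rw [add_mul, mul_add, hUρ, hD', mul_assoc, hFρ, ← mul_assoc, hTρ, mul_assoc]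

/-- The product of the matrices `X i` and their transposes described by a word, where the letter
`(i, true)` stands for `X i` and `(i, false)` for its transpose. -/
def wordMatrix {ι R : Type*} [CommRing R] (X : ι → Matrix n n R) :
    FreeMonoid (ι × Bool) →* Matrix n n R :=
  FreeMonoid.lift fun x => cond x.2 (X x.1) (X x.1)ᵀ

theorem exists_wordMatrix_eq_transpose {ι : Type*} (w : FreeMonoid (ι × Bool)) :
    ∃ w' : FreeMonoid (ι × Bool), ∀ X : ι → Matrix n n ℝ,
      wordMatrix X w' = (wordMatrix X w)ᵀ := by
  induction w using FreeMonoid.inductionOn' with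
  | one => exact ⟨1, fun X => by simp⟩
  | of_mul x w ih =>
    obtain ⟨w', hw'⟩ := ih
    refine ⟨w' * FreeMonoid.of (x.1, !x.2), fun X => ?_⟩
    rw [map_mul, map_mul, transpose_mul, hw']
    rcases x with ⟨i, _ | _⟩ <;> simp [wordMatrix]

theorem wordMatrix_map {ι R S : Type*} [CommRing R] [CommRing S] (f : R →+* S)
    (X : ι → Matrix n n R) (w : FreeMonoid (ι × Bool)) :
    wordMatrix (fun i => (X i).map f) w = (wordMatrix X w).map f := by
  have : wordMatrix (fun i => (X i).map f) = (f.mapMatrix (m := n)).toMonoidHom.comp (wordMatrix X) := by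
    refine FreeMonoid.hom_eq fun x => ?_
    rcases x with ⟨i, _ | _⟩ <;> simp [wordMatrix, transpose_map]
  rw [this]
  rfl

/-- **Specht's theorem** over `ℝ`. -/
theorem exists_orthogonal_of_trace_word_eq {ι : Type*} (X Y : ι → Matrix n n ℝ)
    (h : ∀ w, (wordMatrix X w).trace = (wordMatrix Y w).trace) :
    ∃ U : Matrix n n ℝ, Uᵀ * U = 1 ∧ ∀ i, U * X i = Y i * U := by
  let ρ (X : ι → Matrix n n ℝ) := MonoidAlgebra.lift ℝ (Matrix n n ℝ) _ (wordMatrix X)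
  have hρ X w (r : ℝ) : ρ X (MonoidAlgebra.single w r) = r • wordMatrix X w :=
    MonoidAlgebra.lift_single _ _ _
  obtain ⟨U, hU, hUρ⟩ := exists_orthogonal_intertwiner (ρ X) (ρ Y) (fun a => by
    induction a using MonoidAlgebra.induction_linear with
    | zero => exact ⟨0, by simp⟩
    | add x y hx hy =>
      obtain ⟨b, hb, hb'⟩ := hx
      obtain ⟨c, hc, hc'⟩ := hy
      exact ⟨b + c, by simp [hb, hc], by simp [hb', hc']⟩
    | single w r =>
      obtain ⟨w', hw'⟩ := exists_wordMatrix_eq_transpose (n := n) w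
      exact ⟨MonoidAlgebra.single w' r, by simp [hρ, hw'], by simp [hρ, hw']⟩) (fun a => by
    induction a using MonoidAlgebra.induction_linear with
    | zero => simp
    | add x y hx hy => simp [hx, hy]
    | single w r => simp [hρ, h])
  refine ⟨U, hU, fun i => ?_⟩
  simpa [hρ, wordMatrix] using hUρ (MonoidAlgebra.single (FreeMonoid.of (i, true)) 1)

/-- Finitely many words suffice in `exists_orthogonal_of_trace_word_eq`. -/
theorem exists_finset_word (n ι : Type*) [Fintype n] [DecidableEq n] [Finite ι] :
    ∃ W : Finset (FreeMonoid (ι × Bool)), ∀ X Y : ι → Matrix n n ℝ,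
      (∀ w ∈ W, (wordMatrix X w).trace = (wordMatrix Y w).trace) →
        ∀ w, (wordMatrix X w).trace = (wordMatrix Y w).trace := by
  classical
  let R := MvPolynomial ((ι × n × n) ⊕ (ι × n × n)) ℝ
  let Z (s : ι × n × n → (ι × n × n) ⊕ (ι × n × n)) (i : ι) : Matrix n n R :=
    Matrix.of fun j k => MvPolynomial.X (s (i, j, k))
  let d (w : FreeMonoid (ι × Bool)) : R :=
    (wordMatrix (Z Sum.inl) w).trace - (wordMatrix (Z Sum.inr) w).trace
  obtain ⟨t, ht, hspan⟩ := (Submodule.fg_span_iff_fg_span_finset_subset _).1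
    (IsNoetherian.noetherian (Submodule.span R (Set.range d)))
  obtain ⟨W, rfl⟩ : ∃ W : Finset (FreeMonoid (ι × Bool)), W.image d = t := by
    rw [← Set.image_univ] at ht
    obtain ⟨W, -, hW⟩ := Finset.subset_set_image_iff.1 ht
    exact ⟨W, hW⟩
  refine ⟨W, fun X Y h w => ?_⟩
  let e : R →+* ℝ := MvPolynomial.eval
    (Sum.elim (fun x => X x.1 x.2.1 x.2.2) (fun x => Y x.1 x.2.1 x.2.2))
  have he w : e (d w) = (wordMatrix X w).trace - (wordMatrix Y w).trace := by
    have h₁ : (fun i => (Z Sum.inl i).map e) = X := by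
      ext i j k
      exact MvPolynomial.eval_X _
    have h₂ : (fun i => (Z Sum.inr i).map e) = Y := by
      ext i j k
      exact MvPolynomial.eval_X _
    rw [map_sub, AddMonoidHom.map_trace, AddMonoidHom.map_trace, ← wordMatrix_map, ← wordMatrix_map,
      h₁, h₂]
  have hle : Submodule.span R (Set.range d) ≤ RingHom.ker e := by
    rw [hspan, Submodule.span_le]
    intro x hx
    obtain ⟨w, hw, rfl⟩ := Finset.mem_image.1 hx
    exact (he w).trans (sub_eq_zero.2 (h w hw))
  rw [← sub_eq_zero, ← he]
  exact hle (Submodule.subset_span ⟨w, rfl⟩)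

end UnitaryEquivalence

section QuantifierFree

variable {n m : ℕ}

/-- The set `S` is definable by a quantifier-free formula without parameters. -/
def IsQFDefinable (S : Set (Fin m → Matrix (Fin n) (Fin n) ℝ)) : Prop :=
  ∃ ψ : matLang.Formula (Fin m), ψ.IsQF ∧ ∀ v, ψ.Realize v ↔ v ∈ S

theorem IsQFDefinable.compl {S : Set (Fin m → Matrix (Fin n) (Fin n) ℝ)} (h : IsQFDefinable S) :
    IsQFDefinable Sᶜ := by
  obtain ⟨ψ, hψ, h⟩ := h
  exact ⟨ψ.not, hψ.not, fun v => by rw [Formula.realize_not, h, Set.mem_compl_iff]⟩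

theorem IsQFDefinable.inter {S T : Set (Fin m → Matrix (Fin n) (Fin n) ℝ)}
    (hS : IsQFDefinable S) (hT : IsQFDefinable T) : IsQFDefinable (S ∩ T) := by
  obtain ⟨ψ, hψ, hS⟩ := hS
  obtain ⟨χ, hχ, hT⟩ := hT
  exact ⟨ψ ⊓ χ, hψ.inf hχ, fun v => by rw [Formula.realize_inf, hS, hT, Set.mem_inter_iff]⟩

theorem IsQFDefinable.union {S T : Set (Fin m → Matrix (Fin n) (Fin n) ℝ)}
    (hS : IsQFDefinable S) (hT : IsQFDefinable T) : IsQFDefinable (S ∪ T) := by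
  rw [← compl_compl (S ∪ T), Set.compl_union]
  exact (hS.compl.inter hT.compl).compl

theorem IsQFDefinable.const (p : Prop) :
    IsQFDefinable {_v : Fin m → Matrix (Fin n) (Fin n) ℝ | p} := by
  by_cases hp : p
  · exact ⟨⊤, BoundedFormula.IsQF.top, fun v => by simp [hp]⟩
  · exact ⟨⊥, BoundedFormula.isQF_bot, fun v => by simp [hp]⟩

theorem IsQFDefinable.of_determined {κ : Type*} (T : Finset κ)
    {c : κ → Set (Fin m → Matrix (Fin n) (Fin n) ℝ)} (hc : ∀ k ∈ T, IsQFDefinable (c k))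
    {S : Set (Fin m → Matrix (Fin n) (Fin n) ℝ)}
    (hS : ∀ x y, (∀ k ∈ T, x ∈ c k ↔ y ∈ c k) → x ∈ S → y ∈ S) : IsQFDefinable S := by
  classical
  induction T using Finset.induction_on generalizing S with
  | empty =>
    convert IsQFDefinable.const (∃ x, x ∈ S) using 1
    ext y
    exact ⟨fun h => ⟨y, h⟩, fun ⟨x, hx⟩ => hS x y (by simp) hx⟩
  | insert k T hk ih =>
    let S' (b : Prop) : Set (Fin m → Matrix (Fin n) (Fin n) ℝ) :=
      {y | ∃ x ∈ S, (x ∈ c k ↔ b) ∧ ∀ l ∈ T, x ∈ c l ↔ y ∈ c l}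
    have hS' b : IsQFDefinable (S' b) := by
      refine ih (fun l hl => hc l (Finset.mem_insert_of_mem hl)) ?_
      rintro y z hyz ⟨x, hx, hb, hxy⟩
      exact ⟨x, hx, hb, fun l hl => (hxy l hl).trans (hyz l hl)⟩
    have hk := hc k (Finset.mem_insert_self k T)
    convert (hk.inter (hS' True)).union (hk.compl.inter (hS' False)) using 1
    ext y
    constructor
    · intro hy
      by_cases h : y ∈ c k
      · exact Or.inl ⟨h, y, hy, by simp [h], fun _ _ => Iff.rfl⟩
      · exact Or.inr ⟨h, y, hy, by simp [h], fun _ _ => Iff.rfl⟩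
    · rintro (⟨h, x, hx, hb, hxy⟩ | ⟨h, x, hx, hb, hxy⟩) <;>
      · refine hS x y (fun l hl => ?_) hx
        rcases Finset.mem_insert.1 hl with rfl | hl
        · simp_all
        · exact hxy l hl

theorem exists_term_realize_eq_wordMatrix (n : ℕ) (w : FreeMonoid (Fin m × Bool)) :
    ∃ t : matLang.Term (Fin m), ∀ v : Fin m → Matrix (Fin n) (Fin n) ℝ,
      t.realize v = wordMatrix v w := by
  induction w using FreeMonoid.inductionOn' with
  | one =>
    exact ⟨Term.func (L := matLang) MatFunc.one ![], fun v => by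
      simp [Term.realize, Structure.funMap]⟩
  | of_mul x w ih =>
    obtain ⟨t, ht⟩ := ih
    obtain ⟨s, hs⟩ : ∃ s : matLang.Term (Fin m), ∀ v : Fin m → Matrix (Fin n) (Fin n) ℝ,
        s.realize v = wordMatrix v (FreeMonoid.of x) := by
      rcases x with ⟨i, _ | _⟩
      · exact ⟨Term.func (L := matLang) MatFunc.star ![Term.var i], fun v => by
          simp [Term.realize, Structure.funMap, wordMatrix]⟩
      · exact ⟨Term.var i, fun v => by simp [wordMatrix]⟩
    exact ⟨Term.func (L := matLang) MatFunc.mul ![s, t], fun v => by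
      simp [Term.realize, Structure.funMap, hs, ht]⟩

theorem exists_term_realize_eq_add (s t : matLang.Term (Fin m)) (n : ℕ) :
    ∃ r : matLang.Term (Fin m), ∀ v : Fin m → Matrix (Fin n) (Fin n) ℝ,
      r.realize v = s.realize v + t.realize v :=
  ⟨Term.func (L := matLang) MatFunc.add ![s, t], fun v => by
    simp [Term.realize, Structure.funMap]⟩

theorem exists_term_realize_eq_natCast (m n k : ℕ) :
    ∃ t : matLang.Term (Fin m), ∀ v : Fin m → Matrix (Fin n) (Fin n) ℝ, t.realize v = k := by
  induction k with
  | zero =>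
    exact ⟨Term.func (L := matLang) MatFunc.zero ![], fun v => by
      simp [Term.realize, Structure.funMap]⟩
  | succ k ih =>
    obtain ⟨t, ht⟩ := ih
    obtain ⟨s, hs⟩ := exists_term_realize_eq_wordMatrix (m := m) n 1
    obtain ⟨r, hr⟩ := exists_term_realize_eq_add t s n
    exact ⟨r, fun v => by simp [hr, ht, hs]⟩

theorem exists_terms_realize_sub_eq_smul_one (n : ℕ) {W : Type*}
    (c : W → FreeMonoid (Fin m × Bool)) (p : MvPolynomial W ℤ) :
    ∃ s t : matLang.Term (Fin m), ∀ v : Fin m → Matrix (Fin n) (Fin n) ℝ,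
      s.realize v - t.realize v =
        MvPolynomial.aeval (fun w => (wordMatrix v (c w)).trace) p •
          (1 : Matrix (Fin n) (Fin n) ℝ) := by
  induction p using MvPolynomial.induction_on with
  | C z =>
    obtain ⟨s, hs⟩ := exists_term_realize_eq_natCast m n z.toNat
    obtain ⟨t, ht⟩ := exists_term_realize_eq_natCast m n (-z).toNat
    refine ⟨s, t, fun v => ?_⟩
    rw [hs, ht]
    have := congrArg (Int.cast : ℤ → Matrix (Fin n) (Fin n) ℝ) (Int.toNat_sub_toNat_neg z)
    rw [MvPolynomial.aeval_C, algebraMap_int_eq, eq_intCast, Int.cast_smul_eq_zsmul, zsmul_one]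
    exact_mod_cast this
  | add p q hp hq =>
    obtain ⟨s, t, h⟩ := hp
    obtain ⟨s', t', h'⟩ := hq
    obtain ⟨r, hr⟩ := exists_term_realize_eq_add s s' n
    obtain ⟨r', hr'⟩ := exists_term_realize_eq_add t t' n
    refine ⟨r, r', fun v => ?_⟩
    rw [hr, hr', map_add, add_smul, ← h, ← h']
    abel
  | mul_X p w hp =>
    obtain ⟨s, t, h⟩ := hp
    obtain ⟨u, hu⟩ := exists_term_realize_eq_wordMatrix n (c w)
    refine ⟨Term.func (L := matLang) MatFunc.mul
        ![s, Term.func (L := matLang) MatFunc.tr ![u] ],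
      Term.func (L := matLang) MatFunc.mul
        ![t, Term.func (L := matLang) MatFunc.tr ![u] ], fun v => ?_⟩
    rw [map_mul, MvPolynomial.aeval_X, mul_comm, mul_smul, ← h]
    simp [Term.realize, Structure.funMap, hu, smul_sub]

theorem posSemidef_smul_one_iff (hn : 1 ≤ n) (c : ℝ) :
    (c • (1 : Matrix (Fin n) (Fin n) ℝ)).PosSemidef ↔ 0 ≤ c := by
  refine ⟨fun h => ?_, fun h => PosSemidef.one.smul h⟩
  have := h.diag_nonneg (i := ⟨0, hn⟩)
  simpa using this

theorem isQFDefinable_aeval_trace_nonneg (hn : 1 ≤ n) {W : Type*}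
    (c : W → FreeMonoid (Fin m × Bool)) (p : MvPolynomial W ℤ) :
    IsQFDefinable {v : Fin m → Matrix (Fin n) (Fin n) ℝ |
      0 ≤ MvPolynomial.aeval (fun w => (wordMatrix v (c w)).trace) p} := by
  obtain ⟨s, t, h⟩ := exists_terms_realize_sub_eq_smul_one n c p
  refine ⟨Relations.formula (L := matLang) MatRel.le ![t, s],
    (BoundedFormula.IsAtomic.rel _ _).isQF, fun v => ?_⟩
  rw [Set.mem_ofPred_eq, ← posSemidef_smul_one_iff hn, ← h]
  exact Formula.realize_rel

theorem realize_conj_iff (φ : matLang.Formula (Fin m)) {U : Matrix (Fin n) (Fin n) ℝ}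
    (hU : Uᵀ * U = 1) (v : Fin m → Matrix (Fin n) (Fin n) ℝ) :
    φ.Realize (fun i => U * v i * Uᵀ) ↔ φ.Realize v := by
  have hU' : U * Uᵀ = 1 := mul_eq_one_comm.1 hU
  let e : (Matrix (Fin n) (Fin n) ℝ) ≃[matLang] (Matrix (Fin n) (Fin n) ℝ) :=
    { toFun := fun X => U * X * Uᵀ
      invFun := fun X => Uᵀ * X * U
      left_inv := fun X => by
        change Uᵀ * (U * X * Uᵀ) * U = X
        rw [mul_assoc, mul_assoc, mul_assoc, hU, mul_one, ← mul_assoc, hU, one_mul]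
      right_inv := fun X => by
        change U * (Uᵀ * X * U) * Uᵀ = X
        rw [mul_assoc, mul_assoc, mul_assoc, hU', mul_one, ← mul_assoc, hU', one_mul]
      map_fun' := by
        intro k f x
        change MatFunc k at f
        cases f with
        | zero => simp [Structure.funMap]
        | one => simp [Structure.funMap, hU']
        | add => simp [Structure.funMap, mul_add, add_mul]
        | mul =>
          simp only [Structure.funMap, Function.comp_apply]
          rw [mul_assoc _ Uᵀ, ← mul_assoc Uᵀ, ← mul_assoc Uᵀ, hU, one_mul]
          simp only [mul_assoc]
        | tr =>
          simp only [Structure.funMap, Function.comp_apply]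
          rw [trace_mul_comm (U * x 0), ← mul_assoc, hU, one_mul, mul_smul_comm, smul_mul_assoc,
            mul_one, hU']
        | star => simp [Structure.funMap, mul_assoc]
      map_rel' := by
        intro k r x
        change MatRel k at r
        cases r with
        | le =>
          have (X V : Matrix (Fin n) (Fin n) ℝ) (h : X.PosSemidef) :
              (V * X * Vᵀ).PosSemidef := by
            rw [← conjTranspose_eq_transpose_of_trivial]
            exact h.mul_mul_conjTranspose_same V
          simp only [Structure.RelMap, Function.comp_apply]
          rw [← sub_mul, ← mul_sub]
          refine ⟨fun h => ?_, this _ U⟩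
          have h' := this _ Uᵀ h
          rwa [transpose_transpose, mul_assoc, mul_assoc, mul_assoc, hU, mul_one, ← mul_assoc, hU,
            one_mul] at h' }
  exact StrongHomClass.realize_formula e φ

theorem exists_aeval_eq_trace_wordMatrix {ι : Type*} (n : ℕ) (w : FreeMonoid (ι × Bool)) :
    ∃ P : MvPolynomial (ι × Fin n × Fin n) ℤ, ∀ x : ι × Fin n × Fin n → ℝ,
      MvPolynomial.aeval x P = (wordMatrix (coordMatrix x) w).trace := by
  refine ⟨(wordMatrix (fun a => Matrix.of fun i j => MvPolynomial.X (a, i, j)) w).trace,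
    fun x => ?_⟩
  have := AddMonoidHom.map_trace (MvPolynomial.aeval (R := ℤ) x).toRingHom
    (wordMatrix (fun a => Matrix.of fun i j => MvPolynomial.X (a, i, j)) w)
  rw [← wordMatrix_map] at this
  refine this.trans ?_
  congr 3
  ext a i j
  exact MvPolynomial.aeval_X _ _

theorem isSemialgebraic_trace_image (φ : matLang.Formula (Fin m)) {W : Type*} [Finite W]
    (c : W → FreeMonoid (Fin m × Bool)) :
    IsSemialgebraic {t : W → ℝ | ∃ v : Fin m → Matrix (Fin n) (Fin n) ℝ,
      φ.Realize v ∧ ∀ w, (wordMatrix v (c w)).trace = t w} := by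
  choose P hP using fun w => exists_aeval_eq_trace_wordMatrix n (c w)
  let f : (Fin m ⊕ Fin 0) × Fin n × Fin n → (Fin m × Fin n × Fin n) ⊕ W :=
    fun x => Sum.elim (fun i => Sum.inl (i, x.2)) Fin.elim0 x.1
  have h₁ := (isSemialgebraic_realize (n := n) (k := 0) φ).reindex f
  have h₂ := IsSemialgebraic.iInter fun w : W => IsSemialgebraic.eq_zero
    (MvPolynomial.rename Sum.inl (P w) - MvPolynomial.X (Sum.inr w) :
      MvPolynomial ((Fin m × Fin n × Fin n) ⊕ W) ℤ)
  convert (h₁.inter h₂).exists_sum using 1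
  ext t
  have key (a : Fin m × Fin n × Fin n → ℝ) :
      Sum.elim a t ∈ {x | x ∘ f ∈ {v : (Fin m ⊕ Fin 0) × Fin n × Fin n → ℝ |
        BoundedFormula.Realize φ (fun a => coordMatrix v (Sum.inl a))
          (fun i => coordMatrix v (Sum.inr i))}} ∩
        ⋂ w, {x | MvPolynomial.aeval x
          (MvPolynomial.rename Sum.inl (P w) - MvPolynomial.X (Sum.inr w)) = 0} ↔
      φ.Realize (coordMatrix a) ∧ ∀ w, (wordMatrix (coordMatrix a) (c w)).trace = t w := by
    rw [Set.mem_inter_iff, Set.mem_iInter]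
    refine and_congr ?_ (forall_congr' fun w => ?_)
    · exact iff_of_eq (congrArg (BoundedFormula.Realize φ (coordMatrix a))
        (Subsingleton.elim (α := Fin 0 → _) _ _))
    · rw [Set.mem_ofPred_eq, map_sub, MvPolynomial.aeval_rename, MvPolynomial.aeval_X, sub_eq_zero,
        Sum.elim_comp_inl, hP, Sum.elim_inr]
  rw [Set.mem_ofPred_eq, Set.mem_ofPred_eq]
  constructor
  · rintro ⟨v, hv⟩
    exact ⟨fun x => v x.1 x.2.1 x.2.2, (key _).2 hv⟩
  · rintro ⟨a, ha⟩
    exact ⟨coordMatrix a, (key a).1 ha⟩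

theorem isQFDefinable_realize (hn : 1 ≤ n) (φ : matLang.Formula (Fin m)) :
    IsQFDefinable {v : Fin m → Matrix (Fin n) (Fin n) ℝ | φ.Realize v} := by
  obtain ⟨W, hW⟩ := exists_finset_word (Fin n) (Fin m)
  obtain ⟨T, hT⟩ := isSemialgebraic_trace_image (n := n) φ fun w : W => w.1
  let τ (v : Fin m → Matrix (Fin n) (Fin n) ℝ) (w : W) : ℝ := (wordMatrix v w.1).trace
  refine .of_determined (T ×ˢ {1, -1}) (c := fun k : MvPolynomial W ℤ × MvPolynomial W ℤ =>
    {v | 0 ≤ MvPolynomial.aeval (τ v) (k.2 * k.1)})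
    (fun k _ => isQFDefinable_aeval_trace_nonneg hn _ _) fun x y h hx => ?_
  obtain ⟨z, hz, hzy⟩ := hT (τ x) (τ y) (fun p hp => by
    have h₁ := h (p, 1) (by simp [hp])
    have h₂ := h (p, -1) (by simp [hp])
    simp only [Set.mem_ofPred_eq, one_mul, neg_mul, map_neg, Left.nonneg_neg_iff] at h₁ h₂
    generalize MvPolynomial.aeval (τ x) p = a at *
    generalize MvPolynomial.aeval (τ y) p = b at *
    rcases lt_trichotomy a 0 with ha | rfl | ha
    · rw [sign_neg ha, sign_neg (lt_of_not_ge fun hb => ha.not_ge (h₁.2 hb))]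
    · rw [le_antisymm (h₂.1 le_rfl) (h₁.1 le_rfl)]
    · rw [sign_pos ha, sign_pos (lt_of_not_ge fun hb => ha.not_ge (h₂.2 hb))])
    ⟨x, hx, fun _ => rfl⟩
  obtain ⟨U, hU, hUz⟩ := exists_orthogonal_of_trace_word_eq z y
    (hW z y fun w hw => hzy ⟨w, hw⟩)
  have : y = fun i => U * z i * Uᵀ := by
    funext i
    rw [hUz, mul_assoc, mul_eq_one_comm.1 hU, mul_one]
  rw [Set.mem_ofPred_eq, this, realize_conj_iff φ hU]
  exact hz

end QuantifierFree

/-- The `matLang`-structure `Mat_n(ℝ)` admits quantifier elimination: every formula is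
equivalent to a quantifier-free formula in the same free variables. -/
theorem matrixRing_real_qe (n : ℕ) (hn : 1 ≤ n) (m : ℕ)
    (φ : matLang.Formula (Fin m)) :
    ∃ ψ : matLang.Formula (Fin m), ψ.IsQF ∧
      ∀ v : Fin m → Matrix (Fin n) (Fin n) ℝ, φ.Realize v ↔ ψ.Realize v := by
  obtain ⟨ψ, hψ, h⟩ := isQFDefinable_realize hn φ
  exact ⟨ψ, hψ, fun v => (h v).symm⟩
end

section
/- Fix n ≥ 1 and consider the first-order language L consisting of the ring language (constants 0, 1, binary functions +, ·) together with two unary function symbols tr and *, and a binary relation symbol ≤. Make Mat_n(ℂ) an L-structure by interpreting the ring symbols as matrix addition and multiplication, tr as the map A ↦ (trace of A)·I, * as conjugate transposition, and ≤ as the Loewner order (A ≤ B iff B − A is positive semidefinite). Then this structure admits quantifier elimination: for every L-formula φ(x_1,…,x_m) there is a quantifier-free L-formula ψ(x_1,…,x_m) defining the same subset of Mat_n(ℂ)^m. -/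
open FirstOrder FirstOrder.Language Matrix
open scoped ComplexOrder

/-- `Mat_n(ℂ)` as a `matLang`-structure: ring symbols as matrix operations, `tr` as
`A ↦ trace(A) • I`, `*` as conjugate transposition, `≤` as the Loewner order. -/
noncomputable instance matStructureComplex (n : ℕ) :
    matLang.Structure (Matrix (Fin n) (Fin n) ℂ) where
  funMap {arity} f x :=
    match f, x with
    | .zero, _ => 0
    | .one, _ => 1
    | .add, x => x 0 + x 1
    | .mul, x => x 0 * x 1
    | .tr, x => (x 0).trace • (1 : Matrix (Fin n) (Fin n) ℂ)
    | .star, x => (x 0)ᴴ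
  RelMap {arity} r x :=
    match r, x with
    | .le, x => (x 1 - x 0).PosSemidef

section RealPolynomials

open Polynomial Order

/-- The cell of `s` with respect to the domain of `f` corresponds to the cell of `t` with respect to
the range of `f`. -/
def SameCell (f : PartialIso ℝ ℝ) (s t : ℝ) : Prop :=
  ∀ g ∈ f.val, cmp g.1 s = cmp g.2 t

theorem SameCell.lt_iff {f : PartialIso ℝ ℝ} {s t : ℝ} (h : SameCell f s t) {g : ℝ × ℝ}
    (hg : g ∈ f.val) : g.1 < s ↔ g.2 < t :=
  lt_iff_lt_of_cmp_eq_cmp (h g hg)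

theorem SameCell.eq_iff {f : PartialIso ℝ ℝ} {s t : ℝ} (h : SameCell f s t) {g : ℝ × ℝ}
    (hg : g ∈ f.val) : g.1 = s ↔ g.2 = t :=
  eq_iff_eq_of_cmp_eq_cmp (h g hg)

theorem SameCell.gt_iff {f : PartialIso ℝ ℝ} {s t : ℝ} (h : SameCell f s t) {g : ℝ × ℝ}
    (hg : g ∈ f.val) : s < g.1 ↔ t < g.2 := by
  have h1 := h.lt_iff hg
  have h2 := h.eq_iff hg
  constructor <;> intro h3 <;> by_contra h4 <;> grind

theorem SameCell.of_iff {f : PartialIso ℝ ℝ} {s t : ℝ}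
    (h : ∀ g ∈ f.val, (g.1 < s ↔ g.2 < t) ∧ (s < g.1 ↔ t < g.2)) : SameCell f s t := by
  intro g hg
  obtain ⟨h1, h2⟩ := h g hg
  rcases lt_trichotomy g.1 s with h3 | h3 | h3
  · rw [cmp_eq_lt_iff _ _ |>.2 h3, cmp_eq_lt_iff _ _ |>.2 (h1.1 h3)]
  · have : g.2 = t := by
      rcases lt_trichotomy g.2 t with h4 | h4 | h4
      · exact absurd (h1.2 h4) (by simp [h3])
      · exact h4
      · exact absurd (h2.2 h4) (by simp [h3])
    rw [cmp_eq_eq_iff _ _ |>.2 h3, cmp_eq_eq_iff _ _ |>.2 this]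
  · rw [cmp_eq_gt_iff _ _ |>.2 h3, cmp_eq_gt_iff _ _ |>.2 (h2.1 h3)]

theorem SameCell.of_mem {f : PartialIso ℝ ℝ} {g : ℝ × ℝ} (hg : g ∈ f.val) :
    SameCell f g.1 g.2 := fun h hh => f.prop h hh g hg

theorem mem_comm_val {f : PartialIso ℝ ℝ} {a b : ℝ} : (a, b) ∈ f.comm.val ↔ (b, a) ∈ f.val := by
  change (a, b) ∈ f.val.image (Equiv.prodComm ℝ ℝ) ↔ _
  simp

theorem sameCell_comm {f : PartialIso ℝ ℝ} {s t : ℝ} :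
    SameCell f.comm s t ↔ SameCell f t s := by
  constructor
  · intro h g hg
    exact (h (g.2, g.1) (mem_comm_val.2 hg)).symm
  · intro h g hg
    exact (h (g.2, g.1) (mem_comm_val.1 hg)).symm

/-- Points between two points of the cell belong to the cell. -/
theorem SameCell.between {f : PartialIso ℝ ℝ} {s t u v : ℝ} (h : SameCell f s t)
    (h' : SameCell f s u) (htv : t ≤ v) (hvu : v ≤ u) : SameCell f s v := by
  refine SameCell.of_iff fun g hg => ⟨?_, ?_⟩
  · have h1 := h.lt_iff hg
    have h2 := h.eq_iff hg
    have h3 := h'.lt_iff hg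
    have h4 := h'.eq_iff hg
    constructor <;> intro h5 <;> by_contra h6 <;> grind
  · have h1 := h.gt_iff hg
    have h2 := h.eq_iff hg
    have h3 := h'.gt_iff hg
    have h4 := h'.eq_iff hg
    constructor <;> intro h5 <;> by_contra h6 <;> grind

theorem exists_eval_neg_of_derivative_pos {q : ℝ[X]} (hq : derivative q ≠ 0) {c : ℝ}
    (h : ∀ u ≤ c, 0 < (derivative q).eval u) : ∃ u ≤ c, q.eval u < 0 := by
  by_contra! hcon
  have hdeg : 0 < q.degree := by
    rw [← natDegree_pos_iff_degree_pos]
    by_contra h0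
    exact hq (derivative_of_natDegree_zero (by omega))
  have hmono : MonotoneOn (fun x => q.eval x) (Set.Iic c) := by
    refine monotoneOn_of_deriv_nonneg (convex_Iic c) q.continuous.continuousOn
      q.differentiable.differentiableOn fun x hx => ?_
    rw [interior_Iic] at hx
    rw [Polynomial.deriv]
    exact (h x hx.le).le
  have := ((q.abs_tendsto_atBot hdeg).eventually (Filter.eventually_gt_atTop (q.eval c))).and
    (Filter.eventually_le_atBot c)
  obtain ⟨u, hu1, hu2⟩ := this.exists
  rw [abs_of_nonneg (hcon u hu2)] at hu1
  exact absurd (hmono hu2 (Set.mem_Iic.2 le_rfl) hu2) (not_le.2 hu1)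

theorem exists_eval_neg_of_derivative_neg {q : ℝ[X]} (hq : derivative q ≠ 0) {c : ℝ}
    (h : ∀ u, c ≤ u → (derivative q).eval u < 0) : ∃ u, c ≤ u ∧ q.eval u < 0 := by
  have hd : derivative (q.comp (-X)) = -(derivative q).comp (-X) := by
    simp [derivative_comp]
  obtain ⟨u, hu, hu'⟩ := exists_eval_neg_of_derivative_pos (q := q.comp (-X)) (c := -c)
    (by
      rw [hd]
      intro h0
      apply hq
      have h1 : (derivative q).comp (-X) = 0 := neg_eq_zero.1 h0
      have h2 := congrArg (fun r => r.comp (-X)) h1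
      simpa [comp_assoc] using h2)
    (fun u hu => by
      rw [hd]
      simpa using h (-u) (by linarith))
  exact ⟨-u, by linarith, by simpa using hu'⟩

/-- The values of `p` and `q` at the points of `f` and of their derivatives on the cells of `f`
have the same signs, and all zeros of the derivative of `p` are in the domain of `f`. -/
structure CellCompatible (f : PartialIso ℝ ℝ) (p q : ℝ[X]) : Prop where
  sign_derivative : ∀ s t, SameCell f s t →
    SignType.sign ((derivative p).eval s) = SignType.sign ((derivative q).eval t)
  sign_point : ∀ g ∈ f.val, SignType.sign (p.eval g.1) = SignType.sign (q.eval g.2)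
  complete : ∀ s, (derivative p).eval s = 0 → ∃ g ∈ f.val, g.1 = s
  left_ne : derivative p ≠ 0
  right_ne : derivative q ≠ 0

namespace CellCompatible

variable {f : PartialIso ℝ ℝ} {p q : ℝ[X]}

theorem neg (h : CellCompatible f p q) : CellCompatible f (-p) (-q) where
  sign_derivative s t hst := by simp [Left.sign_neg, h.sign_derivative s t hst]
  sign_point g hg := by simp [Left.sign_neg, h.sign_point g hg]
  complete s hs := h.complete s (by simpa using hs)
  left_ne := by simpa using h.left_ne
  right_ne := by simpa using h.right_ne

theorem comm (h : CellCompatible f p q) : CellCompatible f.comm q p where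
  sign_derivative s t hst := (h.sign_derivative t s (sameCell_comm.1 hst)).symm
  sign_point g hg := (h.sign_point (g.2, g.1) (mem_comm_val.1 hg)).symm
  complete t ht := by
    obtain ⟨s, hs⟩ := PartialIso.exists_across f.comm t
    have hs : SameCell f s t := sameCell_comm.1 hs
    have h0 := h.sign_derivative s t hs
    rw [ht, sign_zero, sign_eq_zero_iff] at h0
    obtain ⟨g, hg, rfl⟩ := h.complete s h0
    exact ⟨(g.2, g.1), mem_comm_val.2 hg, (hs.eq_iff hg).1 rfl⟩
  left_ne := h.right_ne
  right_ne := h.left_ne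

theorem exists_neg_of_derivative_pos (h : CellCompatible f p q) {s : ℝ}
    (hs : ∀ g ∈ f.val, g.1 ≠ s) (hd : 0 < (derivative p).eval s) (hp : p.eval s ≤ 0) :
    ∃ u, SameCell f s u ∧ q.eval u < 0 := by
  obtain ⟨t, ht⟩ := PartialIso.exists_across f s
  have ht : SameCell f s t := ht
  have hq : ∀ u, SameCell f s u → 0 < (derivative q).eval u := fun u hu => by
    rw [← sign_eq_one_iff, ← h.sign_derivative s u hu, sign_eq_one_iff]; exact hd
  by_cases hL : ∃ g ∈ f.val, g.1 < s
  · obtain ⟨g, hgL, hmax⟩ := (f.val.filter (fun g => g.1 < s)).exists_max_image (fun g => g.1)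
      (by obtain ⟨g, hg, hgs⟩ := hL; exact ⟨g, by simp [hg, hgs]⟩)
    simp only [Finset.mem_filter] at hgL hmax
    obtain ⟨hg, hgs⟩ := hgL
    have hpos : ∀ v, g.1 < v → v ≤ s → 0 < (derivative p).eval v := by
      intro v hv hvs
      have hc : SameCell f v t := by
        refine SameCell.of_iff fun k hk => ?_
        have h1 := ht.lt_iff hk
        have h2 := ht.gt_iff hk
        have h3 := hs k hk
        have h4 := hmax k
        rw [← h1, ← h2]
        constructor <;> constructor <;> intro h5
        · linarith
        · linarith [h4 ⟨hk, h5⟩]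
        · by_contra h6
          have h7 : k.1 < s := lt_of_le_of_ne (not_lt.1 h6) h3
          linarith [h4 ⟨hk, h7⟩]
        · linarith
      rw [← sign_eq_one_iff, h.sign_derivative v t hc, sign_eq_one_iff]
      exact hq t ht
    have hmono : StrictMonoOn (fun x => p.eval x) (Set.Icc g.1 s) := by
      refine strictMonoOn_of_deriv_pos (convex_Icc _ _) p.continuous.continuousOn fun x hx => ?_
      rw [interior_Icc] at hx
      rw [Polynomial.deriv]
      exact hpos x hx.1 hx.2.le
    have hlt : p.eval g.1 < p.eval s :=
      hmono (Set.left_mem_Icc.2 hgs.le) (Set.right_mem_Icc.2 hgs.le) hgs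
    have hqg : q.eval g.2 < 0 := by
      rw [← sign_eq_neg_one_iff, ← h.sign_point g hg, sign_eq_neg_one_iff]
      linarith
    have hgt : g.2 < t := (ht.lt_iff hg).1 hgs
    have hev : ∀ᶠ u in nhdsWithin g.2 (Set.Ioi g.2), q.eval u < 0 :=
      (q.continuous.continuousAt.eventually (gt_mem_nhds hqg)).filter_mono nhdsWithin_le_nhds
    obtain ⟨u, hu1, hu2⟩ := (hev.and (Ioo_mem_nhdsGT hgt)).exists
    refine ⟨u, SameCell.of_iff fun k hk => ?_, hu1⟩
    have h1 := ht.lt_iff hk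
    have h2 := ht.gt_iff hk
    have h3 := hs k hk
    have h4 := hmax k
    have h8 := (SameCell.of_mem hg).lt_iff hk
    have h9 := (SameCell.of_mem hg).eq_iff hk
    have h10 : k.1 ≤ g.1 → k.2 ≤ g.2 := fun h => by
      rcases h.lt_or_eq with h | h
      · exact (h8.1 h).le
      · exact (h9.1 h).le
    obtain ⟨hu2, hu3⟩ := hu2
    constructor <;> constructor <;> intro h5
    · linarith [h10 (h4 ⟨hk, h5⟩)]
    · exact h1.2 (by linarith)
    · linarith [h2.1 h5]
    · by_contra h6
      have h7 : k.1 < s := lt_of_le_of_ne (not_lt.1 h6) h3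
      linarith [h10 (h4 ⟨hk, h7⟩)]
  · push Not at hL
    have hcell : ∀ u ≤ t, SameCell f s u := by
      intro u hu
      refine SameCell.of_iff fun k hk => ?_
      have h2 := ht.gt_iff hk
      have h3 : s < k.1 := lt_of_le_of_ne (hL k hk) (hs k hk).symm
      have h4 := h2.1 h3
      constructor <;> constructor <;> intro h5 <;> linarith
    obtain ⟨u, hu, hu'⟩ := exists_eval_neg_of_derivative_pos h.right_ne
      (fun u hu => hq u (hcell u hu))
    exact ⟨u, hcell u hu, hu'⟩

theorem exists_neg_of_derivative_neg (h : CellCompatible f p q) {s : ℝ}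
    (hs : ∀ g ∈ f.val, g.1 ≠ s) (hd : (derivative p).eval s < 0) (hp : p.eval s ≤ 0) :
    ∃ u, SameCell f s u ∧ q.eval u < 0 := by
  obtain ⟨t, ht⟩ := PartialIso.exists_across f s
  have ht : SameCell f s t := ht
  have hq : ∀ u, SameCell f s u → (derivative q).eval u < 0 := fun u hu => by
    rw [← sign_eq_neg_one_iff, ← h.sign_derivative s u hu, sign_eq_neg_one_iff]; exact hd
  by_cases hL : ∃ g ∈ f.val, s < g.1
  · obtain ⟨g, hgL, hmin⟩ := (f.val.filter (fun g => s < g.1)).exists_min_image (fun g => g.1)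
      (by obtain ⟨g, hg, hgs⟩ := hL; exact ⟨g, by simp [hg, hgs]⟩)
    simp only [Finset.mem_filter] at hgL hmin
    obtain ⟨hg, hgs⟩ := hgL
    have hneg : ∀ v, v < g.1 → s ≤ v → (derivative p).eval v < 0 := by
      intro v hv hvs
      have hc : SameCell f v t := by
        refine SameCell.of_iff fun k hk => ?_
        have h1 := ht.lt_iff hk
        have h2 := ht.gt_iff hk
        have h3 := hs k hk
        have h4 := hmin k
        rw [← h1, ← h2]
        constructor <;> constructor <;> intro h5
        · by_contra h6
          have h7 : s < k.1 := lt_of_le_of_ne (not_lt.1 h6) h3.symm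
          linarith [h4 ⟨hk, h7⟩]
        · linarith
        · linarith
        · linarith [h4 ⟨hk, h5⟩]
      rw [← sign_eq_neg_one_iff, h.sign_derivative v t hc, sign_eq_neg_one_iff]
      exact hq t ht
    have hmono : StrictAntiOn (fun x => p.eval x) (Set.Icc s g.1) := by
      refine strictAntiOn_of_deriv_neg (convex_Icc _ _) p.continuous.continuousOn fun x hx => ?_
      rw [interior_Icc] at hx
      rw [Polynomial.deriv]
      exact hneg x hx.2 hx.1.le
    have hlt : p.eval g.1 < p.eval s :=
      hmono (Set.left_mem_Icc.2 hgs.le) (Set.right_mem_Icc.2 hgs.le) hgs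
    have hqg : q.eval g.2 < 0 := by
      rw [← sign_eq_neg_one_iff, ← h.sign_point g hg, sign_eq_neg_one_iff]
      linarith
    have hgt : t < g.2 := (ht.gt_iff hg).1 hgs
    have hev : ∀ᶠ u in nhdsWithin g.2 (Set.Iio g.2), q.eval u < 0 :=
      (q.continuous.continuousAt.eventually (gt_mem_nhds hqg)).filter_mono nhdsWithin_le_nhds
    obtain ⟨u, hu1, hu2⟩ := (hev.and (Ioo_mem_nhdsLT hgt)).exists
    refine ⟨u, SameCell.of_iff fun k hk => ?_, hu1⟩
    have h1 := ht.lt_iff hk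
    have h2 := ht.gt_iff hk
    have h3 := hs k hk
    have h4 := hmin k
    have h8 := (SameCell.of_mem hg).gt_iff hk
    have h9 := (SameCell.of_mem hg).eq_iff hk
    have h10 : g.1 ≤ k.1 → g.2 ≤ k.2 := fun h => by
      rcases h.lt_or_eq with h | h
      · exact (h8.1 h).le
      · exact (h9.1 h.symm).ge
    obtain ⟨hu2, hu3⟩ := hu2
    constructor <;> constructor <;> intro h5
    · linarith [h1.1 h5]
    · by_contra h6
      have h7 : s < k.1 := lt_of_le_of_ne (not_lt.1 h6) h3.symm
      linarith [h10 (h4 ⟨hk, h7⟩)]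
    · linarith [h10 (h4 ⟨hk, h5⟩)]
    · exact h2.2 (by linarith)
  · push Not at hL
    have hcell : ∀ u, t ≤ u → SameCell f s u := by
      intro u hu
      refine SameCell.of_iff fun k hk => ?_
      have h2 := ht.lt_iff hk
      have h3 : k.1 < s := lt_of_le_of_ne (hL k hk) (hs k hk)
      have h4 := h2.1 h3
      constructor <;> constructor <;> intro h5 <;> linarith
    obtain ⟨u, hu, hu'⟩ := exists_eval_neg_of_derivative_neg h.right_ne
      (fun u hu => hq u (hcell u hu))
    exact ⟨u, hcell u hu, hu'⟩

theorem exists_neg (h : CellCompatible f p q) {s : ℝ} (hs : ∀ g ∈ f.val, g.1 ≠ s)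
    (hp : p.eval s ≤ 0) : ∃ u, SameCell f s u ∧ q.eval u < 0 := by
  rcases lt_trichotomy ((derivative p).eval s) 0 with hd | hd | hd
  · exact h.exists_neg_of_derivative_neg hs hd hp
  · obtain ⟨g, hg, hgs⟩ := h.complete s hd
    exact absurd hgs (hs g hg)
  · exact h.exists_neg_of_derivative_pos hs hd hp

theorem exists_pos (h : CellCompatible f p q) {s : ℝ} (hs : ∀ g ∈ f.val, g.1 ≠ s)
    (hp : 0 ≤ p.eval s) : ∃ u, SameCell f s u ∧ 0 < q.eval u := by
  obtain ⟨u, hu, hu'⟩ := h.neg.exists_neg hs (by simpa using hp)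
  exact ⟨u, hu, by simpa using hu'⟩

end CellCompatible

/-- The intermediate value theorem inside a cell. -/
theorem exists_root_of_sameCell {f : PartialIso ℝ ℝ} {q : ℝ[X]} {s t u : ℝ}
    (ht : SameCell f s t) (hu : SameCell f s u) (hqt : q.eval t ≤ 0) (hqu : 0 ≤ q.eval u) :
    ∃ c, SameCell f s c ∧ q.eval c = 0 := by
  obtain ⟨c, hc, hc0⟩ := intermediate_value_uIcc (f := fun x => q.eval x)
    (q.continuous.continuousOn (s := Set.uIcc t u)) (Set.mem_uIcc.2 (Or.inl ⟨hqt, hqu⟩))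
  refine ⟨c, ?_, hc0⟩
  rcases Set.mem_uIcc.1 hc with h | h
  · exact ht.between hu h.1 h.2
  · exact hu.between ht h.1 h.2

theorem CellCompatible.exists_root {f : PartialIso ℝ ℝ} {p q : ℝ[X]} (h : CellCompatible f p q)
    {s : ℝ} (hp : p.eval s = 0) : ∃ c, SameCell f s c ∧ q.eval c = 0 := by
  by_cases hs : ∀ g ∈ f.val, g.1 ≠ s
  · obtain ⟨u, hu, hu'⟩ := h.exists_neg hs hp.le
    obtain ⟨v, hv, hv'⟩ := h.exists_pos hs hp.ge
    exact exists_root_of_sameCell hu hv hu'.le hv'.le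
  · push Not at hs
    obtain ⟨g, hg, rfl⟩ := hs
    refine ⟨g.2, SameCell.of_mem hg, ?_⟩
    have := h.sign_point g hg
    rwa [hp, sign_zero, eq_comm, sign_eq_zero_iff] at this

/-- Adding a pair of points in corresponding cells to a partial isomorphism. -/
noncomputable def insertPair (f : PartialIso ℝ ℝ) (s t : ℝ) (h : SameCell f s t) :
    PartialIso ℝ ℝ :=
  ⟨insert (s, t) f.val, by
    intro p hp q hq
    rw [Finset.mem_insert] at hp hq
    rcases hp with rfl | hp <;> rcases hq with rfl | hq
    · simp only [cmp_self_eq_eq]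
    · rw [cmp_eq_cmp_symm]
      exact h q hq
    · exact h p hp
    · exact f.prop p hp q hq⟩

theorem SameCell.mono {f f' : PartialIso ℝ ℝ} (hf : f.val ⊆ f'.val) {s t : ℝ}
    (h : SameCell f' s t) : SameCell f s t := fun g hg => h g (hf hg)

theorem CellCompatible.mono {f f' : PartialIso ℝ ℝ} {p q : ℝ[X]} (h : CellCompatible f p q)
    (hf : f.val ⊆ f'.val) (hnew : ∀ g ∈ f'.val, g ∈ f.val ∨ (p.eval g.1 = 0 ∧ q.eval g.2 = 0)) :
    CellCompatible f' p q where
  sign_derivative s t hst := h.sign_derivative s t (hst.mono hf)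
  sign_point g hg := by
    rcases hnew g hg with hg | ⟨h1, h2⟩
    · exact h.sign_point g hg
    · rw [h1, h2]
  complete s hs := by
    obtain ⟨g, hg, hgs⟩ := h.complete s hs
    exact ⟨g, hf hg, hgs⟩
  left_ne := h.left_ne
  right_ne := h.right_ne

/-- A partial isomorphism compatible with `p` and `q` extends to one whose domain contains all the
zeros of `p` and whose cells know the signs of `p` and `q`. -/
theorem CellCompatible.exists_extension {f : PartialIso ℝ ℝ} {p q : ℝ[X]}
    (h : CellCompatible f p q) :
    ∃ f' : PartialIso ℝ ℝ, f.val ⊆ f'.val ∧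
      (∀ g ∈ f'.val, g ∈ f.val ∨ (p.eval g.1 = 0 ∧ q.eval g.2 = 0)) ∧
      (∀ s, p.eval s = 0 → ∃ g ∈ f'.val, g.1 = s) ∧
      ∀ s t, SameCell f' s t → SignType.sign (p.eval s) = SignType.sign (q.eval t) := by
  have key : ∀ Z : Finset ℝ, (∀ z ∈ Z, p.eval z = 0) →
      ∃ f' : PartialIso ℝ ℝ, f.val ⊆ f'.val ∧
        (∀ g ∈ f'.val, g ∈ f.val ∨ (p.eval g.1 = 0 ∧ q.eval g.2 = 0)) ∧
        ∀ z ∈ Z, ∃ g ∈ f'.val, g.1 = z := by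
    intro Z
    induction Z using Finset.induction_on with
    | empty => exact fun _ => ⟨f, subset_rfl, fun g hg => Or.inl hg, by simp⟩
    | insert z Z _ ih =>
      intro hZ
      obtain ⟨f', hf, hnew, hdom⟩ := ih fun w hw => hZ w (Finset.mem_insert_of_mem hw)
      have hz := hZ z (Finset.mem_insert_self z Z)
      obtain ⟨c, hc, hc0⟩ := (h.mono hf hnew).exists_root hz
      have hsub : f'.val ⊆ (insertPair f' z c hc).val := Finset.subset_insert _ _
      refine ⟨insertPair f' z c hc, hf.trans hsub, fun g hg => ?_, fun w hw => ?_⟩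
      · rcases Finset.mem_insert.1 hg with rfl | hg
        · exact Or.inr ⟨hz, hc0⟩
        · exact hnew g hg
      · rcases Finset.mem_insert.1 hw with rfl | hw
        · exact ⟨(w, c), Finset.mem_insert_self _ _, rfl⟩
        · obtain ⟨g, hg, hgw⟩ := hdom w hw
          exact ⟨g, hsub hg, hgw⟩
  have hp0 : p ≠ 0 := by
    rintro rfl
    exact h.left_ne (by simp)
  obtain ⟨f', hf, hnew, hdom⟩ := key p.roots.toFinset fun z hz => by
    simpa [hp0] using hz
  have hdom' : ∀ s, p.eval s = 0 → ∃ g ∈ f'.val, g.1 = s := fun s hs =>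
    hdom s (by simpa [hp0] using hs)
  have h' := h.mono hf hnew
  refine ⟨f', hf, hnew, hdom', fun s t hst => ?_⟩
  by_cases hs : ∀ g ∈ f'.val, g.1 ≠ s
  · have hroot : ∀ c, SameCell f' s c → q.eval c ≠ 0 := by
      intro c hc hc0
      obtain ⟨d, hd, hd0⟩ := h'.comm.exists_root hc0
      obtain ⟨g, hg, rfl⟩ := hdom' d hd0
      exact hs g hg ((hc.eq_iff hg).2 (((sameCell_comm.1 hd).eq_iff hg).1 rfl))
    rcases lt_trichotomy (p.eval s) 0 with hp | hp | hp
    · obtain ⟨u, hu, hu'⟩ := h'.exists_neg hs hp.le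
      have : q.eval t < 0 := by
        by_contra hcon
        obtain ⟨c, hc, hc0⟩ := exists_root_of_sameCell hu hst hu'.le (not_lt.1 hcon)
        exact hroot c hc hc0
      rw [sign_neg hp, sign_neg this]
    · obtain ⟨g, hg, hgs⟩ := hdom' s hp
      exact absurd hgs (hs g hg)
    · obtain ⟨u, hu, hu'⟩ := h'.exists_pos hs hp.le
      have : 0 < q.eval t := by
        by_contra hcon
        obtain ⟨c, hc, hc0⟩ := exists_root_of_sameCell hst hu (not_lt.1 hcon) hu'.le
        exact hroot c hc hc0
      rw [sign_pos hp, sign_pos this]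
  · push Not at hs
    obtain ⟨g, hg, rfl⟩ := hs
    rw [← (hst.eq_iff hg).1 rfl]
    exact h'.sign_point g hg

end RealPolynomials

section SignDiagrams

open Polynomial Order

variable {A : Type*} [CommRing A]

theorem exists_pseudoRemainder (Q : A[X]) (hQ : 0 < Q.natDegree) (P : A[X]) :
    ∃ (R S : A[X]) (k : ℕ), C Q.leadingCoeff ^ k * P = S * Q + R ∧
      R.natDegree < Q.natDegree := by
  induction h : P.natDegree using Nat.strong_induction_on generalizing P with
  | _ d ih =>
    by_cases hd : d < Q.natDegree
    · exact ⟨P, 0, 0, by simp, by omega⟩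
    · push Not at hd
      set P' := C Q.leadingCoeff * P - C P.leadingCoeff * X ^ (d - Q.natDegree) * Q with hP'
      have hdeg : P'.natDegree < d := by
        suffices P'.natDegree ≤ d - 1 by omega
        rw [natDegree_le_iff_coeff_eq_zero]
        intro m hm
        have hm' : d ≤ m := by omega
        rw [hP', coeff_sub, coeff_C_mul, mul_assoc, coeff_C_mul, coeff_X_pow_mul',
          if_pos (by omega)]
        rcases hm'.eq_or_lt with rfl | hlt
        · rw [Nat.sub_sub_self hd, coeff_natDegree, ← h, coeff_natDegree, mul_comm, sub_self]
        · rw [coeff_eq_zero_of_natDegree_lt (p := P) (by omega),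
            coeff_eq_zero_of_natDegree_lt (p := Q) (by omega)]
          simp
      obtain ⟨R, S, k, hk, hR⟩ := ih _ hdeg P' rfl
      refine ⟨R, S + C Q.leadingCoeff ^ k * (C P.leadingCoeff * X ^ (d - Q.natDegree)), k + 1,
        ?_, hR⟩
      have : C Q.leadingCoeff * P = P' + C P.leadingCoeff * X ^ (d - Q.natDegree) * Q := by
        rw [hP']; ring
      rw [pow_succ, mul_assoc, this, mul_add, hk]
      ring

/-- A remainder of the pseudo-division of `P` by `Q`. -/
noncomputable def pseudoRem (P Q : A[X]) : A[X] :=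
  open Classical in
  if h : 0 < Q.natDegree then (exists_pseudoRemainder Q h P).choose else 0

theorem pseudoRem_spec (P : A[X]) {Q : A[X]} (h : 0 < Q.natDegree) :
    (∃ (S : A[X]) (k : ℕ), C Q.leadingCoeff ^ k * P = S * Q + pseudoRem P Q) ∧
      (pseudoRem P Q).natDegree < Q.natDegree := by
  rw [pseudoRem, dif_pos h]
  obtain ⟨S, k, h1, h2⟩ := (exists_pseudoRemainder Q h P).choose_spec
  exact ⟨⟨S, k, h1⟩, h2⟩

/-- The elements of `H` of degree at least `e` have their derivatives, their truncations and their
pseudo-remainders in `H`. -/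
def ClosedAbove (e : ℕ) (H : Finset A[X]) : Prop :=
  ∀ P ∈ H, e ≤ P.natDegree → derivative P ∈ H ∧ P.eraseLead ∈ H ∧
    ∀ Q ∈ H, e ≤ Q.natDegree → Q.natDegree ≤ P.natDegree → pseudoRem P Q ∈ H

theorem exists_closedAbove (H : Finset A[X]) : ∃ K, H ⊆ K ∧ ClosedAbove 1 K := by
  classical
  have step : ∀ e : ℕ, ∀ K : Finset A[X], ClosedAbove (e + 1) K →
      ∃ K', K ⊆ K' ∧ ClosedAbove 1 K' := by
    intro e
    induction e with
    | zero => exact fun K hK => ⟨K, subset_rfl, hK⟩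
    | succ e ih =>
      intro K hK
      set D := K.filter (fun P => e + 1 ≤ P.natDegree) with hD
      set N := D.image derivative ∪ D.image eraseLead ∪
        ((D ×ˢ D).filter (fun z => z.2.natDegree ≤ z.1.natDegree)).image
          (fun z => pseudoRem z.1 z.2) with hN
      have hmem : ∀ P ∈ K ∪ N, e + 1 ≤ P.natDegree → P ∈ K := by
        intro P hP hdeg
        rcases Finset.mem_union.1 hP with hP | hP
        · exact hP
        · simp only [hN, hD, Finset.mem_union, Finset.mem_image, Finset.mem_filter,
            Finset.mem_product, Prod.exists] at hP
          rcases hP with (⟨P, ⟨hPK, hPd⟩, rfl⟩ | ⟨P, ⟨hPK, hPd⟩, rfl⟩) |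
            ⟨P, Q, ⟨⟨⟨hPK, hPd⟩, hQK, hQd⟩, hle⟩, rfl⟩
          · have := natDegree_derivative_le P
            exact (hK P hPK (by omega)).1
          · have := eraseLead_natDegree_le P
            exact (hK P hPK (by omega)).2.1
          · have := (pseudoRem_spec P (Q := Q) (by omega)).2
            exact (hK P hPK (by omega)).2.2 Q hQK (by omega) hle
      have hK' : ClosedAbove (e + 1) (K ∪ N) := by
        intro P hP hPd
        have hPD : P ∈ D := Finset.mem_filter.2 ⟨hmem P hP hPd, hPd⟩
        refine ⟨Finset.mem_union_right _ ?_, Finset.mem_union_right _ ?_, fun Q hQ hQd hle =>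
          Finset.mem_union_right _ ?_⟩
        · exact Finset.mem_union_left _ (Finset.mem_union_left _ (Finset.mem_image_of_mem _ hPD))
        · exact Finset.mem_union_left _ (Finset.mem_union_right _ (Finset.mem_image_of_mem _ hPD))
        · have hQD : Q ∈ D := Finset.mem_filter.2 ⟨hmem Q hQ hQd, hQd⟩
          exact Finset.mem_union_right _ (Finset.mem_image.2 ⟨(P, Q),
            Finset.mem_filter.2 ⟨Finset.mem_product.2 ⟨hPD, hQD⟩, hle⟩, rfl⟩)
      obtain ⟨K', hsub, hcl⟩ := ih _ hK'
      exact ⟨K', Finset.subset_union_left.trans hsub, hcl⟩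
  refine step (H.sup natDegree) H fun P hP hd => ?_
  have := Finset.le_sup (f := natDegree) hP
  omega

theorem map_eraseLead_of_leadingCoeff {x : A →+* ℝ} {P : A[X]} (h : x P.leadingCoeff = 0) :
    P.map x = P.eraseLead.map x := by
  have := congrArg (Polynomial.map x) P.eraseLead_add_C_mul_X_pow
  rw [← this, Polynomial.map_add, Polynomial.map_mul, map_C, h, C_0, zero_mul, add_zero]

theorem natDegree_map_of_ne {x : A →+* ℝ} {P : A[X]} (h : x P.leadingCoeff ≠ 0) :
    (P.map x).natDegree = P.natDegree :=
  natDegree_map_of_leadingCoeff_ne_zero x h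

/-- Two specialisations that agree on the signs of the leading coefficients of a closed family
have the same sign diagram. -/
theorem exists_partialIso_of_sign_leadingCoeff {K : Finset A[X]} (hK : ClosedAbove 1 K)
    {x y : A →+* ℝ}
    (hxy : ∀ P ∈ K, SignType.sign (x P.leadingCoeff) = SignType.sign (y P.leadingCoeff)) :
    ∃ f : PartialIso ℝ ℝ, ∀ P ∈ K, ∀ s t, SameCell f s t →
      SignType.sign ((P.map x).eval s) = SignType.sign ((P.map y).eval t) := by
  classical
  have main : ∀ H : Finset A[X], H ⊆ K →
      (∀ P ∈ K, ∀ Q ∈ H, P.natDegree < Q.natDegree → P ∈ H) →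
      ∃ f : PartialIso ℝ ℝ,
        (∀ P ∈ H, ∀ s t, SameCell f s t →
          SignType.sign ((P.map x).eval s) = SignType.sign ((P.map y).eval t)) ∧
        (∀ P ∈ H, P.map x ≠ 0 → ∀ s, (P.map x).eval s = 0 → ∃ g ∈ f.val, g.1 = s) ∧
        ∀ g ∈ f.val, ∃ Q ∈ H, x Q.leadingCoeff ≠ 0 ∧ (Q.map x).eval g.1 = 0 := by
    intro H
    refine Finset.induction_on_max_value natDegree H ?_ ?_
    · exact fun _ _ => ⟨default, by simp, by simp, fun g hg => absurd hg (by
        exact Finset.notMem_empty g)⟩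
    · intro P H hPH hmax ih hsub hdown
      have hPK : P ∈ K := hsub (Finset.mem_insert_self _ _)
      have hlow : ∀ R ∈ K, R.natDegree < P.natDegree → R ∈ H := fun R hR hlt =>
        (Finset.mem_insert.1 (hdown R hR P (Finset.mem_insert_self _ _) hlt)).resolve_left
          (by rintro rfl; exact lt_irrefl _ hlt)
      obtain ⟨f, hf1, hf2, hf3⟩ := ih (fun Q hQ => hsub (Finset.mem_insert_of_mem hQ))
        fun R hR Q hQ hlt => (Finset.mem_insert.1
          (hdown R hR Q (Finset.mem_insert_of_mem hQ) hlt)).resolve_left (by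
            rintro rfl
            exact absurd (hmax Q hQ) (not_le.2 hlt))
      have hlc := hxy P hPK
      have finish : (∀ s t, SameCell f s t →
          SignType.sign ((P.map x).eval s) = SignType.sign ((P.map y).eval t)) →
          (P.map x ≠ 0 → ∀ s, (P.map x).eval s = 0 → ∃ g ∈ f.val, g.1 = s) →
          ∃ f : PartialIso ℝ ℝ,
            (∀ Q ∈ insert P H, ∀ s t, SameCell f s t →
              SignType.sign ((Q.map x).eval s) = SignType.sign ((Q.map y).eval t)) ∧
            (∀ Q ∈ insert P H, Q.map x ≠ 0 → ∀ s, (Q.map x).eval s = 0 →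
              ∃ g ∈ f.val, g.1 = s) ∧
            ∀ g ∈ f.val, ∃ Q ∈ insert P H, x Q.leadingCoeff ≠ 0 ∧ (Q.map x).eval g.1 = 0 := by
        intro h1 h2
        refine ⟨f, fun Q hQ => ?_, fun Q hQ => ?_, fun g hg => ?_⟩
        · rcases Finset.mem_insert.1 hQ with rfl | hQ
          · exact h1
          · exact hf1 Q hQ
        · rcases Finset.mem_insert.1 hQ with rfl | hQ
          · exact h2
          · exact hf2 Q hQ
        · obtain ⟨Q, hQ, h⟩ := hf3 g hg
          exact ⟨Q, Finset.mem_insert_of_mem hQ, h⟩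
      by_cases hdeg : P.natDegree = 0
      · obtain ⟨c, rfl⟩ : ∃ c, P = C c := ⟨P.coeff 0, eq_C_of_natDegree_eq_zero hdeg⟩
        simp only [leadingCoeff_C] at hlc
        refine finish (fun s t _ => by simpa using hlc) fun hne s hs => ?_
        simp only [map_C, eval_C] at hs
        simp [hs] at hne
      have hdeg' : 1 ≤ P.natDegree := Nat.one_le_iff_ne_zero.2 hdeg
      obtain ⟨hder, herase, hrem⟩ := hK P hPK hdeg'
      by_cases hx : x P.leadingCoeff = 0
      · have hy : y P.leadingCoeff = 0 := by
          rw [hx, sign_zero, eq_comm, sign_eq_zero_iff] at hlc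
          exact hlc
        have hE : P.eraseLead ∈ H := hlow _ herase (by
          have := eraseLead_natDegree_le P
          omega)
        rw [map_eraseLead_of_leadingCoeff hx, map_eraseLead_of_leadingCoeff hy] at finish
        exact finish (hf1 _ hE) (hf2 _ hE)
      have hy : y P.leadingCoeff ≠ 0 := by
        intro hy
        rw [hy, sign_zero, sign_eq_zero_iff] at hlc
        exact hx hlc
      have hD : derivative P ∈ H := hlow _ hder (by
        have := natDegree_derivative_le P
        omega)
      have hne : ∀ z : A →+* ℝ, z P.leadingCoeff ≠ 0 → derivative (P.map z) ≠ 0 := by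
        intro z hz h0
        have := Polynomial.derivative_eq_zero.1 h0
        rw [natDegree_map_of_ne hz] at this
        exact hdeg this
      have hcompat : CellCompatible f (P.map x) (P.map y) :=
        { sign_derivative := fun s t hst => by
            rw [derivative_map, derivative_map]
            exact hf1 _ hD s t hst
          sign_point := fun g hg => by
            obtain ⟨Q, hQ, hQlc, hQ0⟩ := hf3 g hg
            have hQK : Q ∈ K := hsub (Finset.mem_insert_of_mem hQ)
            have hQd : 0 < Q.natDegree := by
              by_contra h0
              obtain ⟨c, rfl⟩ : ∃ c, Q = C c :=
                ⟨Q.coeff 0, eq_C_of_natDegree_eq_zero (by omega)⟩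
              simp only [leadingCoeff_C, map_C, eval_C] at hQlc hQ0
              exact hQlc hQ0
            have hcell := SameCell.of_mem hg
            have hQ0' : (Q.map y).eval g.2 = 0 := by
              have := hf1 Q hQ _ _ hcell
              rwa [hQ0, sign_zero, eq_comm, sign_eq_zero_iff] at this
            have hR : pseudoRem P Q ∈ K := hrem Q hQK hQd (hmax Q hQ)
            obtain ⟨⟨S, k, hS⟩, hRd⟩ := pseudoRem_spec P hQd
            have hRH : pseudoRem P Q ∈ H := hlow _ hR (hRd.trans_le (hmax Q hQ))
            have hsgn := hf1 _ hRH _ _ hcell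
            have e1 := congrArg (fun T => (T.map x).eval g.1) hS
            have e2 := congrArg (fun T => (T.map y).eval g.2) hS
            simp only [Polynomial.map_mul, Polynomial.map_add, Polynomial.map_pow, map_C, eval_mul,
              eval_add, eval_pow, eval_C, hQ0, hQ0', mul_zero, zero_add] at e1 e2
            rw [← e1, ← e2, sign_mul, sign_mul, sign_pow, sign_pow, hxy Q hQK] at hsgn
            refine mul_left_cancel₀ (pow_ne_zero k ?_) hsgn
            rw [← hxy Q hQK]
            exact sign_ne_zero.2 hQlc
          complete := fun s hs => by
            rw [derivative_map] at hs
            refine hf2 _ hD ?_ s hs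
            rw [← derivative_map]
            exact hne x hx
          left_ne := hne x hx
          right_ne := hne y hy }
      obtain ⟨f', hff, hnew, hdom, hsign⟩ := hcompat.exists_extension
      refine ⟨f', fun Q hQ => ?_, fun Q hQ => ?_, fun g hg => ?_⟩
      · rcases Finset.mem_insert.1 hQ with rfl | hQ
        · exact hsign
        · exact fun s t hst => hf1 Q hQ s t (hst.mono hff)
      · rcases Finset.mem_insert.1 hQ with rfl | hQ
        · exact fun _ => hdom
        · intro h0 s hs
          obtain ⟨g, hg, hgs⟩ := hf2 Q hQ h0 s hs
          exact ⟨g, hff hg, hgs⟩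
      · rcases hnew g hg with hg | ⟨h0, _⟩
        · obtain ⟨Q, hQ, h⟩ := hf3 g hg
          exact ⟨Q, Finset.mem_insert_of_mem hQ, h⟩
        · exact ⟨P, Finset.mem_insert_self _ _, hx, h0⟩
  obtain ⟨f, hf, _⟩ := main K subset_rfl fun P hP _ _ _ => hP
  exact ⟨f, hf⟩

/-- **Tarski–Seidenberg principle**: the sign vectors realised by finitely many univariate
polynomials over `A` under a specialisation `A → ℝ` only depend on the signs of finitely many
elements of `A`. -/
theorem exists_finset_sign_transfer (H : Finset A[X]) :
    ∃ F : Finset A, ∀ x y : A →+* ℝ, (∀ a ∈ F, SignType.sign (x a) = SignType.sign (y a)) →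
      ∀ s, ∃ t, ∀ P ∈ H,
        SignType.sign ((P.map x).eval s) = SignType.sign ((P.map y).eval t) := by
  classical
  obtain ⟨K, hHK, hK⟩ := exists_closedAbove H
  refine ⟨K.image leadingCoeff, fun x y hxy s => ?_⟩
  obtain ⟨f, hf⟩ := exists_partialIso_of_sign_leadingCoeff hK (x := x) (y := y)
    fun P hP => hxy _ (Finset.mem_image_of_mem _ hP)
  obtain ⟨t, ht⟩ := PartialIso.exists_across f s
  exact ⟨t, fun P hP => hf P (hHK hP) s t ht⟩

end SignDiagrams

section SignDetermined

open Polynomial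

/-- The set `S` is a union of sign cells of finitely many functions in `A`. -/
def SignDet {X : Type*} (A : Subring (X → ℝ)) (S : Set X) : Prop :=
  ∃ F : Finset (X → ℝ), (∀ a ∈ F, a ∈ A) ∧ ∀ x y,
    (∀ a ∈ F, SignType.sign (a x) = SignType.sign (a y)) → (x ∈ S ↔ y ∈ S)

namespace SignDet

variable {X Y : Type*} {A : Subring (X → ℝ)} {B : Subring (Y → ℝ)} {S T : Set X}

theorem compl (h : SignDet A S) : SignDet A Sᶜ := by
  obtain ⟨F, hF, h⟩ := h
  exact ⟨F, hF, fun x y hxy => not_congr (h x y hxy)⟩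

theorem inter (hS : SignDet A S) (hT : SignDet A T) : SignDet A (S ∩ T) := by
  classical
  obtain ⟨F, hF, hS⟩ := hS
  obtain ⟨G, hG, hT⟩ := hT
  refine ⟨F ∪ G, fun a ha => (Finset.mem_union.1 ha).elim (hF a) (hG a), fun x y hxy => ?_⟩
  exact and_congr (hS x y fun a ha => hxy a (Finset.mem_union_left _ ha))
    (hT x y fun a ha => hxy a (Finset.mem_union_right _ ha))

theorem univ : SignDet A Set.univ := ⟨∅, by simp, by simp⟩

theorem iInter {ι : Type*} {s : Finset ι} {S : ι → Set X} (h : ∀ i ∈ s, SignDet A (S i)) :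
    SignDet A {x | ∀ i ∈ s, x ∈ S i} := by
  classical
  induction s using Finset.induction_on with
  | empty => simpa using univ
  | insert i s _ ih =>
    have := (h i (Finset.mem_insert_self i s)).inter
      (ih fun j hj => h j (Finset.mem_insert_of_mem hj))
    convert this using 1
    ext x
    simp

theorem eq_zero {a : X → ℝ} (ha : a ∈ A) : SignDet A {x | a x = 0} := by
  refine ⟨{a}, by simpa using ha, fun x y hxy => ?_⟩
  have := hxy a (by simp)
  change a x = 0 ↔ a y = 0
  rw [← sign_eq_zero_iff, this, sign_eq_zero_iff]

theorem preimage {f : Y → X} (hf : ∀ a ∈ A, (fun y => a (f y)) ∈ B) (h : SignDet A S) :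
    SignDet B (f ⁻¹' S) := by
  classical
  obtain ⟨F, hF, h⟩ := h
  refine ⟨F.image fun a y => a (f y), ?_, fun x y hxy => h _ _ fun a ha => ?_⟩
  · simp only [Finset.mem_image]
    rintro _ ⟨a, ha, rfl⟩
    exact hf a (hF a ha)
  · exact hxy _ (Finset.mem_image_of_mem _ ha)

end SignDet

/-- The functions on `X × (κ → ℝ)` that are polynomial in the second variable with coefficients in
`A`. -/
def adjoinVars {X : Type*} (A : Subring (X → ℝ)) (κ : Type*) : Subring (X × (κ → ℝ) → ℝ) :=
  Subring.closure ({b | ∃ a ∈ A, b = fun z => a z.1} ∪ Set.range fun i z => z.2 i)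

theorem comp_fst_mem_adjoinVars {X κ : Type*} {A : Subring (X → ℝ)} {a : X → ℝ} (ha : a ∈ A) :
    (fun z : X × (κ → ℝ) => a z.1) ∈ adjoinVars A κ :=
  Subring.subset_closure (Or.inl ⟨a, ha, rfl⟩)

theorem snd_apply_mem_adjoinVars {X κ : Type*} {A : Subring (X → ℝ)} (i : κ) :
    (fun z : X × (κ → ℝ) => z.2 i) ∈ adjoinVars A κ :=
  Subring.subset_closure (Or.inr ⟨i, rfl⟩)

/-- To map the closure `C` of `s` into `B` by precomposition it is enough to do so on `s`. -/
theorem comp_mem_of_mem_closure {X Y : Type*} {s : Set (X → ℝ)} {B : Subring (Y → ℝ)} {f : Y → X}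
    (h : ∀ a ∈ s, (fun y => a (f y)) ∈ B) {a : X → ℝ} (ha : a ∈ Subring.closure s) :
    (fun y => a (f y)) ∈ B := by
  let φ : (X → ℝ) →+* (Y → ℝ) :=
    { toFun := fun a y => a (f y)
      map_one' := rfl
      map_mul' := fun _ _ => rfl
      map_zero' := rfl
      map_add' := fun _ _ => rfl }
  have : Subring.closure s ≤ B.comap φ := Subring.closure_le.2 h
  exact this ha

section Projection

variable {X : Type*} {A : Subring (X → ℝ)}

/-- Evaluation at `x`. -/
def evalAt (A : Subring (X → ℝ)) (x : X) : A →+* ℝ := (Pi.evalRingHom (fun _ => ℝ) x).comp A.subtype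

theorem exists_polynomial_of_mem_adjoinVars {b : X × (Unit → ℝ) → ℝ} (hb : b ∈ adjoinVars A Unit) :
    ∃ P : A[X], ∀ x t, b (x, t) = (P.map (evalAt A x)).eval (t ()) := by
  induction hb using Subring.closure_induction with
  | mem b hb =>
    rcases hb with ⟨a, ha, rfl⟩ | ⟨i, rfl⟩
    · exact ⟨C ⟨a, ha⟩, fun x t => by simp [evalAt]⟩
    · exact ⟨Polynomial.X, fun x t => by simp⟩
  | zero => exact ⟨0, by simp⟩
  | one => exact ⟨1, by simp⟩
  | add a b _ _ ha hb =>
    obtain ⟨P, hP⟩ := ha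
    obtain ⟨Q, hQ⟩ := hb
    exact ⟨P + Q, fun x t => by simp [hP, hQ]⟩
  | neg a _ ha =>
    obtain ⟨P, hP⟩ := ha
    exact ⟨-P, fun x t => by simp [hP]⟩
  | mul a b _ _ ha hb =>
    obtain ⟨P, hP⟩ := ha
    obtain ⟨Q, hQ⟩ := hb
    exact ⟨P * Q, fun x t => by simp [hP, hQ]⟩

theorem SignDet.exists_unit {S : Set (X × (Unit → ℝ))} (h : SignDet (adjoinVars A Unit) S) :
    SignDet A {x | ∃ t, (x, t) ∈ S} := by
  classical
  obtain ⟨F, hF, h⟩ := h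
  choose! P hP using fun b (hb : b ∈ F) => exists_polynomial_of_mem_adjoinVars (hF b hb)
  obtain ⟨G, hG⟩ := exists_finset_sign_transfer (F.image P)
  have key : ∀ x y, (∀ a ∈ G, SignType.sign (evalAt A x a) = SignType.sign (evalAt A y a)) →
      (∃ t, (x, t) ∈ S) → ∃ t, (y, t) ∈ S := by
    rintro x y hxy ⟨s, hs⟩
    obtain ⟨t, ht⟩ := hG _ _ hxy (s ())
    refine ⟨fun _ => t, (h (x, s) _ fun b hb => ?_).1 hs⟩
    rw [hP b hb, hP b hb]
    exact ht _ (Finset.mem_image_of_mem _ hb)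
  refine ⟨G.image Subtype.val, ?_, fun x y hxy => ?_⟩
  · simp only [Finset.mem_image]
    rintro _ ⟨a, _, rfl⟩
    exact a.2
  · have hxy' : ∀ a ∈ G, SignType.sign (evalAt A x a) = SignType.sign (evalAt A y a) :=
      fun a ha => hxy _ (Finset.mem_image_of_mem _ ha)
    exact ⟨key x y hxy', key y x fun a ha => (hxy' a ha).symm⟩

theorem SignDet.exists_fin (k : ℕ) {S : Set (X × (Fin k → ℝ))}
    (h : SignDet (adjoinVars A (Fin k)) S) : SignDet A {x | ∃ t, (x, t) ∈ S} := by
  induction k generalizing X with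
  | zero =>
    have := h.preimage (B := A) (f := fun x : X => (x, Fin.elim0)) fun a ha => by
      refine comp_mem_of_mem_closure ?_ ha
      rintro _ (⟨a, ha, rfl⟩ | ⟨i, rfl⟩)
      · exact ha
      · exact i.elim0
    convert this using 1
    ext x
    exact ⟨fun ⟨t, ht⟩ => by rwa [Subsingleton.elim t Fin.elim0] at ht, fun h => ⟨_, h⟩⟩
  | succ k ih =>
    have h1 := h.preimage (B := adjoinVars (adjoinVars A Unit) (Fin k))
      (f := fun z : (X × (Unit → ℝ)) × (Fin k → ℝ) => (z.1.1, Fin.cons (z.1.2 ()) z.2)) fun a ha => by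
      refine comp_mem_of_mem_closure ?_ ha
      rintro _ (⟨a, ha, rfl⟩ | ⟨i, rfl⟩)
      · exact comp_fst_mem_adjoinVars (comp_fst_mem_adjoinVars ha)
      · cases i using Fin.cases with
        | zero =>
          exact comp_fst_mem_adjoinVars (A := adjoinVars A Unit) (snd_apply_mem_adjoinVars ())
        | succ i => exact snd_apply_mem_adjoinVars i
    convert (ih h1).exists_unit using 1
    ext x
    refine ⟨fun ⟨t, ht⟩ => ⟨fun _ => t 0, Fin.tail t, ?_⟩, fun ⟨s, t, h⟩ => ⟨_, h⟩⟩
    simpa using ht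

/-- Projections of sign-determined sets are sign-determined. -/
theorem SignDet.exists_pi {κ : Type*} [Finite κ] {S : Set (X × (κ → ℝ))}
    (h : SignDet (adjoinVars A κ) S) : SignDet A {x | ∃ t, (x, t) ∈ S} := by
  obtain ⟨k, ⟨e⟩⟩ := Finite.exists_equiv_fin κ
  have h1 := h.preimage (B := adjoinVars A (Fin k))
    (f := fun z : X × (Fin k → ℝ) => (z.1, z.2 ∘ e)) fun a ha => by
    refine comp_mem_of_mem_closure ?_ ha
    rintro _ (⟨a, ha, rfl⟩ | ⟨i, rfl⟩)
    · exact comp_fst_mem_adjoinVars ha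
    · exact snd_apply_mem_adjoinVars (e i)
  convert h1.exists_fin using 1
  ext x
  refine ⟨fun ⟨t, ht⟩ => ⟨t ∘ e.symm, ?_⟩, fun ⟨t, h⟩ => ⟨_, h⟩⟩
  simpa [Function.comp_assoc] using ht

end Projection

end SignDetermined

section Definability

variable {n : ℕ} {X : Type} {A : Subring (X → ℝ)}

/-- The real and imaginary parts of the entries of `f` belong to `A`. -/
def EntriesIn (A : Subring (X → ℝ)) (f : X → Matrix (Fin n) (Fin n) ℂ) : Prop :=
  ∀ i j, (fun x => (f x i j).re) ∈ A ∧ (fun x => (f x i j).im) ∈ A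

namespace EntriesIn

variable {f g : X → Matrix (Fin n) (Fin n) ℂ}

theorem zero : EntriesIn A (fun _ => (0 : Matrix (Fin n) (Fin n) ℂ)) := fun _ _ =>
  ⟨A.zero_mem, A.zero_mem⟩

theorem one : EntriesIn A (fun _ => (1 : Matrix (Fin n) (Fin n) ℂ)) := fun i j => by
  by_cases h : i = j
  · subst h
    simp only [Matrix.one_apply_eq]
    exact ⟨A.one_mem, A.zero_mem⟩
  · simp only [Matrix.one_apply_ne h]
    exact ⟨A.zero_mem, A.zero_mem⟩

theorem add (hf : EntriesIn A f) (hg : EntriesIn A g) : EntriesIn A (fun x => f x + g x) :=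
  fun i j => ⟨A.add_mem (hf i j).1 (hg i j).1, A.add_mem (hf i j).2 (hg i j).2⟩

theorem mul (hf : EntriesIn A f) (hg : EntriesIn A g) : EntriesIn A (fun x => f x * g x) := by
  intro i j
  simp only [Matrix.mul_apply, Complex.re_sum, Complex.im_sum, Complex.mul_re, Complex.mul_im]
  constructor
  · convert A.sum_mem (t := Finset.univ) fun k _ => A.sub_mem (A.mul_mem (hf i k).1 (hg k j).1)
      (A.mul_mem (hf i k).2 (hg k j).2) using 1
    ext x
    simp
  · convert A.sum_mem (t := Finset.univ) fun k _ => A.add_mem (A.mul_mem (hf i k).1 (hg k j).2)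
      (A.mul_mem (hf i k).2 (hg k j).1) using 1
    ext x
    simp

theorem conjTranspose (hf : EntriesIn A f) : EntriesIn A (fun x => (f x)ᴴ) := by
  intro i j
  simp only [Matrix.conjTranspose_apply, Complex.star_def, Complex.conj_re, Complex.conj_im]
  exact ⟨(hf j i).1, A.neg_mem (hf j i).2⟩

theorem trace_mem (hf : EntriesIn A f) :
    (fun x => (f x).trace.re) ∈ A ∧ (fun x => (f x).trace.im) ∈ A := by
  simp only [Matrix.trace, Matrix.diag, Complex.re_sum, Complex.im_sum]
  constructor
  · convert A.sum_mem (t := Finset.univ) fun k _ => (hf k k).1 using 1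
    ext x
    simp
  · convert A.sum_mem (t := Finset.univ) fun k _ => (hf k k).2 using 1
    ext x
    simp

theorem trace_smul_one (hf : EntriesIn A f) :
    EntriesIn A (fun x => (f x).trace • (1 : Matrix (Fin n) (Fin n) ℂ)) := by
  intro i j
  by_cases h : i = j
  · subst h
    simpa using hf.trace_mem
  · simp only [Matrix.smul_apply, Matrix.one_apply_ne h, smul_zero]
    exact ⟨A.zero_mem, A.zero_mem⟩

theorem signDet_eq (hf : EntriesIn A f) (hg : EntriesIn A g) : SignDet A {x | f x = g x} := by
  have : SignDet A {x | ∀ p ∈ (Finset.univ : Finset (Fin n × Fin n)),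
      x ∈ {x | (f x p.1 p.2).re - (g x p.1 p.2).re = 0} ∩
        {x | (f x p.1 p.2).im - (g x p.1 p.2).im = 0}} :=
    SignDet.iInter fun p _ =>
      (SignDet.eq_zero (A.sub_mem (hf p.1 p.2).1 (hg p.1 p.2).1)).inter
        (SignDet.eq_zero (A.sub_mem (hf p.1 p.2).2 (hg p.1 p.2).2))
  convert this using 1
  ext x
  simp [← Matrix.ext_iff, Complex.ext_iff, sub_eq_zero]

theorem comp_fst {κ : Type} (hf : EntriesIn A f) :
    EntriesIn (adjoinVars A κ) (fun z : X × (κ → ℝ) => f z.1) := fun i j =>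
  ⟨comp_fst_mem_adjoinVars (hf i j).1, comp_fst_mem_adjoinVars (hf i j).2⟩

end EntriesIn

/-- The matrix with prescribed real and imaginary parts of the entries. -/
def matrixOfReal {κ : Type*} (t : κ × Fin n × Fin n × Bool → ℝ) (k : κ) :
    Matrix (Fin n) (Fin n) ℂ :=
  Matrix.of fun i j => ⟨t (k, i, j, false), t (k, i, j, true)⟩

theorem exists_matrixOfReal_eq {κ : Type*} (M : κ → Matrix (Fin n) (Fin n) ℂ) :
    ∃ t, matrixOfReal t = M :=
  ⟨fun p => if p.2.2.2 then (M p.1 p.2.1 p.2.2.1).im else (M p.1 p.2.1 p.2.2.1).re, by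
    ext; simp [matrixOfReal]⟩

theorem entriesIn_matrixOfReal {κ : Type} (k : κ) :
    EntriesIn (adjoinVars A (κ × Fin n × Fin n × Bool)) fun z => matrixOfReal z.2 k := fun _ _ =>
  ⟨snd_apply_mem_adjoinVars _, snd_apply_mem_adjoinVars _⟩

theorem SignDet.exists_matrix {κ : Type} [Finite κ]
    {S : X → (κ → Matrix (Fin n) (Fin n) ℂ) → Prop}
    (h : SignDet (adjoinVars A (κ × Fin n × Fin n × Bool))
      {z | S z.1 (matrixOfReal z.2)}) : SignDet A {x | ∃ M, S x M} := by
  convert h.exists_pi using 1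
  ext x
  refine ⟨fun ⟨M, hM⟩ => ?_, fun ⟨t, ht⟩ => ⟨_, ht⟩⟩
  obtain ⟨t, rfl⟩ := exists_matrixOfReal_eq M
  exact ⟨t, hM⟩

open scoped MatrixOrder in
theorem EntriesIn.signDet_posSemidef {f : X → Matrix (Fin n) (Fin n) ℂ} (hf : EntriesIn A f) :
    SignDet A {x | (f x).PosSemidef} := by
  have := SignDet.exists_matrix (κ := Unit) (A := A) (S := fun x M => f x = (M ())ᴴ * M ())
    (hf.comp_fst.signDet_eq ((entriesIn_matrixOfReal ()).conjTranspose.mul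
      (entriesIn_matrixOfReal ())))
  convert this using 1
  ext x
  refine ⟨fun h => ?_, fun ⟨M, hM⟩ => ?_⟩
  · obtain ⟨B, hB⟩ := CStarAlgebra.nonneg_iff_eq_star_mul_self.1 h.nonneg
    exact ⟨fun _ => B, hB⟩
  · change (f x).PosSemidef
    rw [hM]
    exact Matrix.posSemidef_conjTranspose_mul_self _

theorem EntriesIn.term {β : Type} {v : β → X → Matrix (Fin n) (Fin n) ℂ}
    (hv : ∀ i, EntriesIn A (v i)) (t : matLang.Term β) :
    EntriesIn A fun x => t.realize fun i => v i x := by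
  induction t with
  | var i => exact hv i
  | @func l f ts ih =>
    cases f with
    | zero => exact EntriesIn.zero
    | one => exact EntriesIn.one
    | add => exact (ih 0).add (ih 1)
    | mul => exact (ih 0).mul (ih 1)
    | tr => exact (ih 0).trace_smul_one
    | star => exact (ih 0).conjTranspose

/-- Definable sets are sign-determined. -/
theorem signDet_realize {α : Type} {k : ℕ} (φ : matLang.BoundedFormula α k)
    {v : α → X → Matrix (Fin n) (Fin n) ℂ} (hv : ∀ i, EntriesIn A (v i))
    {w : Fin k → X → Matrix (Fin n) (Fin n) ℂ} (hw : ∀ i, EntriesIn A (w i)) :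
    SignDet A {x | φ.Realize (fun i => v i x) fun i => w i x} := by
  have hterm : ∀ {X : Type} {A : Subring (X → ℝ)} {k : ℕ}
      {v : α → X → Matrix (Fin n) (Fin n) ℂ} (_ : ∀ i, EntriesIn A (v i))
      {w : Fin k → X → Matrix (Fin n) (Fin n) ℂ} (_ : ∀ i, EntriesIn A (w i))
      (t : matLang.Term (α ⊕ Fin k)),
      EntriesIn A fun x => t.realize (Sum.elim (fun i => v i x) fun i => w i x) := by
    intro X A k v hv w hw t
    convert EntriesIn.term (v := Sum.elim v w) (by rintro (i | i); exacts [hv i, hw i]) t using 3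
    ext (i | i) <;> rfl
  induction φ generalizing X with
  | falsum =>
    convert SignDet.univ.compl using 1
    ext x
    simp [BoundedFormula.Realize]
  | equal t₁ t₂ => exact (hterm hv hw t₁).signDet_eq (hterm hv hw t₂)
  | rel R ts =>
    cases R with
    | le =>
      have h1 := hterm hv hw (ts 0)
      have h2 := hterm hv hw (ts 1)
      have : EntriesIn A fun x =>
          (ts 1).realize (Sum.elim (fun i => v i x) fun i => w i x) -
            (ts 0).realize (Sum.elim (fun i => v i x) fun i => w i x) := fun i j =>
        ⟨A.sub_mem (h2 i j).1 (h1 i j).1, A.sub_mem (h2 i j).2 (h1 i j).2⟩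
      exact this.signDet_posSemidef
  | imp φ ψ ihφ ihψ =>
    convert ((ihφ hv hw).inter (ihψ hv hw).compl).compl using 1
    ext x
    simp [BoundedFormula.realize_imp]
  | @all k φ ih =>
    have := ih (A := adjoinVars A (Unit × Fin n × Fin n × Bool)) (v := fun i z => v i z.1)
      (fun i => (hv i).comp_fst)
      (w := Fin.snoc (fun i z => w i z.1) fun z => matrixOfReal z.2 ()) fun i => by
        cases i using Fin.lastCases with
        | last => simpa using entriesIn_matrixOfReal ()
        | cast i => simpa using (hw i).comp_fst
    have key := (SignDet.exists_matrix (κ := Unit) (A := A)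
      (S := fun x M => ¬ φ.Realize (fun i => v i x) (Fin.snoc (fun i => w i x) (M ()))) (by
        convert this.compl using 1
        ext z
        simp only [Set.mem_compl_iff]
        refine not_congr (iff_of_eq ?_)
        congr 1
        ext i
        cases i using Fin.lastCases <;> simp)).compl
    convert key using 1
    ext x
    simp only [BoundedFormula.realize_all, Set.mem_compl_iff]
    change _ ↔ ¬ ∃ _, _
    push Not
    exact ⟨fun h M => h (M ()), fun h M => h fun _ => M⟩

end Definability

section Specht

variable {d : Type*} [Fintype d] [DecidableEq d]

/-- Every subspace of matrices has an orthonormal basis for the trace form. -/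
theorem exists_trace_orthonormal_basis (N : Submodule ℂ (Matrix d d ℂ)) :
    ∃ (k : ℕ) (b : Fin k → Matrix d d ℂ), (∀ i, b i ∈ N) ∧
      (∀ i j, ((b i)ᴴ * b j).trace = if i = j then 1 else 0) ∧
      ∀ X ∈ N, X = ∑ i, ((b i)ᴴ * X).trace • b i := by
  let := Matrix.toMatrixNormedAddCommGroup (1 : Matrix d d ℂ) Matrix.PosDef.one
  let : InnerProductSpace ℂ (Matrix d d ℂ) :=
    Matrix.toMatrixInnerProductSpace (1 : Matrix d d ℂ) Matrix.PosDef.one.posSemidef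
  have hinner : ∀ X Y : Matrix d d ℂ, inner ℂ X Y = (Xᴴ * Y).trace := fun X Y => by
    change (Y * 1 * Xᴴ).trace = _
    rw [mul_one, Matrix.trace_mul_comm]
  let b := stdOrthonormalBasis ℂ N
  refine ⟨_, fun i => b i, fun i => (b i).2, fun i j => ?_, fun X hX => ?_⟩
  · rw [← hinner, ← Submodule.coe_inner, orthonormal_iff_ite.1 b.orthonormal]
  · have := congrArg Subtype.val (b.sum_repr' ⟨X, hX⟩)
    simp only [Submodule.coe_sum, Submodule.coe_smul, Submodule.coe_inner, hinner] at this
    exact this.symm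

/-- A nonzero matrix can be normalised to a partial isometry by multiplying it with a function of
its modulus. -/
theorem exists_partialIsometry {S : Matrix d d ℂ} (hS : S ≠ 0) :
    ∃ G : Matrix d d ℂ, (∀ X, Commute (Sᴴ * S) X → Commute G X) ∧
      S * G ≠ 0 ∧ S * G * (S * G)ᴴ * (S * G) = S * G := by
  set H := Sᴴ * S with hH
  have hHsa : IsSelfAdjoint H := Matrix.isHermitian_conjTranspose_mul_self S
  have hpos : ∀ t ∈ spectrum ℝ H, 0 ≤ t := by
    open scoped MatrixOrder in
    exact spectrum_nonneg_of_nonneg (Matrix.posSemidef_conjTranspose_mul_self S).nonneg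
  have hcont : ∀ f : ℝ → ℝ, ContinuousOn f (spectrum ℝ H) := fun f =>
    H.finite_real_spectrum.continuousOn f
  set f : ℝ → ℝ := fun t => if t = 0 then 0 else (√t)⁻¹ with hf
  have hff : ∀ t ∈ spectrum ℝ H, t ≠ 0 → f t * t * f t = 1 := by
    intro t ht h0
    have h1 := Real.sqrt_pos.2 (lt_of_le_of_ne (hpos t ht) (Ne.symm h0))
    have h2 := Real.mul_self_sqrt (hpos t ht)
    simp only [hf, if_neg h0]
    nth_rw 2 [← h2]
    field_simp
  set G := cfc f H with hG
  have hGsa : Gᴴ = G := (IsSelfAdjoint.cfc (f := f) (a := H)).star_eq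
  have hid : cfc (fun t : ℝ => t) H = H := cfc_id' ℝ H
  have hGH : G * H = cfc (fun t => f t * t) H := by
    rw [cfc_mul f (fun t => t) H (hcont _) (hcont _), hid]
  have hGHG : G * H * G = cfc (fun t => f t * t * f t) H := by
    rw [hGH, hG, ← cfc_mul _ f H (hcont _) (hcont _)]
  refine ⟨G, fun X hX => hX.cfc_real f, fun h0 => hS ?_, ?_⟩
  · have h1 : G * H * G * H = H := by
      have : cfc (fun t => f t * t * f t * t) H = cfc (fun t : ℝ => t) H := by
        refine cfc_congr fun t ht => ?_
        by_cases h : t = 0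
        · simp [h]
        · simp [hff t ht h]
      rw [cfc_mul (fun t => f t * t * f t) (fun t => t) H (hcont _) (hcont _), hid] at this
      rw [hGHG, this]
    have h2 : H = 0 := by
      rw [← h1, mul_assoc, mul_assoc, ← mul_assoc H, hH, mul_assoc Sᴴ, h0]
      simp
    exact Matrix.conjTranspose_mul_self_eq_zero.1 h2
  · have h1 : G * (G * H * G) = G := by
      rw [hGHG, hG, ← cfc_mul f _ H (hcont _) (hcont _)]
      refine cfc_congr fun t ht => ?_
      by_cases h : t = 0
      · simp [h, hf]
      · simp [hff t ht h]
    calc S * G * (S * G)ᴴ * (S * G) = S * (G * (G * H * G)) := by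
          rw [Matrix.conjTranspose_mul, hGsa, hH]
          simp only [mul_assoc]
      _ = S * G := by rw [h1]

variable {R : Type*} [Ring R] [Algebra ℂ R] {ρ σ : R →ₐ[ℂ] Matrix d d ℂ}

/-- The adjoint of an intertwiner is an intertwiner. -/
theorem conjTranspose_intertwines (hstar : ∀ r, ∃ r', ρ r' = (ρ r)ᴴ ∧ σ r' = (σ r)ᴴ)
    {T : Matrix d d ℂ} (hT : ∀ r, ρ r * T = T * σ r) (r : R) : Tᴴ * ρ r = σ r * Tᴴ := by
  obtain ⟨r', h1, h2⟩ := hstar r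
  have := congrArg Matrix.conjTranspose (hT r')
  simpa [h1, h2, Matrix.conjTranspose_mul] using this

/-- Two complementary projections with equal traces are linked by a nonzero intertwiner. -/
theorem exists_intertwiner (hstar : ∀ r, ∃ r', ρ r' = (ρ r)ᴴ ∧ σ r' = (σ r)ᴴ)
    {P Q : Matrix d d ℂ} (hPh : Pᴴ = P) (hQh : Qᴴ = Q) (hPP : P * P = P) (hQQ : Q * Q = Q)
    (hP : ∀ r, Commute (ρ r) P) (hQ : ∀ r, Commute (σ r) Q)
    (htr : ∀ r, (ρ r * P).trace = (σ r * Q).trace) (hQ0 : Q ≠ 0) :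
    ∃ S : Matrix d d ℂ, S ≠ 0 ∧ (∀ r, ρ r * S = S * σ r) ∧ P * S = S ∧ S * Q = S := by
  let toN : R →ₗ[ℂ] Matrix d d ℂ := (LinearMap.mulRight ℂ Q).comp σ.toLinearMap
  have htoN : ∀ r, toN r = σ r * Q := fun r => rfl
  obtain ⟨k, b, hbN, hbo, hb⟩ := exists_trace_orthonormal_basis (LinearMap.range toN)
  choose s hs using fun i => LinearMap.mem_range.1 (hbN i)
  simp only [htoN] at hs
  have hform : ∀ r r', ((ρ r * P)ᴴ * (ρ r' * P)).trace = ((σ r * Q)ᴴ * (σ r' * Q)).trace := by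
    intro r r'
    obtain ⟨t, h1, h2⟩ := hstar r
    have e1 : (ρ r * P)ᴴ * (ρ r' * P) = ρ (t * r') * P := by
      rw [Matrix.conjTranspose_mul, ← h1, hPh, map_mul, ← mul_assoc, ← (hP t).eq, mul_assoc (ρ t),
        ← (hP r').eq, mul_assoc (ρ t), mul_assoc (ρ r'), hPP, mul_assoc]
    have e2 : (σ r * Q)ᴴ * (σ r' * Q) = σ (t * r') * Q := by
      rw [Matrix.conjTranspose_mul, ← h2, hQh, map_mul, ← mul_assoc, ← (hQ t).eq, mul_assoc (σ t),
        ← (hQ r').eq, mul_assoc (σ t), mul_assoc (σ r'), hQQ, mul_assoc]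
    rw [e1, e2, htr]
  have hker : ∀ r, σ r * Q = 0 → ρ r * P = 0 := fun r hr =>
    Matrix.trace_conjTranspose_mul_self_eq_zero_iff.1 (by rw [hform, hr]; simp)
  set p : Fin k → Matrix d d ℂ := fun i => ρ (s i) * P with hp
  set c : R → Fin k → Fin k → ℂ := fun r i j => ((b j)ᴴ * (σ r * b i)).trace with hc
  have hσb : ∀ r i, σ r * b i = ∑ j, c r i j • b j := fun r i => hb _
    ⟨r * s i, by rw [htoN, map_mul, mul_assoc, hs]⟩
  have hρp : ∀ r i, ρ r * p i = ∑ j, c r i j • p j := by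
    intro r i
    have h0 : σ (r * s i - ∑ j, c r i j • s j) * Q = 0 := by
      rw [map_sub, sub_mul, map_mul, mul_assoc, hs, hσb, map_sum, Finset.sum_mul]
      simp [hs]
    have := hker _ h0
    rw [map_sub, sub_mul, map_mul, mul_assoc, map_sum, Finset.sum_mul, sub_eq_zero] at this
    simpa [smul_mul_assoc, hp] using this
  have hPp : ∀ i, P * p i = p i := fun i => by
    rw [hp]
    dsimp only
    rw [← mul_assoc, ← (hP _).eq, mul_assoc, hPP]
  have hbQ : ∀ i, Q * b i = b i := fun i => by
    rw [← hs, ← mul_assoc, ← (hQ _).eq, mul_assoc, hQQ]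
  let S : Matrix d d ℂ → Matrix d d ℂ := fun M => ∑ i, p i * M * (b i)ᴴ
  obtain ⟨M, hM⟩ : ∃ M, S M ≠ 0 := by
    by_contra! h0
    have hp0 : ∀ i, p i = 0 := by
      intro i
      ext a e
      have h1 : ∑ j, p j a e • (b j)ᴴ = 0 := by
        ext f g
        have := congrFun (congrFun (h0 (Matrix.single e f 1)) a) g
        simpa [S, Matrix.sum_apply, Matrix.mul_apply, Matrix.single_apply, Finset.sum_mul,
          ite_and] using this
      have h2 := congrArg (fun X => (X * b i).trace) h1
      simpa [Finset.sum_mul, Matrix.trace_sum, hbo] using h2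
    have hk : ∀ i : Fin k, False := fun i => by
      have h1 := hform (s i) (s i)
      have h2 := hp0 i
      rw [hp] at h2
      dsimp only at h2
      rw [h2, hs, hbo] at h1
      simp at h1
    have : Q = ∑ i, ((b i)ᴴ * Q).trace • b i := hb Q ⟨1, by rw [htoN, map_one, one_mul]⟩
    rw [Finset.sum_eq_zero fun i _ => (hk i).elim] at this
    exact hQ0 this
  refine ⟨S M, hM, fun r => ?_, ?_, ?_⟩
  · obtain ⟨t, _, h2⟩ := hstar r
    have hcc : ∀ i j, star (c t j i) = c r i j := by
      intro i j
      rw [hc]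
      dsimp only
      rw [← Matrix.trace_conjTranspose, Matrix.conjTranspose_mul, Matrix.conjTranspose_mul, h2]
      simp [mul_assoc]
    have hbσ : ∀ j, (b j)ᴴ * σ r = ∑ i, c r i j • (b i)ᴴ := by
      intro j
      have := congrArg Matrix.conjTranspose (hσb t j)
      rw [Matrix.conjTranspose_mul, h2, Matrix.conjTranspose_conjTranspose,
        Matrix.conjTranspose_sum] at this
      simpa [Matrix.conjTranspose_smul, hcc] using this
    calc ρ r * S M = ∑ i, ∑ j, c r i j • (p j * M * (b i)ᴴ) := by
          simp only [S, Finset.mul_sum, ← mul_assoc, hρp, Finset.sum_mul, smul_mul_assoc]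
      _ = ∑ j, ∑ i, c r i j • (p j * M * (b i)ᴴ) := Finset.sum_comm
      _ = S M * σ r := by
          simp only [S, Finset.sum_mul, mul_assoc, hbσ, Finset.mul_sum, mul_smul_comm]
  · simp only [S, Finset.mul_sum, ← mul_assoc, hPp]
  · have : ∀ i, (b i)ᴴ * Q = (b i)ᴴ := fun i => by
      have := congrArg Matrix.conjTranspose (hbQ i)
      rwa [Matrix.conjTranspose_mul, hQh] at this
    simp only [S, Finset.sum_mul, mul_assoc, this]

/-- Matrix representations that are closed under adjoints and have the same character are unitarily
equivalent. -/
theorem exists_unitary_intertwiner (hstar : ∀ r, ∃ r', ρ r' = (ρ r)ᴴ ∧ σ r' = (σ r)ᴴ)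
    (htr : ∀ r, (ρ r).trace = (σ r).trace) :
    ∃ U : Matrix d d ℂ, Uᴴ * U = 1 ∧ ∀ r, ρ r * U = U * σ r := by
  have main : ∀ K : Submodule ℂ (Matrix d d ℂ), ∀ T : Matrix d d ℂ,
      LinearMap.ker (LinearMap.mulLeft ℂ T) = K → (∀ r, ρ r * T = T * σ r) → T * Tᴴ * T = T →
      ∃ U : Matrix d d ℂ, Uᴴ * U = 1 ∧ ∀ r, ρ r * U = U * σ r := by
    intro K
    induction K using WellFoundedLT.induction with
    | ind K ih =>
    intro T hTK hT hTT
    have hT' := conjTranspose_intertwines hstar hT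
    have hTT' : Tᴴ * T * Tᴴ = Tᴴ := by
      have := congrArg Matrix.conjTranspose hTT
      simpa [Matrix.conjTranspose_mul, mul_assoc] using this
    by_cases hQ0 : 1 - Tᴴ * T = 0
    · exact ⟨T, (sub_eq_zero.1 hQ0).symm, hT⟩
    have hPc : ∀ r, Commute (ρ r) (1 - T * Tᴴ) := fun r => by
      refine (Commute.one_right _).sub_right ?_
      change ρ r * (T * Tᴴ) = T * Tᴴ * ρ r
      rw [← mul_assoc, hT, mul_assoc, mul_assoc, hT']
    have hQc : ∀ r, Commute (σ r) (1 - Tᴴ * T) := fun r => by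
      refine (Commute.one_right _).sub_right ?_
      change σ r * (Tᴴ * T) = Tᴴ * T * σ r
      rw [← mul_assoc, ← hT', mul_assoc, mul_assoc, hT]
    obtain ⟨S, hS0, hS, hPS, hSQ⟩ := exists_intertwiner hstar
      (P := 1 - T * Tᴴ) (Q := 1 - Tᴴ * T) (by simp) (by simp)
      (by rw [mul_sub, mul_one, sub_mul, one_mul, ← mul_assoc, hTT, sub_self, sub_zero])
      (by rw [mul_sub, mul_one, sub_mul, one_mul, ← mul_assoc, hTT', sub_self, sub_zero]) hPc hQc
      (fun r => by
        rw [mul_sub, mul_sub, Matrix.trace_sub, Matrix.trace_sub, mul_one, mul_one, htr,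
          ← mul_assoc, hT, mul_assoc, Matrix.trace_mul_comm, mul_assoc]) hQ0
    obtain ⟨G, hG, hG0, hGG⟩ := exists_partialIsometry hS0
    have hS' := conjTranspose_intertwines hstar hS
    have hGσ : ∀ r, Commute G (σ r) := fun r => hG _ <| by
      change Sᴴ * S * σ r = σ r * (Sᴴ * S)
      rw [mul_assoc, ← hS, ← mul_assoc, hS', mul_assoc]
    have hQS : (1 - Tᴴ * T) * Sᴴ = Sᴴ := by
      have := congrArg Matrix.conjTranspose hSQ
      simpa [Matrix.conjTranspose_mul] using this
    have hGQ : Commute G (1 - Tᴴ * T) := hG _ <| by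
      change Sᴴ * S * (1 - Tᴴ * T) = (1 - Tᴴ * T) * (Sᴴ * S)
      rw [mul_assoc, hSQ, ← mul_assoc, hQS]
    set V := S * G with hV
    have hVρ : ∀ r, ρ r * V = V * σ r := fun r => by
      rw [hV, ← mul_assoc, hS, mul_assoc, mul_assoc, (hGσ r).eq]
    have hPV : (1 - T * Tᴴ) * V = V := by rw [hV, ← mul_assoc, hPS]
    have hVQ : V * (1 - Tᴴ * T) = V := by rw [hV, mul_assoc, hGQ.eq, ← mul_assoc, hSQ]
    have hTQ : T * (1 - Tᴴ * T) = 0 := by rw [mul_sub, mul_one, ← mul_assoc, hTT, sub_self]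
    have hQT : (1 - Tᴴ * T) * Tᴴ = 0 := by rw [sub_mul, one_mul, hTT', sub_self]
    have hTP : Tᴴ * (1 - T * Tᴴ) = 0 := by rw [mul_sub, mul_one, ← mul_assoc, hTT', sub_self]
    have hTV : Tᴴ * V = 0 := by rw [← hPV, ← mul_assoc, hTP, zero_mul]
    have hVT : V * Tᴴ = 0 := by rw [← hVQ, mul_assoc, hQT, mul_zero]
    have hTV' : T * Vᴴ = 0 := by
      have := congrArg Matrix.conjTranspose hVT
      simpa [Matrix.conjTranspose_mul] using this
    refine ih _ ?_ (T + V) rfl (fun r => by rw [mul_add, hT, hVρ, add_mul]) ?_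
    · rw [← hTK]
      refine lt_of_le_of_ne (fun X hX => ?_) fun h => hG0 ?_
      · rw [LinearMap.mem_ker, LinearMap.mulLeft_apply] at hX ⊢
        have := congrArg (fun Y => T * (Tᴴ * Y)) hX
        simpa only [← mul_assoc, mul_add, add_mul, hTT, mul_assoc T Tᴴ V, hTV, mul_zero, add_zero,
          zero_mul] using this
      · have hmem : (1 - Tᴴ * T) ∈ LinearMap.ker (LinearMap.mulLeft ℂ T) := hTQ
        rw [← h, LinearMap.mem_ker, LinearMap.mulLeft_apply, add_mul, hTQ, hVQ, zero_add] at hmem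
        exact hmem
    · rw [Matrix.conjTranspose_add, mul_assoc, add_mul Tᴴ, mul_add Tᴴ, mul_add Vᴴ, hTV, add_zero,
        add_mul T, mul_add T, mul_add V]
      have h1 : V * (Tᴴ * T) = 0 := by rw [← mul_assoc, hVT, zero_mul]
      have h2 : T * (Vᴴ * T + Vᴴ * V) = 0 := by
        rw [mul_add, ← mul_assoc, ← mul_assoc, hTV', zero_mul, zero_mul, add_zero]
      have h3 : Vᴴ * T = 0 := by
        have := congrArg Matrix.conjTranspose hTV
        simpa [Matrix.conjTranspose_mul] using this
      rw [h1, h2, h3, zero_add, zero_add, ← mul_assoc T, hTT, ← mul_assoc V, hGG, add_zero]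
  exact main _ 0 rfl (by simp) (by simp)

/-- **Specht's theorem** for tuples closed under adjoints. -/
theorem exists_unitary_of_trace_prod_eq {ι : Type*} {A B : ι → Matrix d d ℂ} (s : ι → ι)
    (hA : ∀ i, A (s i) = (A i)ᴴ) (hB : ∀ i, B (s i) = (B i)ᴴ)
    (htr : ∀ w : List ι, (w.map A).prod.trace = (w.map B).prod.trace) :
    ∃ U : Matrix d d ℂ, Uᴴ * U = 1 ∧ ∀ i, A i * U = U * B i := by
  set ρ := FreeAlgebra.lift ℂ A with hρ
  set σ := FreeAlgebra.lift ℂ B with hσ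
  have hstar : ∀ r, ∃ r', ρ r' = (ρ r)ᴴ ∧ σ r' = (σ r)ᴴ := by
    intro r
    induction r using FreeAlgebra.induction with
    | grade0 z =>
      refine ⟨algebraMap ℂ _ (star z), ?_, ?_⟩ <;>
      simp [Matrix.algebraMap_eq_diagonal, Matrix.diagonal_conjTranspose]
    | grade1 i => exact ⟨FreeAlgebra.ι ℂ (s i), by simp [hρ, hA], by simp [hσ, hB]⟩
    | mul a b ha hb =>
      obtain ⟨a', h1, h2⟩ := ha
      obtain ⟨b', h3, h4⟩ := hb
      exact ⟨b' * a', by simp [h1, h3], by simp [h2, h4]⟩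
    | add a b ha hb =>
      obtain ⟨a', h1, h2⟩ := ha
      obtain ⟨b', h3, h4⟩ := hb
      exact ⟨a' + b', by simp [h1, h3], by simp [h2, h4]⟩
  have htrace : ∀ r (w : List ι),
      (ρ r * (w.map A).prod).trace = (σ r * (w.map B).prod).trace := by
    have key : ∀ r h : FreeAlgebra ℂ ι,
        (∀ w : List ι, (ρ h * (w.map A).prod).trace = (σ h * (w.map B).prod).trace) →
        ∀ w : List ι, (ρ (r * h) * (w.map A).prod).trace = (σ (r * h) * (w.map B).prod).trace := by
      intro r
      induction r using FreeAlgebra.induction with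
      | grade0 z =>
        intro h hh w
        have := congrArg (z * ·) (hh w)
        simpa [Algebra.algebraMap_eq_smul_one] using this
      | grade1 i =>
        intro h hh w
        have := hh (w ++ [i])
        simp only [List.map_append, List.prod_append, List.map_cons, List.map_nil, List.prod_cons,
          List.prod_nil, mul_one] at this
        simp only [map_mul, hρ, hσ, FreeAlgebra.lift_ι_apply]
        rw [mul_assoc, Matrix.trace_mul_comm, mul_assoc, mul_assoc (B i),
          Matrix.trace_mul_comm (B i), mul_assoc]
        exact this
      | mul a b ha hb =>
        intro h hh w
        rw [mul_assoc]
        exact ha _ (hb _ hh) w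
      | add a b ha hb =>
        intro h hh w
        rw [add_mul, map_add, map_add, add_mul, add_mul, Matrix.trace_add, Matrix.trace_add,
          ha _ hh, hb _ hh]
    intro r w
    simpa using key r 1 (by simpa using htr) w
  obtain ⟨U, hU, h⟩ := exists_unitary_intertwiner hstar fun r => by simpa using htrace r []
  exact ⟨U, hU, fun i => by simpa [hρ, hσ] using h (FreeAlgebra.ι ℂ i)⟩

end Specht

section Invariants

/-- Conjugation by a unitary matrix is an automorphism of the structure. -/
def conjUnitary {n : ℕ} (U : Matrix (Fin n) (Fin n) ℂ) (hU : Uᴴ * U = 1) :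
    Matrix (Fin n) (Fin n) ℂ ≃[matLang] Matrix (Fin n) (Fin n) ℂ :=
  have hU' : U * Uᴴ = 1 := mul_eq_one_comm.1 hU
  have hinv : ∀ X, Uᴴ * (U * X * Uᴴ) * U = X := fun X => by
    rw [mul_assoc U, ← mul_assoc Uᴴ, hU, one_mul, mul_assoc, hU, mul_one]
  { toFun := fun X => U * X * Uᴴ
    invFun := fun X => Uᴴ * X * U
    left_inv := hinv
    right_inv := fun X => by
      change U * (Uᴴ * X * U) * Uᴴ = X
      rw [mul_assoc Uᴴ, ← mul_assoc U, hU', one_mul, mul_assoc, hU', mul_one]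
    map_fun' := by
      intro k f x
      cases f with
      | zero =>
        change U * 0 * Uᴴ = 0
        simp
      | one =>
        change U * 1 * Uᴴ = 1
        simpa using hU'
      | add =>
        change U * (x 0 + x 1) * Uᴴ = U * x 0 * Uᴴ + U * x 1 * Uᴴ
        rw [mul_add, add_mul]
      | mul =>
        change U * (x 0 * x 1) * Uᴴ = U * x 0 * Uᴴ * (U * x 1 * Uᴴ)
        rw [mul_assoc U (x 1), mul_assoc (U * x 0), ← mul_assoc Uᴴ U, hU, one_mul]
        simp only [mul_assoc]
      | tr =>
        change U * ((x 0).trace • 1) * Uᴴ = (U * x 0 * Uᴴ).trace • 1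
        rw [Matrix.trace_mul_comm, ← mul_assoc, hU, one_mul]
        simp [hU']
      | star =>
        change U * (x 0)ᴴ * Uᴴ = (U * x 0 * Uᴴ)ᴴ
        simp [Matrix.conjTranspose_mul, mul_assoc]
    map_rel' := by
      intro k r x
      cases r with
      | le =>
        change (U * x 1 * Uᴴ - U * x 0 * Uᴴ).PosSemidef ↔ (x 1 - x 0).PosSemidef
        rw [← sub_mul, ← mul_sub]
        refine ⟨fun h => ?_, fun h => h.mul_mul_conjTranspose_same U⟩
        have := h.conjTranspose_mul_mul_same U
        rwa [hinv] at this }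

/-- Entrywise complex conjugation is an automorphism of the structure. -/
def conjEntries (n : ℕ) : Matrix (Fin n) (Fin n) ℂ ≃[matLang] Matrix (Fin n) (Fin n) ℂ where
  toFun X := Xᴴᵀ
  invFun X := Xᴴᵀ
  left_inv X := by ext; simp
  right_inv X := by ext; simp
  map_fun' := by
    intro k f x
    cases f with
    | zero =>
      change (0 : Matrix (Fin n) (Fin n) ℂ)ᴴᵀ = 0
      simp
    | one =>
      change (1 : Matrix (Fin n) (Fin n) ℂ)ᴴᵀ = 1
      simp
    | add =>
      change (x 0 + x 1)ᴴᵀ = (x 0)ᴴᵀ + (x 1)ᴴᵀ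
      simp
    | mul =>
      change (x 0 * x 1)ᴴᵀ = (x 0)ᴴᵀ * (x 1)ᴴᵀ
      simp
    | tr =>
      change ((x 0).trace • (1 : Matrix (Fin n) (Fin n) ℂ))ᴴᵀ = ((x 0)ᴴᵀ).trace • 1
      simp [Matrix.trace_conjTranspose]
    | star =>
      change (x 0)ᴴᴴᵀ = (x 0)ᴴᵀᴴ
      ext
      simp
  map_rel' := by
    intro k r x
    cases r with
    | le =>
      change ((x 1)ᴴᵀ - (x 0)ᴴᵀ).PosSemidef ↔ (x 1 - x 0).PosSemidef
      rw [← Matrix.transpose_sub, ← Matrix.conjTranspose_sub, Matrix.posSemidef_transpose_iff,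
        Matrix.posSemidef_conjTranspose_iff]

variable {n m : ℕ}

/-- The tuple `v` extended by the adjoints of its members. -/
def starGen (v : Fin m → Matrix (Fin n) (Fin n) ℂ) (i : Fin m × Bool) : Matrix (Fin n) (Fin n) ℂ :=
  if i.2 then (v i.1)ᴴ else v i.1

/-- The value of a word in the members of `v` and their adjoints. -/
def wordVal (v : Fin m → Matrix (Fin n) (Fin n) ℂ) (w : List (Fin m × Bool)) :
    Matrix (Fin n) (Fin n) ℂ :=
  (w.map (starGen v)).prod

theorem wordVal_nil (v : Fin m → Matrix (Fin n) (Fin n) ℂ) : wordVal v [] = 1 := by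
  simp [wordVal]

theorem wordVal_cons (v : Fin m → Matrix (Fin n) (Fin n) ℂ) (i : Fin m × Bool)
    (w : List (Fin m × Bool)) : wordVal v (i :: w) = starGen v i * wordVal v w := by
  simp [wordVal]

theorem wordVal_conj (v : Fin m → Matrix (Fin n) (Fin n) ℂ) (w : List (Fin m × Bool)) :
    wordVal (fun i => (v i)ᴴᵀ) w = (wordVal v w)ᴴᵀ := by
  induction w with
  | nil => simp [wordVal_nil]
  | cons i w ih =>
    rw [wordVal_cons, wordVal_cons, ih, Matrix.conjTranspose_mul, Matrix.transpose_mul]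
    congr 1
    unfold starGen
    split_ifs
    · ext
      simp
    · rfl

/-- Tuples with the same word traces satisfy the same formulas. -/
theorem realize_iff_of_trace_wordVal_eq (φ : matLang.Formula (Fin m))
    {v v' : Fin m → Matrix (Fin n) (Fin n) ℂ}
    (h : ∀ w, (wordVal v w).trace = (wordVal v' w).trace) : φ.Realize v ↔ φ.Realize v' := by
  have hs : ∀ (v : Fin m → Matrix (Fin n) (Fin n) ℂ) (i : Fin m × Bool),
      starGen v (i.1, !i.2) = (starGen v i)ᴴ := by
    rintro v ⟨i, _ | _⟩ <;> simp [starGen]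
  obtain ⟨U, hU, hvU⟩ := exists_unitary_of_trace_prod_eq (fun i => (i.1, !i.2)) (hs v) (hs v') h
  have : v = conjUnitary U hU ∘ v' := by
    ext1 i
    have := hvU (i, false)
    simp only [starGen, Bool.false_eq_true, if_false] at this
    change v i = U * v' i * Uᴴ
    rw [← this, mul_assoc, mul_eq_one_comm.1 hU, mul_one]
  rw [this, StrongHomClass.realize_formula]

/-- Real polynomial invariants that separate the orbits of the group generated by unitary
conjugations and complex conjugation. -/
def traceInv (v : Fin m → Matrix (Fin n) (Fin n) ℂ) :
    List (Fin m × Bool) ⊕ List (Fin m × Bool) × List (Fin m × Bool) → ℝ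
  | .inl w => 2 * (wordVal v w).trace.re
  | .inr (w, w') => 4 * ((wordVal v w).trace.im * (wordVal v w').trace.im)

theorem realize_iff_of_traceInv_eq (φ : matLang.Formula (Fin m))
    {v v' : Fin m → Matrix (Fin n) (Fin n) ℂ} (h : traceInv v = traceInv v') :
    φ.Realize v ↔ φ.Realize v' := by
  have hre : ∀ w, (wordVal v w).trace.re = (wordVal v' w).trace.re := fun w => by
    simpa [traceInv] using congrFun h (.inl w)
  have him : ∀ w w', (wordVal v w).trace.im * (wordVal v w').trace.im =
      (wordVal v' w).trace.im * (wordVal v' w').trace.im := fun w w' => by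
    simpa [traceInv] using congrFun h (.inr (w, w'))
  have hcases : (∀ w, (wordVal v w).trace.im = (wordVal v' w).trace.im) ∨
      ∀ w, (wordVal v w).trace.im = -(wordVal v' w).trace.im := by
    by_cases h0 : ∀ w, (wordVal v w).trace.im = 0
    · left
      intro w
      have := him w w
      rw [h0, zero_mul, eq_comm, mul_self_eq_zero] at this
      rw [h0, this]
    · push Not at h0
      obtain ⟨u, hu⟩ := h0
      rcases mul_self_eq_mul_self_iff.1 (him u u) with hu' | hu'
      · left
        intro w
        have := him w u
        rw [← hu'] at this
        exact mul_right_cancel₀ hu this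
      · right
        intro w
        have := him w u
        rw [← neg_eq_iff_eq_neg.2 hu', mul_neg, ← neg_mul] at this
        exact mul_right_cancel₀ hu this
  rcases hcases with h1 | h1
  · exact realize_iff_of_trace_wordVal_eq φ fun w => Complex.ext (hre w) (h1 w)
  · have key := realize_iff_of_trace_wordVal_eq φ (v := v) (v' := fun i => (v' i)ᴴᵀ) fun w => by
      rw [wordVal_conj, Matrix.trace_transpose, Matrix.trace_conjTranspose]
      exact Complex.ext (hre w) (h1 w)
    rw [key]
    exact StrongHomClass.realize_formula (conjEntries n) φ

theorem traceInv_mem {X : Type} {A : Subring (X → ℝ)} {v : Fin m → X → Matrix (Fin n) (Fin n) ℂ}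
    (hv : ∀ i, EntriesIn A (v i)) (j) : (fun x => traceInv (fun i => v i x) j) ∈ A := by
  have hw : ∀ w, EntriesIn A fun x => wordVal (fun i => v i x) w := by
    intro w
    induction w with
    | nil =>
      simp only [wordVal_nil]
      exact EntriesIn.one
    | cons i w ih =>
      simp only [wordVal_cons]
      refine EntriesIn.mul ?_ ih
      unfold starGen
      split_ifs
      · exact (hv _).conjTranspose
      · exact hv _
  rcases j with w | ⟨w, w'⟩
  · exact A.mul_mem (ofNat_mem A 2) (hw w).trace_mem.1
  · exact A.mul_mem (ofNat_mem A 4) (A.mul_mem (hw w).trace_mem.2 (hw w').trace_mem.2)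

/-- The common zeros of a family of functions in a finitely generated ring are the common zeros of
a finite subfamily. -/
theorem exists_finset_common_zeros {Y J : Type*} {s : Set (Y → ℝ)} (hs : s.Finite)
    {f : J → Y → ℝ} (hf : ∀ j, f j ∈ Subring.closure s) :
    ∃ W : Finset J, ∀ y, (∀ j ∈ W, f j y = 0) → ∀ j, f j y = 0 := by
  classical
  have := is_noetherian_subring_closure s hs
  let g : J → Subring.closure s := fun j => ⟨f j, hf j⟩
  obtain ⟨t, hts, ht⟩ := Submodule.fg_span_iff_fg_span_finset_subset (Set.range g) |>.1
    (IsNoetherian.noetherian (Ideal.span (Set.range g)))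
  choose i hi using fun a : t => hts a.2
  refine ⟨t.attach.image i, fun y hy j => ?_⟩
  have hle : Ideal.span (t : Set (Subring.closure s)) ≤ RingHom.ker (evalAt _ y) := by
    rw [Ideal.span_le]
    intro a ha
    have := hy (i ⟨a, ha⟩) (Finset.mem_image_of_mem _ (Finset.mem_attach _ _))
    exact (congrArg (fun b : Subring.closure s => b.1 y) (hi ⟨a, ha⟩)).symm.trans this
  have hj : g j ∈ Submodule.span (Subring.closure s) (Set.range g) :=
    Submodule.subset_span ⟨j, rfl⟩
  rw [ht] at hj
  exact hle hj

/-- Finitely many of the trace invariants determine all of them. -/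
theorem exists_finset_traceInv (n m : ℕ) :
    ∃ W : Finset (List (Fin m × Bool) ⊕ List (Fin m × Bool) × List (Fin m × Bool)),
      ∀ v v' : Fin m → Matrix (Fin n) (Fin n) ℂ,
        (∀ j ∈ W, traceInv v j = traceInv v' j) → traceInv v = traceInv v' := by
  let Y := (Fin m → Matrix (Fin n) (Fin n) ℂ) × (Fin m → Matrix (Fin n) (Fin n) ℂ)
  let c : Fin m × Fin n × Fin n → Bool → Bool → Y → ℝ := fun p a b y =>
    let M := (if a then y.1 else y.2) p.1 p.2.1 p.2.2
    if b then M.re else M.im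
  let s : Set (Y → ℝ) := Set.range fun q : (Fin m × Fin n × Fin n) × Bool × Bool =>
    c q.1 q.2.1 q.2.2
  have hc : ∀ p a b, c p a b ∈ Subring.closure s := fun p a b =>
    Subring.subset_closure ⟨(p, a, b), rfl⟩
  have h1 : ∀ i, EntriesIn (Subring.closure s) fun y : Y => y.1 i := fun i k l =>
    ⟨hc (i, k, l) true true, hc (i, k, l) true false⟩
  have h2 : ∀ i, EntriesIn (Subring.closure s) fun y : Y => y.2 i := fun i k l =>
    ⟨hc (i, k, l) false true, hc (i, k, l) false false⟩
  obtain ⟨W, hW⟩ := exists_finset_common_zeros (Set.finite_range _)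
    fun j => (Subring.closure s).sub_mem (traceInv_mem h1 j) (traceInv_mem h2 j)
  refine ⟨W, fun v v' h => funext fun j => sub_eq_zero.1 ?_⟩
  exact hW (v, v') (fun j hj => sub_eq_zero.2 (h j hj)) j

end Invariants

section QuantifierFree

variable {n m : ℕ}

namespace MatTerm

variable {α : Type}

/-- The term `0`. -/
def zero : matLang.Term α := Term.func (l := 0) MatFunc.zero Fin.elim0

/-- The term `1`. -/
def one : matLang.Term α := Term.func (l := 0) MatFunc.one Fin.elim0

/-- The sum of two terms. -/
def add (s t : matLang.Term α) : matLang.Term α := Term.func (l := 2) MatFunc.add ![s, t]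

/-- The product of two terms. -/
def mul (s t : matLang.Term α) : matLang.Term α := Term.func (l := 2) MatFunc.mul ![s, t]

/-- The trace of a term. -/
def tr (t : matLang.Term α) : matLang.Term α := Term.func (l := 1) MatFunc.tr ![t]

/-- The adjoint of a term. -/
def adj (t : matLang.Term α) : matLang.Term α := Term.func (l := 1) MatFunc.star ![t]

variable (v : α → Matrix (Fin n) (Fin n) ℂ) (s t : matLang.Term α)

theorem realize_zero : (zero : matLang.Term α).realize v = 0 := rfl

theorem realize_one : (one : matLang.Term α).realize v = 1 := rfl

theorem realize_add : (add s t).realize v = s.realize v + t.realize v := rfl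

theorem realize_mul : (mul s t).realize v = s.realize v * t.realize v := rfl

theorem realize_tr : (tr t).realize v = (t.realize v).trace • 1 := rfl

theorem realize_adj : (adj t).realize v = (t.realize v)ᴴ := rfl

end MatTerm

open MatTerm

/-- The real functions whose scalar matrices are differences of two terms. -/
def termFunctions (n m : ℕ) : Subring ((Fin m → Matrix (Fin n) (Fin n) ℂ) → ℝ) where
  carrier := {f | ∃ s t : matLang.Term (Fin m), ∀ v : Fin m → Matrix (Fin n) (Fin n) ℂ,
    s.realize v - t.realize v = (f v : ℂ) • (1 : Matrix (Fin n) (Fin n) ℂ)}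
  mul_mem' := by
    rintro f g ⟨s, t, h⟩ ⟨s', t', h'⟩
    refine ⟨add (mul s s') (mul t t'), add (mul s t') (mul t s'), fun v => ?_⟩
    have : ((f * g) v : ℂ) • (1 : Matrix (Fin n) (Fin n) ℂ) =
        ((f v : ℂ) • (1 : Matrix (Fin n) (Fin n) ℂ)) * ((g v : ℂ) • 1) := by
      rw [smul_mul_smul_comm, mul_one, Pi.mul_apply, Complex.ofReal_mul]
    rw [this, ← h, ← h']
    simp only [realize_add, realize_mul]
    noncomm_ring
  one_mem' := ⟨one, zero, fun v => by simp [realize_one, realize_zero]⟩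
  add_mem' := by
    rintro f g ⟨s, t, h⟩ ⟨s', t', h'⟩
    refine ⟨add s s', add t t', fun v => ?_⟩
    have : ((f + g) v : ℂ) • (1 : Matrix (Fin n) (Fin n) ℂ) =
        ((f v : ℂ) • (1 : Matrix (Fin n) (Fin n) ℂ)) + ((g v : ℂ) • 1) := by
      simp [add_smul]
    rw [this, ← h, ← h']
    simp only [realize_add]
    abel
  zero_mem' := ⟨zero, zero, fun v => by simp⟩
  neg_mem' := by
    rintro f ⟨s, t, h⟩
    refine ⟨t, s, fun v => ?_⟩
    rw [← neg_sub, h]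
    simp

/-- The term spelling a word. -/
def wordTerm (w : List (Fin m × Bool)) : matLang.Term (Fin m) :=
  w.foldr (fun i t => mul (if i.2 then adj (Term.var i.1) else Term.var i.1) t) one

theorem realize_wordTerm (v : Fin m → Matrix (Fin n) (Fin n) ℂ) (w : List (Fin m × Bool)) :
    (wordTerm w).realize v = wordVal v w := by
  induction w with
  | nil => exact (wordVal_nil v).symm
  | cons i w ih =>
    rw [wordVal_cons, ← ih]
    obtain ⟨i, _ | _⟩ := i <;> rfl

theorem traceInv_mem_termFunctions (j) : (fun v => traceInv v j) ∈ termFunctions n m := by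
  have hre : ∀ z : ℂ, ((2 * z.re : ℝ) : ℂ) = z + star z := fun z => by
    rw [Complex.star_def, Complex.add_conj]
  have him : ∀ z : ℂ, z - star z = 2 * z.im * Complex.I := fun z => by
    rw [Complex.star_def, Complex.sub_conj]
    push_cast
    ring
  have himim : ∀ z z' : ℂ, ((4 * (z.im * z'.im) : ℝ) : ℂ) =
      z * star z' + star z * z' - (z * z' + star z * star z') := fun z z' => by
    have : z * star z' + star z * z' - (z * z' + star z * star z') =
        -((z - star z) * (z' - star z')) := by ring
    rw [this, him, him]
    push_cast
    linear_combination (4 * z.im * z'.im : ℂ) * Complex.I_mul_I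
  rcases j with w | ⟨w, w'⟩
  · refine ⟨add (tr (wordTerm w)) (tr (adj (wordTerm w))), zero, fun v => ?_⟩
    simp only [realize_add, realize_tr, realize_adj, realize_wordTerm, realize_zero, sub_zero,
      traceInv, hre, Matrix.trace_conjTranspose, add_smul]
  · refine ⟨add (mul (tr (wordTerm w)) (tr (adj (wordTerm w'))))
        (mul (tr (adj (wordTerm w))) (tr (wordTerm w'))),
      add (mul (tr (wordTerm w)) (tr (wordTerm w')))
        (mul (tr (adj (wordTerm w))) (tr (adj (wordTerm w')))), fun v => ?_⟩
    simp only [realize_add, realize_mul, realize_tr, realize_adj, realize_wordTerm,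
      traceInv, himim, Matrix.trace_conjTranspose, add_smul, sub_smul, smul_mul_smul_comm, mul_one]

/-- The set `D` is defined by a quantifier-free formula. -/
def QFDefinable (D : Set (Fin m → Matrix (Fin n) (Fin n) ℂ)) : Prop :=
  ∃ ψ : matLang.Formula (Fin m), ψ.IsQF ∧ ∀ v, v ∈ D ↔ ψ.Realize v

namespace QFDefinable

variable {D E : Set (Fin m → Matrix (Fin n) (Fin n) ℂ)}

theorem empty : QFDefinable (∅ : Set (Fin m → Matrix (Fin n) (Fin n) ℂ)) :=
  ⟨⊥, BoundedFormula.isQF_bot, fun v => by simp [Formula.Realize]⟩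

theorem compl (h : QFDefinable D) : QFDefinable Dᶜ := by
  obtain ⟨ψ, hψ, h⟩ := h
  exact ⟨ψ.not, hψ.not, fun v => by
    rw [Set.mem_compl_iff, h, Formula.realize_not]⟩

theorem inter (hD : QFDefinable D) (hE : QFDefinable E) : QFDefinable (D ∩ E) := by
  obtain ⟨ψ, hψ, h⟩ := hD
  obtain ⟨χ, hχ, h'⟩ := hE
  exact ⟨ψ ⊓ χ, hψ.inf hχ, fun v => by rw [Set.mem_inter_iff, h, h', Formula.realize_inf]⟩

theorem union (hD : QFDefinable D) (hE : QFDefinable E) : QFDefinable (D ∪ E) := by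
  simpa [Set.compl_inter] using (hD.compl.inter hE.compl).compl

theorem nonneg (hn : 1 ≤ n) {a : (Fin m → Matrix (Fin n) (Fin n) ℂ) → ℝ}
    (ha : a ∈ termFunctions n m) : QFDefinable {v | 0 ≤ a v} := by
  obtain ⟨s, t, h⟩ := ha
  have : Nonempty (Fin n) := ⟨⟨0, hn⟩⟩
  refine ⟨Relations.formula₂ (L := matLang) MatRel.le t s,
    (BoundedFormula.IsAtomic.rel _ _).isQF, fun v => ?_⟩
  refine Iff.trans ?_ (Formula.realize_rel₂ (L := matLang)).symm
  change 0 ≤ a v ↔ (s.realize v - t.realize v).PosSemidef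
  rw [h]
  refine ⟨fun h0 => Matrix.PosSemidef.one.smul (Complex.zero_le_real.2 h0), fun h0 => ?_⟩
  have := h0.diag_nonneg (i := ⟨0, hn⟩)
  simpa using this

theorem of_signDet (hn : 1 ≤ n) (h : SignDet (termFunctions n m) D) : QFDefinable D := by
  classical
  obtain ⟨F, hF, h⟩ := h
  induction F using Finset.induction_on generalizing D with
  | empty =>
    rcases D.eq_empty_or_nonempty with rfl | ⟨x, hx⟩
    · exact empty
    · have : D = (∅ : Set _)ᶜ := by
        ext y
        simpa using (h x y (by simp)).1 hx
      rw [this]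
      exact empty.compl
  | insert a F _ ih =>
    have ha := hF a (Finset.mem_insert_self a F)
    have hsign : ∀ c : SignType, QFDefinable {v | SignType.sign (a v) = c} := by
      have h1 := nonneg hn ha
      have h2 := nonneg hn ((termFunctions n m).neg_mem ha)
      intro c
      cases c with
      | zero =>
        convert h1.inter h2 using 1
        ext v
        change SignType.sign (a v) = 0 ↔ 0 ≤ a v ∧ 0 ≤ -a v
        rw [sign_eq_zero_iff]
        grind
      | neg =>
        convert h1.compl using 1
        ext v
        change SignType.sign (a v) = -1 ↔ ¬ 0 ≤ a v
        rw [sign_eq_neg_one_iff, not_le]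
      | pos =>
        convert h2.compl using 1
        ext v
        change SignType.sign (a v) = 1 ↔ ¬ 0 ≤ -a v
        rw [sign_eq_one_iff]
        grind
    let E : SignType → Set (Fin m → Matrix (Fin n) (Fin n) ℂ) := fun c =>
      {x | ∃ y ∈ D, SignType.sign (a y) = c ∧
        ∀ b ∈ F, SignType.sign (b x) = SignType.sign (b y)}
    have hE : ∀ c, QFDefinable (E c) := fun c =>
      ih (fun b hb => hF b (Finset.mem_insert_of_mem hb)) fun x x' hxx' =>
        exists_congr fun y => and_congr_right fun _ => and_congr_right fun _ =>
          forall₂_congr fun b hb => by rw [hxx' b hb]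
    have hD : D = (E 0 ∩ {v | SignType.sign (a v) = 0} ∪ E (-1) ∩ {v | SignType.sign (a v) = -1}) ∪
        E 1 ∩ {v | SignType.sign (a v) = 1} := by
      ext x
      have key : ∀ c, x ∈ E c ∩ {v | SignType.sign (a v) = c} ↔
          x ∈ D ∧ SignType.sign (a x) = c := by
        refine fun c => ⟨?_, fun hx => ⟨⟨x, hx.1, hx.2, fun _ _ => rfl⟩, hx.2⟩⟩
        rintro ⟨⟨y, hy, hyc, hyF⟩, hxc⟩
        refine ⟨(h x y fun b hb => ?_).2 hy, hxc⟩
        rcases Finset.mem_insert.1 hb with rfl | hb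
        · exact hxc.trans hyc.symm
        · exact hyF b hb
      rw [Set.mem_union, Set.mem_union, key, key, key, ← and_or_left, ← and_or_left]
      refine (and_iff_left ?_).symm
      rcases SignType.trichotomy (SignType.sign (a x)) with h | h | h <;> simp [h]
    rw [hD]
    exact (((hE 0).inter (hsign 0)).union ((hE (-1)).inter (hsign (-1)))).union
      ((hE 1).inter (hsign 1))

end QFDefinable

end QuantifierFree

/-- The `matLang`-structure `Mat_n(ℂ)` admits quantifier elimination: every formula is
equivalent to a quantifier-free formula in the same free variables. -/
theorem matrixRing_complex_qe (n : ℕ) (hn : 1 ≤ n) (m : ℕ)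
    (φ : matLang.Formula (Fin m)) :
    ∃ ψ : matLang.Formula (Fin m), ψ.IsQF ∧
      ∀ v : Fin m → Matrix (Fin n) (Fin n) ℂ, φ.Realize v ↔ ψ.Realize v := by
  obtain ⟨W, hW⟩ := exists_finset_traceInv n m
  let B := adjoinVars (termFunctions n m) (Fin m × Fin n × Fin n × Bool)
  have hM : ∀ i : Fin m, EntriesIn B fun z => matrixOfReal z.2 i := entriesIn_matrixOfReal
  have hφ : SignDet B {z | φ.Realize (matrixOfReal z.2)} := by
    have key := signDet_realize φ hM (w := Fin.elim0) fun i => i.elim0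
    convert key using 1
    ext z
    change BoundedFormula.Realize φ _ _ ↔ BoundedFormula.Realize φ _ _
    exact iff_of_eq (congrArg _ (Subsingleton.elim _ _))
  have hinv : ∀ j, SignDet B {z | traceInv z.1 j = traceInv (matrixOfReal z.2) j} := fun j => by
    have key := SignDet.eq_zero (B.sub_mem
      (comp_fst_mem_adjoinVars (traceInv_mem_termFunctions j)) (traceInv_mem hM j))
    convert key using 1
    ext z
    exact sub_eq_zero.symm
  have hdet : SignDet B {z | φ.Realize (matrixOfReal z.2) ∧
      ∀ j ∈ W, traceInv z.1 j = traceInv (matrixOfReal z.2) j} :=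
    hφ.inter (SignDet.iInter (s := W) fun j _ => hinv j)
  have hproj := SignDet.exists_matrix (κ := Fin m) (S := fun v M => φ.Realize M ∧
    ∀ j ∈ W, traceInv v j = traceInv M j) hdet
  obtain ⟨ψ, hψ, h⟩ := QFDefinable.of_signDet hn hproj
  refine ⟨ψ, hψ, fun v => ?_⟩
  rw [← h]
  refine ⟨fun hv => ⟨v, hv, fun _ _ => rfl⟩, ?_⟩
  rintro ⟨M, hM, hvM⟩
  exact (realize_iff_of_traceInv_eq φ (hW v M hvM)).2 hM
end
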